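/- Let 1 ≤ p, q < ∞ with p ≠ q. For each n, let 𝔹_{p}^{n,sym} = {A ∈ Sym_n(ℝ) : Σ_{j=1}^n |λ_j(A)|^p ≤ 1} be the unit ball in the space of real symmetric n×n matrices with respect to the p-th power sum of eigenvalues, and let 𝔻_p^{n,sym} = vol(𝔹_p^{n,sym})^{-1/d_n} 𝔹_p^{n,sym}, where d_n = n(n+1)/2 and vol is the d_n-dimensional Lebesgue (Haar) measure on Sym_n(ℝ). Then vol(𝔻_p^{n,sym} ∩ t 𝔻_q^{n,sym}) converges, as n → ∞, to 0 if t < e^{1/(2p) − 1/(2q)} (2p/(p+q))^{1/q}, and to 1 if t > e^{1/(2p) − 1/(2q)} (2p/(p+q))^{1/q}. -/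

import Mathlib

open MeasureTheory Set Filter
open scoped ENNReal Topology Pointwise

/-- The dimension `d_n = n(n+1)/2` of the space of real symmetric `n × n` matrices. -/
def symDim (n : ℕ) : ℕ := n * (n + 1) / 2

/-- We identify `ℝ^{n × n}` (with its Euclidean metric) with the space of `n × n`
matrices. The set of (vectors representing) real symmetric matrices `A` whose
eigenvalues satisfy `Σ_j |λ_j(A)|^p ≤ 1`, i.e. the unit ball `𝔹_p^{n,sym}` inside
`Sym_n(ℝ)`. -/
noncomputable def symBall (n : ℕ) (p : ℝ) : Set (EuclideanSpace ℝ (Fin n × Fin n)) :=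
  {x | ∃ h : (Matrix.of fun i j => x (i, j)).IsHermitian,
    ∑ j, |h.eigenvalues j| ^ p ≤ 1}

/-- The `d_n`-dimensional Hausdorff measure on `ℝ^{n×n}` (serving as the Lebesgue/Haar
measure on the `d_n`-dimensional subspace `Sym_n(ℝ)`). -/
noncomputable def symVol (n : ℕ) : Measure (EuclideanSpace ℝ (Fin n × Fin n)) :=
  μH[(symDim n : ℝ)]

/-- The volume-normalized ball `𝔻_p^{n,sym} = vol(𝔹_p^{n,sym})^{-1/d_n} 𝔹_p^{n,sym}`. -/
noncomputable def symNBall (n : ℕ) (p : ℝ) : Set (EuclideanSpace ℝ (Fin n × Fin n)) :=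
  ((symVol n (symBall n p)).toReal ^ (-(1 / (symDim n : ℝ)))) • symBall n p

namespace SymBall

open Matrix

/-- Pairs of indices strictly above the diagonal. -/
abbrev UpperPair (n : ℕ) := {ij : Fin n × Fin n // ij.1 < ij.2}

/-- Coordinates of symmetric matrices: diagonal entries and entries above the diagonal. -/
abbrev SymCoord (n : ℕ) := (Fin n → ℝ) × (UpperPair n → ℝ)

/-- The symmetric matrix with given coordinates. -/
def symMat {n : ℕ} : SymCoord n →ₗ[ℝ] Matrix (Fin n) (Fin n) ℝ where
  toFun e := of fun i j =>
    if h : i < j then e.2 ⟨(i, j), h⟩ else if h : j < i then e.2 ⟨(j, i), h⟩ else e.1 i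
  map_add' a b := by ext i j; simp only [of_apply, Matrix.add_apply]; split_ifs <;> rfl
  map_smul' a b := by ext i j; simp only [of_apply, Matrix.smul_apply]; split_ifs <;> rfl

/-- The skew-symmetric matrix with given entries above the diagonal. -/
def skewMat {n : ℕ} : (UpperPair n → ℝ) →ₗ[ℝ] Matrix (Fin n) (Fin n) ℝ where
  toFun u := of fun i j =>
    if h : i < j then u ⟨(i, j), h⟩ else if h : j < i then -u ⟨(j, i), h⟩ else 0
  map_add' a b := by
    ext i j; simp only [of_apply, Matrix.add_apply]; split_ifs <;> simp [add_comm]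
  map_smul' a b := by
    ext i j; simp only [of_apply, Matrix.smul_apply]; split_ifs <;> simp

/-- The entries above the diagonal. -/
def upperEntries {n : ℕ} : Matrix (Fin n) (Fin n) ℝ →ₗ[ℝ] (UpperPair n → ℝ) where
  toFun A := fun ij => A ij.1.1 ij.1.2
  map_add' _ _ := rfl
  map_smul' _ _ := rfl

/-- The coordinates of a matrix. -/
def symCoords {n : ℕ} : Matrix (Fin n) (Fin n) ℝ →ₗ[ℝ] SymCoord n where
  toFun A := (fun i => A i i, fun ij => A ij.1.1 ij.1.2)
  map_add' _ _ := rfl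
  map_smul' _ _ := rfl

variable {n : ℕ}

lemma symMat_apply (e : SymCoord n) (i j : Fin n) : symMat e i j =
    if h : i < j then e.2 ⟨(i, j), h⟩ else if h : j < i then e.2 ⟨(j, i), h⟩ else e.1 i := rfl

lemma skewMat_apply (u : UpperPair n → ℝ) (i j : Fin n) : skewMat u i j =
    if h : i < j then u ⟨(i, j), h⟩ else if h : j < i then -u ⟨(j, i), h⟩ else 0 := rfl

lemma upperEntries_apply (A : Matrix (Fin n) (Fin n) ℝ) (ij : UpperPair n) :
    upperEntries A ij = A ij.1.1 ij.1.2 := rfl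

lemma symCoords_fst (A : Matrix (Fin n) (Fin n) ℝ) (i : Fin n) : (symCoords A).1 i = A i i := rfl

lemma symCoords_snd (A : Matrix (Fin n) (Fin n) ℝ) (ij : UpperPair n) :
    (symCoords A).2 ij = A ij.1.1 ij.1.2 := rfl

lemma symMat_transpose (e : SymCoord n) : (symMat e)ᵀ = symMat e := by
  ext i j
  simp only [symMat, LinearMap.coe_mk, AddHom.coe_mk, transpose_apply, of_apply]
  rcases lt_trichotomy i j with h | rfl | h
  · simp [h, h.not_gt]
  · simp
  · simp [h, h.not_gt]

lemma symCoords_symMat (e : SymCoord n) : symCoords (symMat e) = e := by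
  ext i
  · simp [symCoords_fst, symMat_apply]
  · simp [symCoords_snd, symMat_apply, i.2]

lemma symMat_symCoords {A : Matrix (Fin n) (Fin n) ℝ} (hA : Aᵀ = A) :
    symMat (symCoords A) = A := by
  ext i j
  simp only [symMat_apply, symCoords_fst, symCoords_snd]
  rcases lt_trichotomy i j with h | rfl | h
  · simp [h]
  · simp
  · simp only [h, h.not_gt, dif_pos]
    simpa using congr_fun (congr_fun hA i) j

lemma symMat_injective : Function.Injective (symMat (n := n)) :=
  Function.LeftInverse.injective symCoords_symMat

lemma skewMat_transpose (u : UpperPair n → ℝ) : (skewMat u)ᵀ = -skewMat u := by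
  ext i j
  simp only [skewMat, LinearMap.coe_mk, AddHom.coe_mk, transpose_apply, of_apply, Matrix.neg_apply]
  rcases lt_trichotomy i j with h | rfl | h
  · simp [h, h.not_gt]
  · simp
  · simp [h, h.not_gt]

lemma upperEntries_skewMat (u : UpperPair n → ℝ) : upperEntries (skewMat u) = u := by
  ext i
  simp [upperEntries_apply, skewMat_apply, i.2]

lemma skewMat_upperEntries {A : Matrix (Fin n) (Fin n) ℝ} (hA : Aᵀ = -A) :
    skewMat (upperEntries A) = A := by
  have key : ∀ i j, A j i = - A i j := fun i j => by
    simpa using congr_fun (congr_fun hA i) j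
  ext i j
  simp only [skewMat_apply, upperEntries_apply]
  rcases lt_trichotomy i j with h | rfl | h
  · simp [h]
  · have := key i i
    simp; linarith
  · simp only [h, h.not_gt, dif_pos]
    simpa using (key j i).symm

lemma skewMat_injective : Function.Injective (skewMat (n := n)) :=
  Function.LeftInverse.injective upperEntries_skewMat

lemma isUnit_one_add_skew {S : Matrix (Fin n) (Fin n) ℝ} (hS : Sᵀ = -S) :
    IsUnit (1 + S) := by
  rw [← mulVec_injective_iff_isUnit]
  intro x y hxy
  have h : (1 + S) *ᵥ (x - y) = 0 := by
    rw [mulVec_sub]; simpa [sub_eq_zero] using hxy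
  set v := x - y with hv
  have h1 : v ⬝ᵥ (S *ᵥ v) = 0 := by
    have h2 : v ⬝ᵥ (S *ᵥ v) = - (v ⬝ᵥ (S *ᵥ v)) := by
      conv_lhs => rw [dotProduct_comm, ← vecMul_transpose, ← dotProduct_mulVec, hS]
      simp [neg_mulVec]
    linarith
  have h3 : v ⬝ᵥ v = 0 := by
    have : v ⬝ᵥ ((1 + S) *ᵥ v) = 0 := by rw [h]; simp
    rw [add_mulVec, dotProduct_add, h1] at this
    simpa using this
  have := dotProduct_self_eq_zero.1 h3
  exact sub_eq_zero.1 this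

/-- The resolvent `(1 + S)⁻¹` of a skew-symmetric matrix. -/
noncomputable def cayleyInv (u : UpperPair n → ℝ) : Matrix (Fin n) (Fin n) ℝ :=
  (1 + skewMat u)⁻¹

/-- The Cayley transform of a skew-symmetric matrix. -/
noncomputable def cayley (u : UpperPair n → ℝ) : Matrix (Fin n) (Fin n) ℝ :=
  (2 : ℝ) • cayleyInv u - 1

lemma isUnit_one_add_skewMat (u : UpperPair n → ℝ) : IsUnit (1 + skewMat u) :=
  isUnit_one_add_skew (skewMat_transpose u)

lemma mul_cayleyInv (u : UpperPair n → ℝ) : (1 + skewMat u) * cayleyInv u = 1 :=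
  mul_nonsing_inv _ ((isUnit_iff_isUnit_det _).1 (isUnit_one_add_skewMat u))

lemma cayleyInv_mul (u : UpperPair n → ℝ) : cayleyInv u * (1 + skewMat u) = 1 :=
  nonsing_inv_mul _ ((isUnit_iff_isUnit_det _).1 (isUnit_one_add_skewMat u))

lemma cayleyInv_transpose (u : UpperPair n → ℝ) : (cayleyInv u)ᵀ = cayleyInv (-u) := by
  rw [cayleyInv, cayleyInv, transpose_nonsing_inv, transpose_add, skewMat_transpose, map_neg,
    transpose_one]

lemma cayley_transpose (u : UpperPair n → ℝ) : (cayley u)ᵀ = cayley (-u) := by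
  rw [cayley, cayley, transpose_sub, transpose_smul, cayleyInv_transpose, transpose_one]

lemma cayley_mul_cayleyInv_neg (u : UpperPair n → ℝ) :
    cayley u * cayleyInv (-u) = cayleyInv u := by
  have h1 := mul_cayleyInv (-u)
  have h2 := cayleyInv_mul u
  rw [map_neg] at h1
  have h : cayley u = cayleyInv u * (1 + -skewMat u) := by
    nth_rw 1 [cayley, ← h2]; rw [two_smul]; noncomm_ring
  rw [h, mul_assoc, h1, mul_one]

lemma cayleyInv_mul_cayley_neg (u : UpperPair n → ℝ) :
    cayleyInv u * cayley (-u) = cayleyInv (-u) := by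
  have := congr_arg transpose (cayley_mul_cayleyInv_neg u)
  rw [transpose_mul, cayley_transpose, cayleyInv_transpose, neg_neg, cayleyInv_transpose] at this
  exact this

lemma cayley_mul_transpose (u : UpperPair n → ℝ) : cayley u * (cayley u)ᵀ = 1 := by
  have h1 := cayley_mul_cayleyInv_neg u
  have h2 := cayleyInv_mul (-u)
  have h3 := cayleyInv_mul u
  rw [map_neg] at h2
  have h4 : cayley (-u) = (2 : ℝ) • cayleyInv (-u) - 1 := rfl
  rw [cayley_transpose, h4, mul_sub, mul_smul_comm, h1, cayley, mul_one, sub_sub_cancel]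

lemma cayley_transpose_mul (u : UpperPair n → ℝ) : (cayley u)ᵀ * cayley u = 1 :=
  mul_eq_one_comm.1 (cayley_mul_transpose u)

lemma cayley_injective : Function.Injective (cayley (n := n)) := by
  intro u v h
  have h1 : cayleyInv u = cayleyInv v := by
    exact smul_right_injective _ (two_ne_zero : (2 : ℝ) ≠ 0) (sub_left_injective h)
  have h2 : 1 + skewMat u = 1 + skewMat v := by
    calc 1 + skewMat u = (1 + skewMat u) * (cayleyInv v * (1 + skewMat v)) := by
          rw [cayleyInv_mul, mul_one]
      _ = 1 + skewMat v := by rw [← h1, ← mul_assoc, mul_cayleyInv, one_mul]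
  exact skewMat_injective (add_left_cancel h2)

/-- Conjugation of a symmetric matrix in coordinates. -/
def conjCoord (Q : Matrix (Fin n) (Fin n) ℝ) : SymCoord n →ₗ[ℝ] SymCoord n :=
  symCoords ∘ₗ LinearMap.mulRight ℝ Qᵀ ∘ₗ LinearMap.mulLeft ℝ Q ∘ₗ symMat

lemma conjCoord_apply (Q : Matrix (Fin n) (Fin n) ℝ) (e : SymCoord n) :
    conjCoord Q e = symCoords (Q * symMat e * Qᵀ) := rfl

lemma symMat_conjCoord (Q : Matrix (Fin n) (Fin n) ℝ) (e : SymCoord n) :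
    symMat (conjCoord Q e) = Q * symMat e * Qᵀ := by
  rw [conjCoord_apply, symMat_symCoords]
  simp [transpose_mul, symMat_transpose, mul_assoc]

/-- The logarithmic derivative of the Cayley transform, in coordinates. -/
noncomputable def cayleyDeriv (u : UpperPair n → ℝ) : (UpperPair n → ℝ) →ₗ[ℝ] (UpperPair n → ℝ) :=
  upperEntries ∘ₗ ((-2 : ℝ) • (LinearMap.mulRight ℝ (cayleyInv u) ∘ₗ
    LinearMap.mulLeft ℝ (cayleyInv (-u)) ∘ₗ skewMat))

lemma skewMat_cayleyDeriv (u H : UpperPair n → ℝ) :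
    skewMat (cayleyDeriv u H) = (-2 : ℝ) • (cayleyInv (-u) * skewMat H * cayleyInv u) := by
  refine skewMat_upperEntries
    (A := (-2 : ℝ) • (cayleyInv (-u) * skewMat H * cayleyInv u)) ?_
  simp [transpose_mul, cayleyInv_transpose, skewMat_transpose, mul_assoc]

/-- The commutator part of the derivative of the spectral parametrization. -/
def gapMap (l : Fin n → ℝ) : (UpperPair n → ℝ) →ₗ[ℝ] (UpperPair n → ℝ) :=
  LinearMap.pi fun ij => ((l ij.1.2 - l ij.1.1) • LinearMap.id) ∘ₗ LinearMap.proj ij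

lemma gapMap_apply (l : Fin n → ℝ) (u : UpperPair n → ℝ) (ij : UpperPair n) :
    gapMap l u ij = (l ij.1.2 - l ij.1.1) * u ij := rfl

lemma det_gapMap (l : Fin n → ℝ) :
    LinearMap.det (gapMap l) = ∏ ij : UpperPair n, (l ij.1.2 - l ij.1.1) := by
  rw [gapMap, LinearMap.det_pi]
  simp

/-- The spectral parametrization of symmetric matrices. -/
noncomputable def spectralMap (x : SymCoord n) : SymCoord n :=
  symCoords (cayley x.2 * diagonal x.1 * cayley (-x.2))

/-- The derivative of the spectral parametrization. -/
noncomputable def spectralDeriv (x : SymCoord n) : SymCoord n →ₗ[ℝ] SymCoord n :=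
  conjCoord (cayley x.2) ∘ₗ
    LinearMap.prodMap LinearMap.id (gapMap x.1 ∘ₗ cayleyDeriv x.2)

lemma symMat_gap (l m : Fin n → ℝ) (u : UpperPair n → ℝ) :
    symMat (m, gapMap l u) =
      diagonal m + (skewMat u * diagonal l - diagonal l * skewMat u) := by
  ext i j
  simp only [symMat, skewMat, LinearMap.coe_mk, AddHom.coe_mk, of_apply, Matrix.add_apply, Matrix.sub_apply,
    mul_diagonal, diagonal_mul, gapMap_apply]
  rcases lt_trichotomy i j with h | rfl | h
  · simp [h, h.ne]; ring
  · simp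
  · simp [h, h.not_gt, h.ne']; ring

lemma det_spectralDeriv (x : SymCoord n) : LinearMap.det (spectralDeriv x) =
    LinearMap.det (conjCoord (cayley x.2)) *
      ((∏ ij : UpperPair n, (x.1 ij.1.2 - x.1 ij.1.1)) * LinearMap.det (cayleyDeriv x.2)) := by
  rw [spectralDeriv, LinearMap.det_comp, LinearMap.det_prodMap, LinearMap.det_id, one_mul,
    LinearMap.det_comp, det_gapMap]

open Matrix.Norms.Operator

lemma hasFDerivAt_cayley (u : UpperPair n → ℝ) : HasFDerivAt cayley
    (LinearMap.toContinuousLinearMap ((-2 : ℝ) • (LinearMap.mulRight ℝ (cayleyInv u) ∘ₗ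
      LinearMap.mulLeft ℝ (cayleyInv u) ∘ₗ skewMat))) u := by
  obtain ⟨U, hU⟩ := isUnit_one_add_skewMat u
  have h0 : (cayleyInv : (UpperPair n → ℝ) → _) = fun v => Ring.inverse (1 + skewMat v) := by
    ext1 v; rw [cayleyInv, nonsing_inv_eq_ringInverse]
  have h1 := hasFDerivAt_ringInverse (𝕜 := ℝ) U
  have h2 : HasFDerivAt (fun v : UpperPair n → ℝ => 1 + skewMat v)
      (LinearMap.toContinuousLinearMap (skewMat (n := n))) u :=
    (LinearMap.toContinuousLinearMap (skewMat (n := n))).hasFDerivAt.const_add 1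
  rw [hU] at h1
  have h3 := ((h1.comp u h2).const_smul (2 : ℝ)).sub_const (1 : Matrix (Fin n) (Fin n) ℝ)
  have hinv : ((U⁻¹ : (Matrix (Fin n) (Fin n) ℝ)ˣ) : Matrix (Fin n) (Fin n) ℝ) = cayleyInv u := by
    rw [cayleyInv, nonsing_inv_eq_ringInverse, ← hU, Ring.inverse_unit]
  have h4 : (cayley : (UpperPair n → ℝ) → _) = fun v =>
      (2 : ℝ) • (Ring.inverse ∘ fun v : UpperPair n → ℝ => 1 + skewMat v) v - 1 := by
    ext1 v
    rw [cayley, h0]; rfl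
  rw [h4]
  refine h3.congr_fderiv ?_
  refine ContinuousLinearMap.ext fun H => ?_
  rw [hinv]
  change (2 : ℝ) • -(cayleyInv u * skewMat H * cayleyInv u) =
    (-2 : ℝ) • (cayleyInv u * skewMat H * cayleyInv u)
  rw [smul_neg, neg_smul]

lemma hasFDerivAt_spectralMap (x : SymCoord n) :
    HasFDerivAt spectralMap (LinearMap.toContinuousLinearMap (spectralDeriv x)) x := by
  have h1 : HasFDerivAt (fun y : SymCoord n => cayley y.2) _ x :=
    (hasFDerivAt_cayley x.2).comp x hasFDerivAt_snd
  have h2 : HasFDerivAt (fun y : SymCoord n => cayley (-y.2)) _ x :=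
    (hasFDerivAt_cayley (-x.2)).comp x (f := fun y : SymCoord n => -y.2) hasFDerivAt_snd.fun_neg
  have h3 : HasFDerivAt (fun y : SymCoord n => (diagonal y.1 : Matrix (Fin n) (Fin n) ℝ)) _ x :=
    ((LinearMap.toContinuousLinearMap (diagonalLinearMap (Fin n) ℝ ℝ)).hasFDerivAt).comp x
      hasFDerivAt_fst
  have h4 := (LinearMap.toContinuousLinearMap (symCoords (n := n))).hasFDerivAt.comp x
    ((h1.mul' h3).mul' h2)
  refine (HasFDerivAt.congr_fderiv h4 ?_ : _)
  refine ContinuousLinearMap.ext fun e => symMat_injective ?_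
  have hK := skewMat_cayleyDeriv x.2 e.2
  have e1 := cayley_mul_cayleyInv_neg x.2
  have e2 := cayleyInv_mul_cayley_neg x.2
  have hR : symMat (spectralDeriv x e) = cayley x.2 * (diagonal e.1 +
      (skewMat (cayleyDeriv x.2 e.2) * diagonal x.1 - diagonal x.1 * skewMat (cayleyDeriv x.2 e.2)))
        * cayley (-x.2) := by
    rw [spectralDeriv, LinearMap.comp_apply, symMat_conjCoord, ← symMat_gap, cayley_transpose]
    rfl
  have hR' : symMat (spectralDeriv x e) = cayley x.2 * diagonal e.1 * cayley (-x.2)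
      + ((-2 : ℝ) • (cayleyInv x.2 * skewMat e.2 * cayleyInv x.2) * diagonal x.1 * cayley (-x.2)
      - cayley x.2 * diagonal x.1 *
        ((-2 : ℝ) • (cayleyInv (-x.2) * skewMat e.2 * cayleyInv (-x.2)))) := by
    have e3 : cayley x.2 * skewMat (cayleyDeriv x.2 e.2) =
        (-2 : ℝ) • (cayleyInv x.2 * skewMat e.2 * cayleyInv x.2) := by
      rw [hK, mul_smul_comm, ← mul_assoc, ← mul_assoc, e1]
    have e4 : skewMat (cayleyDeriv x.2 e.2) * cayley (-x.2) =
        (-2 : ℝ) • (cayleyInv (-x.2) * skewMat e.2 * cayleyInv (-x.2)) := by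
      rw [hK, smul_mul_assoc, mul_assoc, e2]
    rw [hR, ← e3, ← e4]
    noncomm_ring
  rw [LinearMap.coe_toContinuousLinearMap', hR']
  have hs : ∀ A : Matrix (Fin n) (Fin n) ℝ, symMat (spectralDeriv x e) = A →
      symMat (symCoords A) = A := fun A hA => symMat_symCoords (by rw [← hA, symMat_transpose])
  rw [← hs _ hR']
  refine congrArg symMat (congrArg symCoords ?_)
  change cayley x.2 * diagonal x.1 * ((-2 : ℝ) • (cayleyInv (-x.2) * skewMat (-e.2) * cayleyInv (-x.2))) +
    (cayley x.2 * diagonal e.1 + ((-2 : ℝ) • (cayleyInv x.2 * skewMat e.2 * cayleyInv x.2)) * diagonal x.1)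
      * cayley (-x.2) = _
  have e5 : cayleyInv (-x.2) * skewMat (-e.2) * cayleyInv (-x.2) =
      -(cayleyInv (-x.2) * skewMat e.2 * cayleyInv (-x.2)) := by
    rw [map_neg, mul_neg, neg_mul]
  rw [e5, smul_neg, mul_neg, add_mul]
  abel

end SymBall

namespace SymBall

open Matrix

variable {n : ℕ}

/-- The diagonal matrix of a vector of signs. -/
def signDiag (ε : Fin n → ℤˣ) : Matrix (Fin n) (Fin n) ℝ := diagonal fun i => ((ε i : ℤ) : ℝ)

lemma signDiag_mul (ε ε' : Fin n → ℤˣ) : signDiag ε * signDiag ε' = signDiag (ε * ε') := by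
  simp [signDiag, diagonal_mul_diagonal]

lemma signDiag_one : signDiag (1 : Fin n → ℤˣ) = 1 := by
  simp [signDiag]

lemma mul_self_eq_one (ε : Fin n → ℤˣ) : ε * ε = 1 := by
  ext1 i; simp [Int.units_mul_self]

lemma signDiag_mul_self (ε : Fin n → ℤˣ) : signDiag ε * signDiag ε = 1 := by
  rw [signDiag_mul, mul_self_eq_one, signDiag_one]

lemma signDiag_transpose (ε : Fin n → ℤˣ) : (signDiag ε)ᵀ = signDiag ε := diagonal_transpose _

lemma signDiag_conj (ε : Fin n → ℤˣ) (l : Fin n → ℝ) :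
    signDiag ε * diagonal l * signDiag ε = diagonal l := by
  have : signDiag ε * diagonal l = diagonal l * signDiag ε := by
    simp only [signDiag, diagonal_mul_diagonal]; congr 1; ext i; exact mul_comm _ _
  rw [this, mul_assoc, signDiag_mul_self, mul_one]

/-- A matrix can be moved away from the eigenvalue `-1` by changing signs of columns. -/
lemma exists_det_one_add_mul_signDiag_ne_zero (M : Matrix (Fin n) (Fin n) ℝ) :
    ∃ ε, (1 + M * signDiag ε).det ≠ 0 := by
  set f : (Fin n → ℝ) → ℝ := fun x => (1 + M * diagonal x).det with hf
  have aff : ∀ (x : Fin n → ℝ) (a : Fin n), f (Function.update x a 1) + f (Function.update x a (-1))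
      = 2 * f (Function.update x a 0) := by
    intro x a
    have h : ∀ t : ℝ, f (Function.update x a t) =
        (updateCol (1 + M * diagonal x) a (Pi.single a 1)).det +
          t * (updateCol (1 + M * diagonal x) a (fun i => M i a)).det := by
      intro t
      rw [← det_updateCol_smul, ← det_updateCol_add]
      refine congrArg det ?_
      ext i j
      by_cases hj : j = a
      · subst hj
        simp [mul_diagonal, one_apply, Pi.single_apply, mul_comm]
      · simp [mul_diagonal, hj]
    rw [h, h, h]; ring
  have key : ∀ s : Finset (Fin n), ∃ x : Fin n → ℝ, (∀ i ∈ s, x i = 1 ∨ x i = -1) ∧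
      (∀ i ∉ s, x i = 0) ∧ f x ≠ 0 := by
    intro s
    induction s using Finset.induction_on with
    | empty =>
      refine ⟨0, by simp, by simp, ?_⟩
      have : (diagonal 0 : Matrix (Fin n) (Fin n) ℝ) = 0 := diagonal_zero
      simp [hf, this]
    | insert a s ha ih =>
      obtain ⟨x, h1, h2, h3⟩ := ih
      have hx : Function.update x a 0 = x := by rw [← h2 a ha]; exact Function.update_eq_self a x
      have h4 := aff x a
      rw [hx] at h4
      have h5 : f (Function.update x a 1) ≠ 0 ∨ f (Function.update x a (-1)) ≠ 0 := by
        by_contra! hc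
        rw [hc.1, hc.2] at h4
        exact h3 (by linarith)
      have aux : ∀ t : ℝ, (t = 1 ∨ t = -1) →
          (∀ i ∈ insert a s, Function.update x a t i = 1 ∨ Function.update x a t i = -1) ∧
          (∀ i ∉ insert a s, Function.update x a t i = 0) := by
        intro t ht
        constructor
        · intro i hi
          by_cases hia : i = a
          · subst hia; simpa using ht
          · rw [Function.update_of_ne hia]
            exact h1 i (Finset.mem_of_mem_insert_of_ne hi hia)
        · intro i hi
          rw [Finset.mem_insert, not_or] at hi
          rw [Function.update_of_ne hi.1]; exact h2 i hi.2
      rcases h5 with h5 | h5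
      · exact ⟨_, (aux 1 (Or.inl rfl)).1, (aux 1 (Or.inl rfl)).2, h5⟩
      · exact ⟨_, (aux (-1) (Or.inr rfl)).1, (aux (-1) (Or.inr rfl)).2, h5⟩
  obtain ⟨x, h1, -, h3⟩ := key Finset.univ
  refine ⟨fun i => if x i = 1 then 1 else -1, ?_⟩
  have : signDiag (fun i => if x i = 1 then 1 else -1) = diagonal x := by
    rw [signDiag]; congr 1; ext i
    rcases h1 i (Finset.mem_univ i) with h | h
    · simp [h]
    · norm_num [h]
  rw [this]; exact h3

/-- The inverse of the Cayley transform. -/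
noncomputable def cayleyCoord (Q : Matrix (Fin n) (Fin n) ℝ) : UpperPair n → ℝ :=
  upperEntries ((2 : ℝ) • (1 + Q)⁻¹ - 1)

lemma cayley_cayleyCoord {Q : Matrix (Fin n) (Fin n) ℝ} (hQ : Q * Qᵀ = 1)
    (hdet : (1 + Q).det ≠ 0) : cayley (cayleyCoord Q) = Q := by
  have hu : IsUnit (1 + Q).det := isUnit_iff_ne_zero.2 hdet
  have hQ' : Qᵀ * Q = 1 := mul_eq_one_comm.1 hQ
  have h1 := mul_nonsing_inv (1 + Q) hu
  have h2 := nonsing_inv_mul (1 + Q) hu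
  set R := (1 + Q)⁻¹ with hR
  have hRT : Rᵀ = Q * R := by
    have h3 : Rᵀ * (1 + Qᵀ) = 1 := by
      have := congrArg transpose h1
      simpa [transpose_mul] using this
    calc Rᵀ = Rᵀ * ((1 + Qᵀ) * (Q * R)) := by
          rw [← mul_assoc (1 + Qᵀ), add_mul 1, one_mul, hQ', add_comm Q, h1, mul_one]
      _ = Q * R := by rw [← mul_assoc, h3, one_mul]
  have hskew : ((2 : ℝ) • R - 1)ᵀ = -((2 : ℝ) • R - 1) := by
    rw [transpose_sub, transpose_smul, hRT, transpose_one]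
    have : Q * R = 1 - R := by rw [← h1]; noncomm_ring
    rw [this, smul_sub, two_smul ℝ (1 : Matrix (Fin n) (Fin n) ℝ)]; abel
  have h4 : skewMat (cayleyCoord Q) = (2 : ℝ) • R - 1 := skewMat_upperEntries hskew
  have h5 : cayleyInv (cayleyCoord Q) = (1 / 2 : ℝ) • (1 + Q) := by
    rw [cayleyInv, h4]
    refine inv_eq_left_inv ?_
    rw [add_sub_cancel, smul_mul_smul_comm, h1]
    norm_num
  rw [cayley, h5, smul_smul]; norm_num

lemma det_one_add_cayley_ne_zero (u : UpperPair n → ℝ) : (1 + cayley u).det ≠ 0 := by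
  have h : 1 + cayley u = (2 : ℝ) • cayleyInv u := by rw [cayley, add_sub_cancel]
  rw [h, det_smul]
  refine mul_ne_zero (by positivity) ?_
  have := congrArg det (mul_cayleyInv u)
  rw [det_mul, det_one] at this
  exact right_ne_zero_of_mul (this ▸ one_ne_zero)

lemma cayleyCoord_cayley (u : UpperPair n → ℝ) : cayleyCoord (cayley u) = u :=
  cayley_injective (cayley_cayleyCoord (cayley_mul_transpose u) (det_one_add_cayley_ne_zero u))

/-- A Borel set of representatives of orthogonal matrices modulo signs of the columns. -/
noncomputable def cayleyDom (n : ℕ) : Set (UpperPair n → ℝ) :=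
  {u | ∀ ε, (1 + cayley u * signDiag ε).det ≠ 0 →
    embeddingReal _ u ≤ embeddingReal _ (cayleyCoord (cayley u * signDiag ε))}

lemma continuous_cayley : Continuous (cayley (n := n)) := by
  refine continuous_iff_continuousAt.2 fun u => ?_
  exact (hasFDerivAt_cayley u).continuousAt

lemma measurable_cayleyCoord_comp {α : Type*} [MeasurableSpace α]
    {f : α → Matrix (Fin n) (Fin n) ℝ} (hf : ∀ i j, Measurable fun a => f a i j) :
    Measurable fun a => cayleyCoord (f a) := by
  refine measurable_pi_iff.2 fun ij => ?_
  have h1 : ∀ i j, Measurable fun a => (1 + f a) i j := fun i j => by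
    simpa using (hf i j).const_add _
  have hd : Measurable fun a => (1 + f a).det := by
    simp only [det_apply]
    exact Finset.measurable_sum _ fun σ _ =>
      (Finset.measurable_prod _ fun i _ => h1 _ _).const_smul _
  have ha : ∀ i j, Measurable fun a => (1 + f a).adjugate i j := fun i j => by
    simp only [adjugate_apply, det_apply]
    refine Finset.measurable_sum _ fun σ _ =>
      (Finset.measurable_prod _ fun k _ => ?_).const_smul _
    simp only [updateRow_apply]
    split_ifs
    · exact measurable_const
    · exact h1 _ _
  simp only [cayleyCoord, upperEntries_apply, Matrix.sub_apply, Matrix.smul_apply, inv_def,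
    Ring.inverse_eq_inv']
  exact (((hd.inv).smul (ha _ _)).const_smul (2 : ℝ)).sub_const _

lemma measurableSet_cayleyDom : MeasurableSet (cayleyDom n) := by
  have hc : ∀ (ε : Fin n → ℤˣ), Continuous fun u : UpperPair n → ℝ => cayley u * signDiag ε :=
    fun ε => continuous_cayley.mul continuous_const
  have h0 : Measurable (embeddingReal (UpperPair n → ℝ)) :=
    (measurableEmbedding_embeddingReal _).measurable
  rw [cayleyDom, Set.ofPred_forall]
  refine MeasurableSet.iInter fun ε => ?_
  have h1 : Measurable fun u : UpperPair n → ℝ =>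
      embeddingReal (UpperPair n → ℝ) (cayleyCoord (cayley u * signDiag ε)) :=
    h0.comp (measurable_cayleyCoord_comp fun i j => ((hc ε).matrix_elem i j).measurable)
  have h2 : MeasurableSet {u : UpperPair n → ℝ | (1 + cayley u * signDiag ε).det ≠ 0} :=
    ((continuous_const.add (hc ε)).matrix_det.measurable (measurableSet_singleton 0).compl)
  simp only [imp_iff_not_or, Set.ofPred_or]
  exact h2.compl.union (measurableSet_le h0 h1)

lemma exists_mem_cayleyDom {Q : Matrix (Fin n) (Fin n) ℝ} (hQ : Q * Qᵀ = 1) :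
    ∃ u ∈ cayleyDom n, ∃ ε, Q = cayley u * signDiag ε := by
  classical
  obtain ⟨ε₀, h₀⟩ := exists_det_one_add_mul_signDiag_ne_zero Q
  have hne : (Finset.univ.filter fun ε : Fin n → ℤˣ => (1 + Q * signDiag ε).det ≠ 0).Nonempty :=
    ⟨ε₀, by simpa using h₀⟩
  obtain ⟨ε, hε, hmin⟩ := Finset.exists_min_image _
    (fun ε => embeddingReal _ (cayleyCoord (Q * signDiag ε))) hne
  have hε' : (1 + Q * signDiag ε).det ≠ 0 := by simpa using hε
  have hort : (Q * signDiag ε) * (Q * signDiag ε)ᵀ = 1 := by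
    rw [transpose_mul, signDiag_transpose, mul_assoc, ← mul_assoc (signDiag ε),
      signDiag_mul_self, one_mul, hQ]
  have hc := cayley_cayleyCoord hort hε'
  refine ⟨cayleyCoord (Q * signDiag ε), ?_, ε, ?_⟩
  · intro ε' h'
    rw [hc, mul_assoc, signDiag_mul] at h' ⊢
    exact hmin _ (by simpa using h')
  · rw [hc, mul_assoc, signDiag_mul_self, mul_one]

lemma eq_of_mem_cayleyDom {u v : UpperPair n → ℝ} (hu : u ∈ cayleyDom n) (hv : v ∈ cayleyDom n)
    {ε : Fin n → ℤˣ} (h : cayley u = cayley v * signDiag ε) : u = v := by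
  have h' : cayley v = cayley u * signDiag ε := by
    rw [h, mul_assoc, signDiag_mul_self, mul_one]
  have h1 := hu ε (by rw [← h']; exact det_one_add_cayley_ne_zero v)
  have h2 := hv ε (by rw [← h]; exact det_one_add_cayley_ne_zero u)
  rw [← h', cayleyCoord_cayley] at h1
  rw [← h, cayleyCoord_cayley] at h2
  exact (measurableEmbedding_embeddingReal _).injective (le_antisymm h1 h2)

/-- Coordinates of symmetric matrices with spectrum in `S`. -/
def specSet (S : Set (Fin n → ℝ)) : Set (SymCoord n) :=
  {e | ∃ l ∈ S, ∃ Q : Matrix (Fin n) (Fin n) ℝ, Q * Qᵀ = 1 ∧ symMat e = Q * diagonal l * Qᵀ}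

lemma symMat_spectralMap (x : SymCoord n) :
    symMat (spectralMap x) = cayley x.2 * diagonal x.1 * (cayley x.2)ᵀ := by
  rw [spectralMap, ← cayley_transpose, symMat_symCoords]
  simp [transpose_mul, mul_assoc]

lemma specSet_eq_image (S : Set (Fin n → ℝ)) :
    specSet S = spectralMap '' (S ×ˢ cayleyDom n) := by
  ext e
  constructor
  · rintro ⟨l, hl, Q, hQ, he⟩
    obtain ⟨u, hu, ε, rfl⟩ := exists_mem_cayleyDom hQ
    refine ⟨(l, u), ⟨hl, hu⟩, symMat_injective ?_⟩
    rw [symMat_spectralMap, he, transpose_mul, signDiag_transpose]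
    calc _ = cayley u * (signDiag ε * diagonal l * signDiag ε) * (cayley u)ᵀ := by
          rw [signDiag_conj]
      _ = _ := by simp only [mul_assoc]
  · rintro ⟨⟨l, u⟩, ⟨hl, hu⟩, rfl⟩
    exact ⟨l, hl, cayley u, cayley_mul_transpose u, symMat_spectralMap _⟩

lemma eq_of_conj_diagonal {l m : Fin n → ℝ} (hl : StrictMono l) (hm : StrictMono m)
    {P Q : Matrix (Fin n) (Fin n) ℝ} (hP : P * Pᵀ = 1) (hQ : Q * Qᵀ = 1)
    (h : P * diagonal l * Pᵀ = Q * diagonal m * Qᵀ) : l = m := by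
  have key : ∀ (k : Fin n → ℝ) (R : Matrix (Fin n) (Fin n) ℝ), R * Rᵀ = 1 →
      (R * diagonal k * Rᵀ).charpoly = (diagonal k).charpoly := by
    intro k R hR
    rw [charpoly_mul_comm, ← mul_assoc, mul_eq_one_comm.1 hR, one_mul]
  have h1 : (diagonal l).charpoly = (diagonal m).charpoly := by
    rw [← key l P hP, ← key m Q hQ, h]
  rw [charpoly_diagonal, charpoly_diagonal] at h1
  refine (hl.range_inj hm).1 ?_
  ext x
  have h2 := congrArg (Polynomial.eval x) h1
  simp only [Polynomial.eval_prod, Polynomial.eval_sub, Polynomial.eval_X,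
    Polynomial.eval_C] at h2
  have h3 : ∀ k : Fin n → ℝ, x ∈ Set.range k ↔ ∏ i, (x - k i) = 0 := fun k => by
    simp only [Finset.prod_eq_zero_iff, Finset.mem_univ, true_and, sub_eq_zero, Set.mem_range,
      eq_comm (a := x)]
  rw [h3, h3, h2]

lemma injOn_spectralMap : InjOn spectralMap ({l | StrictMono l} ×ˢ cayleyDom n) := by
  rintro ⟨l, u⟩ ⟨hl, hu⟩ ⟨m, v⟩ ⟨hm, hv⟩ h
  simp only [mem_ofPred_eq] at hl hm hu hv
  have h1 : cayley u * diagonal l * (cayley u)ᵀ = cayley v * diagonal m * (cayley v)ᵀ := by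
    have := congrArg symMat h
    rwa [symMat_spectralMap, symMat_spectralMap] at this
  obtain rfl : l = m :=
    eq_of_conj_diagonal hl hm (cayley_mul_transpose u) (cayley_mul_transpose v) h1
  set P := (cayley v)ᵀ * cayley u with hP
  have hvP : cayley v * P = cayley u := by rw [hP, ← mul_assoc, cayley_mul_transpose, one_mul]
  have hcomm : P * diagonal l = diagonal l * P := by
    calc P * diagonal l = (cayley v)ᵀ * (cayley u * diagonal l * (cayley u)ᵀ) * cayley u := by
          simp only [hP, mul_assoc, cayley_transpose_mul, mul_one]
      _ = ((cayley v)ᵀ * cayley v) * (diagonal l * P) := by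
          rw [h1]; simp only [hP, mul_assoc]
      _ = diagonal l * P := by rw [cayley_transpose_mul, one_mul]
  have hoff : ∀ i j, i ≠ j → P i j = 0 := by
    intro i j hij
    have := congr_fun (congr_fun hcomm i) j
    rw [mul_diagonal, diagonal_mul] at this
    have h2 : P i j * (l j - l i) = 0 := by linarith
    rcases mul_eq_zero.1 h2 with h3 | h3
    · exact h3
    · exact absurd (hl.injective (sub_eq_zero.1 h3)).symm hij
  have hPP : P * Pᵀ = 1 := by
    rw [hP, transpose_mul, transpose_transpose, mul_assoc, ← mul_assoc (cayley u),
      cayley_mul_transpose, one_mul, cayley_transpose_mul]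
  have hdiag : P = diagonal fun i => P i i := by
    ext i j
    by_cases hij : i = j
    · subst hij; simp
    · rw [hoff i j hij, diagonal_apply_ne _ hij]
  have hsq : ∀ i, P i i = 1 ∨ P i i = -1 := by
    intro i
    rw [hdiag, diagonal_transpose, diagonal_mul_diagonal] at hPP
    have := congr_fun (congr_fun hPP i) i
    rw [diagonal_apply_eq, one_apply_eq] at this
    exact mul_self_eq_one_iff.1 this
  classical
  have hsign : P = signDiag fun i => if P i i = 1 then 1 else -1 := by
    conv_lhs => rw [hdiag]
    rw [signDiag]
    congr 1; ext i
    rcases hsq i with h | h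
    · simp [h]
    · norm_num [h]
  have := eq_of_mem_cayleyDom hu hv (by rw [← hsign, hvP])
  rw [this]

end SymBall

namespace SymBall

open Matrix

variable {n : ℕ}

/-- The absolute value of the Vandermonde product. -/
noncomputable def vand (x : Fin n → ℝ) : ℝ := ∏ i, ∏ j ∈ Finset.Ioi i, |x j - x i|

lemma vand_eq_abs_det (x : Fin n → ℝ) : vand x = |(vandermonde x).det| := by
  rw [det_vandermonde, Finset.abs_prod, vand]
  simp only [Finset.abs_prod]

lemma vand_nonneg (x : Fin n → ℝ) : 0 ≤ vand x := by
  rw [vand_eq_abs_det]; exact abs_nonneg _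

lemma vand_comp_perm (x : Fin n → ℝ) (σ : Equiv.Perm (Fin n)) : vand (x ∘ σ) = vand x := by
  rw [vand_eq_abs_det, vand_eq_abs_det]
  have : vandermonde (x ∘ σ) = (vandermonde x).submatrix σ id := by ext i j; simp [vandermonde]
  rw [this, det_permute, abs_mul]
  rcases Int.units_eq_one_or (Equiv.Perm.sign σ) with h | h <;> simp [h]

lemma vand_eq_zero_iff (x : Fin n → ℝ) : vand x = 0 ↔ ¬ Function.Injective x := by
  rw [vand_eq_abs_det, abs_eq_zero, ← not_iff_not, not_not, ← ne_eq,
    det_vandermonde_ne_zero_iff]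

lemma continuous_vand : Continuous (vand (n := n)) := by
  unfold vand; fun_prop

lemma vand_eq_prod_upperPair (x : Fin n → ℝ) :
    vand x = ∏ ij : UpperPair n, |x ij.1.2 - x ij.1.1| := by
  have h1 : ∏ ij : UpperPair n, |x ij.1.2 - x ij.1.1| =
      ∏ ij ∈ (Finset.univ : Finset (Fin n × Fin n)).filter (fun ij => ij.1 < ij.2),
        |x ij.2 - x ij.1| := by
    rw [Finset.prod_subtype (p := fun ij : Fin n × Fin n => ij.1 < ij.2)
      (f := fun ij => |x ij.2 - x ij.1|)]
    simp
  rw [h1, Finset.prod_filter, Fintype.prod_prod_type, vand]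
  refine Finset.prod_congr rfl fun i _ => ?_
  rw [← Finset.prod_filter]
  refine Finset.prod_congr ?_ fun _ _ => rfl
  ext j; simp

/-- The angular part of the Jacobian of the spectral parametrization. -/
noncomputable def cayleyDensity (u : UpperPair n → ℝ) : ℝ :=
  |LinearMap.det (conjCoord (cayley u)) * LinearMap.det (cayleyDeriv u)|

lemma abs_det_spectralDeriv (x : SymCoord n) :
    |LinearMap.det (spectralDeriv x)| = vand x.1 * cayleyDensity x.2 := by
  rw [det_spectralDeriv, vand_eq_prod_upperPair, cayleyDensity, abs_mul, abs_mul, abs_mul,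
    Finset.abs_prod]
  ring

lemma measurable_cayleyDensity : Measurable (cayleyDensity (n := n)) := by
  set l : Fin n → ℝ := fun i => (i : ℝ) with hl
  have hl0 : vand l ≠ 0 := by
    rw [ne_eq, vand_eq_zero_iff, not_not]
    intro i j h
    exact Fin.ext (by simpa [hl] using h)
  have h : ∀ u : UpperPair n → ℝ,
      cayleyDensity u = |(fderiv ℝ spectralMap (l, u)).det| / vand l := by
    intro u
    rw [(hasFDerivAt_spectralMap (l, u)).fderiv, eq_div_iff hl0, mul_comm]
    exact (abs_det_spectralDeriv (l, u)).symm
  rw [show (cayleyDensity (n := n)) = fun u => _ from funext h]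
  have h1 : Measurable fun u : UpperPair n → ℝ => fderiv ℝ spectralMap (l, u) :=
    (measurable_fderiv ℝ (spectralMap (n := n))).comp (measurable_const.prodMk measurable_id)
  exact ((ContinuousLinearMap.continuous_det.measurable.comp h1).abs).div_const _

instance : (volume : Measure (SymCoord n)).IsAddHaarMeasure :=
  Measure.prod.instIsAddHaarMeasure _ _

lemma volume_specSet_ties : volume (specSet {l : Fin n → ℝ | ¬ Function.Injective l}) = 0 := by
  rw [specSet_eq_image]
  refine addHaar_image_eq_zero_of_det_fderivWithin_eq_zero volume
    (fun x _ => (hasFDerivAt_spectralMap x).hasFDerivWithinAt) ?_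
  rintro ⟨l, u⟩ ⟨hl, -⟩
  have h : vand l = 0 := (vand_eq_zero_iff l).2 hl
  rw [ContinuousLinearMap.det, LinearMap.coe_toContinuousLinearMap, ← abs_eq_zero,
    abs_det_spectralDeriv, h, zero_mul]

/-- The angular constant in the Weyl integration formula. -/
noncomputable def weylConst (n : ℕ) : ℝ≥0∞ :=
  ∫⁻ u in cayleyDom n, ENNReal.ofReal (cayleyDensity u)

/-- The open Weyl chamber. -/
def chamber (n : ℕ) : Set (Fin n → ℝ) := {l | StrictMono l}

lemma isOpen_chamber : IsOpen (chamber n) := by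
  have : chamber n = ⋂ i, ⋂ j, {l : Fin n → ℝ | i < j → l i < l j} := by
    ext l; simp [chamber, StrictMono]
  rw [this]
  refine isOpen_iInter_of_finite fun i => isOpen_iInter_of_finite fun j => ?_
  by_cases h : i < j
  · simp only [h, true_imp_iff]
    exact isOpen_lt (continuous_apply i) (continuous_apply j)
  · simp [h]

lemma volume_specSet_of_subset_chamber {S : Set (Fin n → ℝ)} (hS : MeasurableSet S)
    (hSc : S ⊆ chamber n) :
    volume (specSet S) = weylConst n * ∫⁻ x in S, ENNReal.ofReal (vand x) := by
  rw [specSet_eq_image, ← lintegral_abs_det_fderiv_eq_addHaar_image volume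
    (hS.prod measurableSet_cayleyDom) (fun x _ => (hasFDerivAt_spectralMap x).hasFDerivWithinAt)
    (injOn_spectralMap.mono (prod_mono hSc subset_rfl))]
  have h : ∀ x : SymCoord n, ENNReal.ofReal
      |(LinearMap.toContinuousLinearMap (spectralDeriv x)).det| =
      ENNReal.ofReal (vand x.1) * ENNReal.ofReal (cayleyDensity x.2) := by
    intro x
    rw [ContinuousLinearMap.det, LinearMap.coe_toContinuousLinearMap, abs_det_spectralDeriv,
      ENNReal.ofReal_mul (vand_nonneg _)]
  simp_rw [h]
  rw [Measure.volume_eq_prod, ← Measure.prod_restrict]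
  refine (lintegral_prod_mul (f := fun x : Fin n → ℝ => ENNReal.ofReal (vand x))
    (g := fun u : UpperPair n → ℝ => ENNReal.ofReal (cayleyDensity u))
    continuous_vand.measurable.ennreal_ofReal.aemeasurable
    measurable_cayleyDensity.ennreal_ofReal.aemeasurable).trans ?_
  rw [mul_comm, weylConst]

lemma specSet_univ : specSet (univ : Set (Fin n → ℝ)) = univ := by
  refine eq_univ_of_forall fun e => ?_
  have hA : (symMat e).IsHermitian := by
    rw [IsHermitian, conjTranspose_eq_transpose_of_trivial]; exact symMat_transpose e
  refine ⟨hA.eigenvalues, mem_univ _, hA.eigenvectorUnitary, ?_, ?_⟩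
  · have := (mem_unitaryGroup_iff (A := (hA.eigenvectorUnitary : Matrix (Fin n) (Fin n) ℝ))).1
      hA.eigenvectorUnitary.2
    rwa [star_eq_conjTranspose, conjTranspose_eq_transpose_of_trivial] at this
  · have := hA.spectral_theorem
    rw [Unitary.conjStarAlgAut_apply, star_eq_conjTranspose,
      conjTranspose_eq_transpose_of_trivial] at this
    exact this

lemma specSet_mono {S T : Set (Fin n → ℝ)} (h : S ⊆ T) : specSet S ⊆ specSet T :=
  fun _ ⟨l, hl, r⟩ => ⟨l, h hl, r⟩

lemma specSet_subset_of_perm {S : Set (Fin n → ℝ)}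
    (hS : ∀ (σ : Equiv.Perm (Fin n)), ∀ l ∈ S, l ∘ σ ∈ S) :
    specSet S ⊆ specSet (S ∩ chamber n) ∪ specSet {l | ¬ Function.Injective l} := by
  rintro e ⟨l, hl, Q, hQ, he⟩
  by_cases hinj : Function.Injective l
  · left
    set σ := Tuple.sort l with hσ
    have hmono : StrictMono (l ∘ σ) :=
      (Tuple.monotone_sort l).strictMono_of_injective (hinj.comp σ.injective)
    refine ⟨l ∘ σ, ⟨hS σ l hl, hmono⟩, Q.submatrix id σ, ?_, ?_⟩
    · rw [transpose_submatrix, submatrix_mul_equiv, hQ]; simp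
    · have : diagonal (l ∘ σ) = (diagonal l).submatrix σ σ := by
        rw [submatrix_diagonal_equiv]
      rw [this, transpose_submatrix, submatrix_mul_equiv, submatrix_mul_equiv, he]
      simp
  · right
    exact ⟨l, hinj, Q, hQ, he⟩

lemma volume_specSet_of_perm {S : Set (Fin n → ℝ)} (hSm : MeasurableSet S)
    (hS : ∀ (σ : Equiv.Perm (Fin n)), ∀ l ∈ S, l ∘ σ ∈ S) :
    volume (specSet S) = weylConst n * ∫⁻ x in S ∩ chamber n, ENNReal.ofReal (vand x) := by
  rw [← volume_specSet_of_subset_chamber (hSm.inter isOpen_chamber.measurableSet)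
    inter_subset_right]
  refine le_antisymm ?_ (measure_mono (specSet_mono inter_subset_left))
  refine (measure_mono (specSet_subset_of_perm hS)).trans ((measure_union_le _ _).trans ?_)
  rw [volume_specSet_ties, add_zero]

lemma weylConst_ne_zero : weylConst n ≠ 0 := by
  intro h
  have := volume_specSet_of_perm (n := n) MeasurableSet.univ (fun _ _ _ => mem_univ _)
  rw [h, zero_mul, specSet_univ] at this
  exact (NeZero.ne (volume (univ : Set (SymCoord n)))) this

lemma abs_le_one_of_orthogonal {Q : Matrix (Fin n) (Fin n) ℝ} (hQ : Q * Qᵀ = 1) (i j : Fin n) :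
    |Q i j| ≤ 1 := by
  have h : ∑ k, Q i k * Q i k = 1 := by
    have := congr_fun (congr_fun hQ i) i
    simpa [mul_apply] using this
  have h2 : Q i j * Q i j ≤ 1 := by
    rw [← h]
    exact Finset.single_le_sum (f := fun k => Q i k * Q i k) (fun k _ => mul_self_nonneg _)
      (Finset.mem_univ j)
  exact abs_le_one_iff_mul_self_le_one.2 h2

lemma volume_specSet_ball_lt_top (R : ℝ) :
    volume (specSet {l : Fin n → ℝ | ∀ i, |l i| ≤ R}) < ∞ := by
  have hsub : specSet {l : Fin n → ℝ | ∀ i, |l i| ≤ R} ⊆ Metric.closedBall 0 (n * |R|) := by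
    rintro e ⟨l, hl, Q, hQ, he⟩
    have key : ∀ i j, |symMat e i j| ≤ n * |R| := by
      intro i j
      rw [he, mul_apply]
      simp only [mul_diagonal, transpose_apply]
      refine (Finset.abs_sum_le_sum_abs _ _).trans ?_
      have : ∀ k ∈ Finset.univ, |Q i k * l k * Q j k| ≤ |R| := by
        intro k _
        rw [abs_mul, abs_mul]
        have h1 := abs_le_one_of_orthogonal hQ i k
        have h2 := abs_le_one_of_orthogonal hQ j k
        have h3 := (hl k).trans (le_abs_self R)
        calc |Q i k| * |l k| * |Q j k| ≤ 1 * |R| * 1 := by gcongr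
          _ = |R| := by ring
      refine (Finset.sum_le_sum this).trans ?_
      simp
    rw [mem_closedBall_zero_iff]
    have hpos : 0 ≤ n * |R| := by positivity
    refine max_le ((pi_norm_le_iff_of_nonneg hpos).2 fun i => ?_)
      ((pi_norm_le_iff_of_nonneg hpos).2 fun ij => ?_)
    · simpa [symMat_apply] using key i i
    · simpa [symMat_apply, ij.2] using key ij.1.1 ij.1.2
  exact (measure_mono hsub).trans_lt measure_closedBall_lt_top

lemma lintegral_vand_pos {S : Set (Fin n → ℝ)} (hS : IsOpen S) (hne : S.Nonempty)
    (hSc : S ⊆ chamber n) : 0 < ∫⁻ x in S, ENNReal.ofReal (vand x) := by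
  rw [setLIntegral_pos_iff continuous_vand.measurable.ennreal_ofReal]
  have : (Function.support fun x : Fin n → ℝ => ENNReal.ofReal (vand x)) ∩ S = S := by
    refine inter_eq_right.2 fun x hx => ?_
    have h0 : vand x ≠ 0 := by
      rw [ne_eq, vand_eq_zero_iff, not_not]; exact (hSc hx).injective
    simpa using lt_of_le_of_ne (vand_nonneg x) h0.symm
  rw [this]
  exact hS.measure_pos _ hne

lemma weylConst_ne_top : weylConst n ≠ ∞ := by
  intro h
  set S : Set (Fin n → ℝ) := chamber n ∩ {l | ∀ i, |l i| < n + 1} with hS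
  have hopen : IsOpen S := by
    refine isOpen_chamber.inter ?_
    rw [Set.ofPred_forall]
    exact isOpen_iInter_of_finite fun i => isOpen_lt (continuous_apply i).abs continuous_const
  have hne : S.Nonempty := by
    refine ⟨fun i => (i : ℝ), fun i j hij => by simpa using hij, fun i => ?_⟩
    have : ((i : ℕ) : ℝ) < n := by exact_mod_cast i.2
    rw [abs_of_nonneg (by positivity)]; linarith
  have h1 := volume_specSet_of_subset_chamber hopen.measurableSet
    (inter_subset_left : S ⊆ chamber n)
  rw [h, ENNReal.top_mul (lintegral_vand_pos hopen hne inter_subset_left).ne'] at h1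
  have h2 : volume (specSet S) < ∞ :=
    (measure_mono (specSet_mono fun l hl i => (hl.2 i).le)).trans_lt
      (volume_specSet_ball_lt_top ((n : ℝ) + 1))
  exact h2.ne h1

lemma measurePreserving_comp_perm (σ : Equiv.Perm (Fin n)) :
    MeasurePreserving (fun x : Fin n → ℝ => x ∘ σ) := by
  have := volume_preserving_arrowCongr' (σ⁻¹ : Equiv.Perm (Fin n)) (MeasurableEquiv.refl ℝ)
    (MeasurePreserving.id _)
  exact this

lemma lintegral_vand_eq_chamber {S : Set (Fin n → ℝ)} (hSm : MeasurableSet S)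
    (hS : ∀ (σ : Equiv.Perm (Fin n)), ∀ l ∈ S, l ∘ σ ∈ S) :
    ∫⁻ x in S, ENNReal.ofReal (vand x) =
      (n.factorial : ℝ≥0∞) * ∫⁻ x in S ∩ chamber n, ENNReal.ofReal (vand x) := by
  have hSiff : ∀ (σ : Equiv.Perm (Fin n)) l, l ∘ σ ∈ S ↔ l ∈ S := by
    intro σ l
    refine ⟨fun h => ?_, hS σ l⟩
    have := hS σ⁻¹ _ h
    convert this using 1
    ext i; simp
  set V : Equiv.Perm (Fin n) → Set (Fin n → ℝ) :=
    fun σ => (fun x : Fin n → ℝ => x ∘ σ) ⁻¹' (S ∩ chamber n) with hV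
  have hmeas : ∀ σ, MeasurableSet (V σ) := fun σ =>
    (measurePreserving_comp_perm σ).measurable (hSm.inter isOpen_chamber.measurableSet)
  have hdisj : Pairwise (Function.onFun Disjoint V) := by
    intro σ τ hne
    rw [Function.onFun, Set.disjoint_left]
    rintro x ⟨-, h1⟩ ⟨-, h2⟩
    have h1' : StrictMono (x ∘ σ) := h1
    have h2' : StrictMono (x ∘ τ) := h2
    have h3 : x ∘ σ = x ∘ τ := by
      refine (h1'.range_inj h2').1 ?_
      rw [σ.surjective.range_comp, τ.surjective.range_comp]
    have hx : Function.Injective x := by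
      have := h1'.injective.comp (σ⁻¹).injective
      convert this using 1
      ext i; simp
    exact hne (Equiv.ext fun i => hx (congr_fun h3 i))
  have hU : ∀ x ∈ S, x ∉ ⋃ σ, V σ → vand x = 0 := by
    intro x hx hxV
    rw [vand_eq_zero_iff]
    intro hinj
    refine hxV (mem_iUnion.2 ⟨Tuple.sort x, (hSiff _ _).2 hx, ?_⟩)
    exact (Tuple.monotone_sort x).strictMono_of_injective (hinj.comp (Tuple.sort x).injective)
  have hUS : (⋃ σ, V σ) ⊆ S := iUnion_subset fun σ x hx => (hSiff σ x).1 hx.1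
  have h1 : ∫⁻ x in S, ENNReal.ofReal (vand x) =
      ∫⁻ x in ⋃ σ, V σ, ENNReal.ofReal (vand x) := by
    rw [← lintegral_inter_add_sdiff _ S (MeasurableSet.iUnion hmeas), inter_eq_right.2 hUS,
      setLIntegral_eq_zero (hSm.diff (MeasurableSet.iUnion hmeas)), add_zero]
    intro x hx
    simp only [hU x hx.1 hx.2, ENNReal.ofReal_zero, Pi.zero_apply]
  have h2 : ∀ σ, ∫⁻ x in V σ, ENNReal.ofReal (vand x) =
      ∫⁻ x in S ∩ chamber n, ENNReal.ofReal (vand x) := by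
    intro σ
    rw [← (measurePreserving_comp_perm σ).setLIntegral_comp_preimage
      (hSm.inter isOpen_chamber.measurableSet) continuous_vand.measurable.ennreal_ofReal]
    simp_rw [vand_comp_perm]
    rfl
  rw [h1, lintegral_iUnion hmeas hdisj, tsum_fintype]
  simp_rw [h2]
  rw [Finset.sum_const, Finset.card_univ, Fintype.card_perm, Fintype.card_fin, nsmul_eq_mul]

/-- Weyl integration formula for permutation invariant sets, up to a constant. -/
lemma exists_volume_specSet (n : ℕ) : ∃ C : ℝ≥0∞, C ≠ 0 ∧ C ≠ ∞ ∧ ∀ S : Set (Fin n → ℝ),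
    MeasurableSet S → (∀ (σ : Equiv.Perm (Fin n)), ∀ l ∈ S, l ∘ σ ∈ S) →
    volume (specSet S) = C * ∫⁻ x in S, ENNReal.ofReal (vand x) := by
  have hf : (n.factorial : ℝ≥0∞) ≠ 0 := by exact_mod_cast n.factorial_ne_zero
  have hf' : (n.factorial : ℝ≥0∞) ≠ ∞ := ENNReal.natCast_ne_top _
  refine ⟨weylConst n * (n.factorial : ℝ≥0∞)⁻¹, mul_ne_zero weylConst_ne_zero
    (ENNReal.inv_ne_zero.2 hf'), ENNReal.mul_ne_top weylConst_ne_top (ENNReal.inv_ne_top.2 hf),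
    fun S hSm hS => ?_⟩
  rw [volume_specSet_of_perm hSm hS, lintegral_vand_eq_chamber hSm hS, mul_assoc, ← mul_assoc _⁻¹,
    ENNReal.inv_mul_cancel hf hf', one_mul]

end SymBall

namespace SymBall

open Matrix Module

variable {n : ℕ}

/-- The embedding of symmetric matrices in Euclidean space. -/
noncomputable def symEmb (n : ℕ) : SymCoord n →ₗ[ℝ] EuclideanSpace ℝ (Fin n × Fin n) where
  toFun e := WithLp.toLp 2 fun ij => symMat e ij.1 ij.2
  map_add' a b := by ext ij; simp
  map_smul' a b := by ext ij; simp

lemma symEmb_apply (e : SymCoord n) (ij : Fin n × Fin n) : symEmb n e ij = symMat e ij.1 ij.2 := rfl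

lemma symEmb_injective : Function.Injective (symEmb n) := by
  intro a b h
  refine symMat_injective ?_
  ext i j
  rw [← symEmb_apply a (i, j), h]; rfl

lemma of_symEmb (e : SymCoord n) : (of fun i j => symEmb n e (i, j)) = symMat e := rfl

lemma card_upperPair : Fintype.card (UpperPair n) = n * (n - 1) / 2 := by
  have h : Fintype.card (UpperPair n) = ∑ j : Fin n, (j : ℕ) := by
    rw [Fintype.card_subtype, Finset.card_filter, Fintype.sum_prod_type_right]
    refine Finset.sum_congr rfl fun j _ => ?_
    rw [← Finset.card_filter]
    have : (Finset.univ.filter fun i : Fin n => i < j) = Finset.Iio j := by ext; simp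
    rw [this, Fin.card_Iio]
  rw [h, Fin.sum_univ_eq_sum_range (fun j => j), Finset.sum_range_id]

lemma symDim_eq : symDim n = n + n * (n - 1) / 2 := by
  rw [symDim]
  rcases n with _ | n
  · rfl
  · rw [Nat.add_sub_cancel, show (n + 1) * (n + 1 + 1) = (n + 1) * n + (n + 1) * 2 by ring,
      Nat.add_mul_div_right _ _ two_pos, add_comm]

lemma finrank_symCoord : finrank ℝ (SymCoord n) = symDim n := by
  rw [finrank_prod, finrank_fintype_fun_eq_card, finrank_fintype_fun_eq_card, Fintype.card_fin,
    card_upperPair, symDim_eq]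

lemma exists_symVol_symEmb_image (n : ℕ) : ∃ c : ℝ≥0∞, c ≠ 0 ∧ c ≠ ∞ ∧
    ∀ A : Set (SymCoord n), symVol n (symEmb n '' A) = c * volume A := by
  set R := LinearMap.range (symEmb n)
  set e : SymCoord n ≃ₗ[ℝ] R := LinearEquiv.ofInjective (symEmb n) symEmb_injective with he
  have hdim : finrank ℝ R = symDim n := by rw [← e.finrank_eq, finrank_symCoord]
  have hH : (μH[(symDim n : ℝ)] : Measure R).IsAddHaarMeasure := by
    rw [← hdim]; infer_instance
  have hM : ((volume : Measure (SymCoord n)).map e).IsAddHaarMeasure :=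
    e.toContinuousLinearEquiv.isAddHaarMeasure_map volume
  have heq := Measure.isAddLeftInvariant_eq_smul (μH[(symDim n : ℝ)] : Measure R)
    ((volume : Measure (SymCoord n)).map e)
  set c := Measure.addHaarScalarFactor (μH[(symDim n : ℝ)] : Measure R)
    ((volume : Measure (SymCoord n)).map e) with hc
  refine ⟨c, ?_, ENNReal.coe_ne_top, fun A => ?_⟩
  · exact_mod_cast (Measure.addHaarScalarFactor_pos_of_isAddHaarMeasure _ _).ne'
  · have h1 : symEmb n '' A = Subtype.val '' (e '' A) := by
      rw [image_image]; rfl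
    have hA : e ⁻¹' (e '' A) = A := preimage_image_eq _ e.injective
    let em : SymCoord n ≃ᵐ R := e.toContinuousLinearEquiv.toHomeomorph.toMeasurableEquiv
    have hem : (volume : Measure (SymCoord n)).map e (e '' A) = volume A := by
      have := em.map_apply (μ := (volume : Measure (SymCoord n))) (e '' A)
      refine this.trans ?_
      exact congrArg volume hA
    rw [symVol, h1, isometry_subtype_coe.hausdorffMeasure_image (Or.inl (by positivity)), heq,
      Measure.smul_apply, hem]
    rfl

/-- Symmetric sets of vectors. -/
def IsSymm (S : Set (Fin n → ℝ)) : Prop :=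
  ∀ l m : Fin n → ℝ, Finset.univ.val.map l = Finset.univ.val.map m → l ∈ S → m ∈ S

lemma IsSymm.perm {S : Set (Fin n → ℝ)} (hS : IsSymm S) (σ : Equiv.Perm (Fin n)) :
    ∀ l ∈ S, l ∘ σ ∈ S := by
  intro l hl
  refine hS l _ ?_ hl
  rw [← Multiset.map_map, ← σ.coe_toEmbedding, ← Finset.map_val, Finset.map_univ_equiv]

lemma roots_charpoly_conj_diagonal {k : Fin n → ℝ} {R : Matrix (Fin n) (Fin n) ℝ}
    (hR : R * Rᵀ = 1) : (R * diagonal k * Rᵀ).charpoly.roots = Finset.univ.val.map k := by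
  have h : (Finset.univ.val.map fun i => Polynomial.X - Polynomial.C (k i)) =
      (Finset.univ.val.map k).map fun a => Polynomial.X - Polynomial.C a := by
    rw [Multiset.map_map]; rfl
  rw [charpoly_mul_comm, ← mul_assoc, mul_eq_one_comm.1 hR, one_mul, charpoly_diagonal,
    Finset.prod, h, Polynomial.roots_multiset_prod_X_sub_C]

lemma map_eq_map_of_conj {l m : Fin n → ℝ}
    {P Q : Matrix (Fin n) (Fin n) ℝ} (hP : P * Pᵀ = 1) (hQ : Q * Qᵀ = 1)
    (h : P * diagonal l * Pᵀ = Q * diagonal m * Qᵀ) :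
    Finset.univ.val.map l = Finset.univ.val.map m := by
  rw [← roots_charpoly_conj_diagonal hP, ← roots_charpoly_conj_diagonal hQ, h]

lemma specSet_inter {S T : Set (Fin n → ℝ)} (hS : IsSymm S) :
    specSet (S ∩ T) = specSet S ∩ specSet T := by
  refine Subset.antisymm (fun e he => ⟨specSet_mono inter_subset_left he,
    specSet_mono inter_subset_right he⟩) ?_
  rintro e ⟨⟨l, hl, Q, hQ, h⟩, ⟨m, hm, P, hP, h'⟩⟩
  exact ⟨m, ⟨hS l m (map_eq_map_of_conj hQ hP (h.symm.trans h')) hl, hm⟩, P, hP, h'⟩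

lemma smul_specSet (a : ℝ) (S : Set (Fin n → ℝ)) : a • specSet S = specSet (a • S) := by
  have hd : ∀ l : Fin n → ℝ, diagonal (a • l) = a • diagonal l := fun l => by
    rw [diagonal_smul]
  ext e
  constructor
  · rintro ⟨e, ⟨l, hl, Q, hQ, h⟩, rfl⟩
    refine ⟨a • l, smul_mem_smul_set hl, Q, hQ, ?_⟩
    simp only [map_smul, h, hd, mul_smul_comm, smul_mul_assoc]
  · rintro ⟨_, ⟨l, hl, rfl⟩, Q, hQ, h⟩
    refine ⟨symCoords (Q * diagonal l * Qᵀ), ⟨l, hl, Q, hQ, symMat_symCoords ?_⟩, ?_⟩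
    · simp [transpose_mul, mul_assoc]
    · refine symMat_injective ?_
      simp only [map_smul, h, hd, mul_smul_comm, smul_mul_assoc]
      rw [symMat_symCoords]
      simp [transpose_mul, mul_assoc]

/-- The set of symmetric matrices with spectrum in `S`. -/
def symSet (S : Set (Fin n → ℝ)) : Set (EuclideanSpace ℝ (Fin n × Fin n)) :=
  symEmb n '' specSet S

lemma smul_symSet (a : ℝ) (S : Set (Fin n → ℝ)) : a • symSet S = symSet (a • S) := by
  rw [symSet, symSet, ← smul_specSet, image_smul_comm]
  intro b; exact map_smul _ _ _

lemma symSet_inter {S T : Set (Fin n → ℝ)} (hS : IsSymm S) :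
    symSet (S ∩ T) = symSet S ∩ symSet T := by
  rw [symSet, specSet_inter hS, image_inter symEmb_injective]; rfl

/-- The measure with Vandermonde density. -/
noncomputable def vandMeasure (n : ℕ) : Measure (Fin n → ℝ) :=
  volume.withDensity fun x => ENNReal.ofReal (vand x)

lemma vandMeasure_apply (S : Set (Fin n → ℝ)) :
    vandMeasure n S = ∫⁻ x in S, ENNReal.ofReal (vand x) := withDensity_apply' _ _

lemma exists_symVol_symSet (n : ℕ) : ∃ C : ℝ≥0∞, C ≠ 0 ∧ C ≠ ∞ ∧ ∀ S : Set (Fin n → ℝ),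
    MeasurableSet S → IsSymm S → symVol n (symSet S) = C * vandMeasure n S := by
  obtain ⟨c, hc, hc', h⟩ := exists_symVol_symEmb_image n
  obtain ⟨C, hC, hC', h'⟩ := exists_volume_specSet n
  refine ⟨c * C, mul_ne_zero hc hC, ENNReal.mul_ne_top hc' hC', fun S hS hS' => ?_⟩
  rw [symSet, h, h' S hS (fun σ l hl => hS'.perm σ l hl), mul_assoc, vandMeasure_apply]

/-- Balls for power sums. -/
def powBall (n : ℕ) (p a : ℝ) : Set (Fin n → ℝ) := {x | ∑ i, |x i| ^ p ≤ a}

lemma isSymm_powBall (p a : ℝ) : IsSymm (powBall n p a) := by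
  intro l m h hl
  have key : ∀ k : Fin n → ℝ, ∑ i, |k i| ^ p =
      ((Finset.univ.val.map k).map fun x => |x| ^ p).sum := by
    intro k
    rw [Multiset.map_map]; rfl
  rw [powBall, Set.mem_ofPred_eq, key] at hl ⊢
  rwa [← h]

lemma IsSymm.inter {S T : Set (Fin n → ℝ)} (hS : IsSymm S) (hT : IsSymm T) : IsSymm (S ∩ T) :=
  fun l m h hl => ⟨hS l m h hl.1, hT l m h hl.2⟩

lemma measurableSet_powBall (p a : ℝ) : MeasurableSet (powBall n p a) := by
  refine measurableSet_le ?_ measurable_const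
  fun_prop

lemma symBall_eq (p : ℝ) : symBall n p = symSet (powBall n p 1) := by
  ext x
  constructor
  · rintro ⟨h, hx⟩
    set M := (of fun i j => x (i, j) : Matrix (Fin n) (Fin n) ℝ) with hM
    have hMT : Mᵀ = M := by
      rw [← conjTranspose_eq_transpose_of_trivial]; exact h
    have hsc := symMat_symCoords hMT
    refine ⟨symCoords M, ⟨h.eigenvalues, hx, h.eigenvectorUnitary, ?_, ?_⟩, ?_⟩
    · have := (mem_unitaryGroup_iff (A := (h.eigenvectorUnitary : Matrix (Fin n) (Fin n) ℝ))).1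
        h.eigenvectorUnitary.2
      rwa [star_eq_conjTranspose, conjTranspose_eq_transpose_of_trivial] at this
    · rw [hsc]
      have := h.spectral_theorem
      rw [Unitary.conjStarAlgAut_apply, star_eq_conjTranspose,
        conjTranspose_eq_transpose_of_trivial] at this
      exact this
    · ext ij
      rw [symEmb_apply, hsc]; rfl
  · rintro ⟨e, ⟨l, hl, Q, hQ, he⟩, rfl⟩
    have hA : (of fun i j => symEmb n e (i, j)).IsHermitian := by
      rw [of_symEmb, IsHermitian, conjTranspose_eq_transpose_of_trivial]; exact symMat_transpose e
    refine ⟨hA, ?_⟩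
    refine isSymm_powBall p 1 l _ ?_ hl
    have h1 : (symMat e).charpoly.roots = Finset.univ.val.map hA.eigenvalues :=
      hA.roots_charpoly_eq_eigenvalues
    rw [← h1, he, roots_charpoly_conj_diagonal hQ]

end SymBall

namespace SymBall

open Module

variable {n : ℕ}

lemma vand_smul {a : ℝ} (ha : 0 < a) (x : Fin n → ℝ) :
    vand (a • x) = a ^ (n * (n - 1) / 2) * vand x := by
  rw [vand_eq_prod_upperPair, vand_eq_prod_upperPair, ← card_upperPair, ← Finset.card_univ,
    ← Finset.prod_const, ← Finset.prod_mul_distrib]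
  refine Finset.prod_congr rfl fun ij _ => ?_
  rw [Pi.smul_apply, Pi.smul_apply, smul_eq_mul, smul_eq_mul, ← mul_sub, abs_mul, abs_of_pos ha]

lemma vandMeasure_smul {a : ℝ} (ha : 0 < a) {S : Set (Fin n → ℝ)} (hS : MeasurableSet S) :
    vandMeasure n (a • S) = ENNReal.ofReal a ^ symDim n * vandMeasure n S := by
  rw [vandMeasure_apply, vandMeasure_apply, ← image_smul]
  rw [lintegral_image_eq_lintegral_abs_det_fderiv_mul volume hS (f := fun x => a • x)
    (f' := fun _ => a • ContinuousLinearMap.id ℝ (Fin n → ℝ))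
    (fun x _ => ((hasFDerivAt_id x).const_smul a).hasFDerivWithinAt)
    (smul_right_injective _ ha.ne').injOn]
  rw [← lintegral_const_mul _ continuous_vand.measurable.ennreal_ofReal]
  refine lintegral_congr fun x => ?_
  have hdet : (a • ContinuousLinearMap.id ℝ (Fin n → ℝ)).det = a ^ n := by
    rw [ContinuousLinearMap.det]
    simp [LinearMap.det_smul]
  rw [hdet, vand_smul ha, ← ENNReal.ofReal_mul (abs_nonneg _), abs_of_pos (pow_pos ha n),
    ← mul_assoc, ← pow_add, ← symDim_eq, ENNReal.ofReal_mul (by positivity), ENNReal.ofReal_pow ha.le]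

lemma smul_powBall {a : ℝ} (ha : 0 < a) (p b : ℝ) :
    a • powBall n p b = powBall n p (a ^ p * b) := by
  ext x
  rw [mem_smul_set_iff_inv_smul_mem₀ ha.ne', powBall, powBall, Set.mem_ofPred_eq, Set.mem_ofPred_eq]
  have h : ∑ i, |x i| ^ p = a ^ p * ∑ i, |(a⁻¹ • x) i| ^ p := by
    rw [Finset.mul_sum]
    refine Finset.sum_congr rfl fun i _ => ?_
    rw [← Real.mul_rpow ha.le (abs_nonneg _), Pi.smul_apply, smul_eq_mul, abs_mul,
      abs_of_pos (inv_pos.2 ha), mul_inv_cancel_left₀ ha.ne']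
  rw [h, mul_le_mul_iff_of_pos_left (by positivity)]

lemma abs_le_of_mem_powBall {p a : ℝ} (hp : 1 ≤ p) {x : Fin n → ℝ} (hx : x ∈ powBall n p a)
    (i : Fin n) : |x i| ≤ max 1 a := by
  rcases le_total |x i| 1 with h | h
  · exact h.trans (le_max_left _ _)
  · refine le_trans ?_ (le_max_right _ _)
    calc |x i| ≤ |x i| ^ p := Real.self_le_rpow_of_one_le h hp
      _ ≤ ∑ j, |x j| ^ p :=
        Finset.single_le_sum (f := fun j => |x j| ^ p) (fun j _ => by positivity) (Finset.mem_univ i)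
      _ ≤ a := hx

lemma vandMeasure_box_lt_top (R : ℝ) : vandMeasure n {x | ∀ i, |x i| ≤ R} < ∞ := by
  obtain ⟨C, hC, hC', h⟩ := exists_volume_specSet n
  have hm : MeasurableSet {x : Fin n → ℝ | ∀ i, |x i| ≤ R} := by
    rw [Set.ofPred_forall]
    exact MeasurableSet.iInter fun i => measurableSet_le (by fun_prop) measurable_const
  have h1 := h {x | ∀ i, |x i| ≤ R} hm (fun σ l hl i => hl (σ i))
  rw [vandMeasure_apply]
  have h2 := volume_specSet_ball_lt_top (n := n) R
  rw [h1] at h2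
  exact (ENNReal.lt_top_of_mul_ne_top_right h2.ne hC)

lemma vandMeasure_powBall_lt_top {p : ℝ} (hp : 1 ≤ p) (a : ℝ) :
    vandMeasure n (powBall n p a) < ∞ :=
  (measure_mono fun _ hx i => abs_le_of_mem_powBall hp hx i).trans_lt
    (vandMeasure_box_lt_top (max 1 a))

lemma vandMeasure_powBall_pos {p a : ℝ} (hp : 1 ≤ p) (ha : 0 < a) :
    0 < vandMeasure n (powBall n p a) := by
  have hp0 : 0 < p := by linarith
  have hcont : Continuous fun x : Fin n → ℝ => ∑ i, |x i| ^ p :=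
    continuous_finsetSum _ fun i _ => (by fun_prop : Continuous fun x : Fin n → ℝ => |x i|).rpow_const
      fun _ => Or.inr hp0.le
  have hopen : IsOpen (chamber n ∩ {x | ∑ i, |x i| ^ p < a}) :=
    isOpen_chamber.inter (isOpen_lt hcont continuous_const)
  have hne : (chamber n ∩ {x | ∑ i, |x i| ^ p < a}).Nonempty := by
    have hc : Continuous fun e : ℝ => ∑ i : Fin n, |(e • fun j : Fin n => ((j : ℕ) : ℝ)) i| ^ p :=
      hcont.comp (by fun_prop : Continuous fun e : ℝ => e • fun j : Fin n => ((j : ℕ) : ℝ))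
    have h0 : ∑ i : Fin n, |((0 : ℝ) • fun j : Fin n => ((j : ℕ) : ℝ)) i| ^ p < a := by
      simpa [Real.zero_rpow hp0.ne'] using ha
    have hev := hc.continuousAt.eventually_lt (continuousAt_const (y := a)) h0
    obtain ⟨e, he, he0⟩ := ((hev.filter_mono nhdsWithin_le_nhds).and
      (self_mem_nhdsWithin (s := Ioi (0 : ℝ)))).exists
    refine ⟨_, ?_, he⟩
    intro i j hij
    have : (i : ℝ) < j := by exact_mod_cast hij
    simpa using mul_lt_mul_of_pos_left this he0
  have := lintegral_vand_pos hopen hne inter_subset_left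
  rw [← vandMeasure_apply] at this
  exact this.trans_le (measure_mono fun x hx => (show ∑ i, |x i| ^ p < a from hx.2).le)

/-- The Vandermonde volume of the `p`-ball of radius `n ^ (1 / p)`. -/
noncomputable def ballVol (n : ℕ) (p : ℝ) : ℝ := (vandMeasure n (powBall n p n)).toReal

lemma ballVol_pos {p : ℝ} (hp : 1 ≤ p) (hn : 0 < n) : 0 < ballVol n p :=
  ENNReal.toReal_pos (vandMeasure_powBall_pos hp (by exact_mod_cast hn)).ne'
    (vandMeasure_powBall_lt_top hp _).ne

lemma symDim_pos (hn : 0 < n) : 0 < symDim n := by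
  rw [symDim_eq]; omega

lemma ballVol_eq {p : ℝ} (hp : 1 ≤ p) (hn : 0 < n) :
    ballVol n p = ((n : ℝ) ^ (1 / p)) ^ symDim n * (vandMeasure n (powBall n p 1)).toReal := by
  have hn' : (0 : ℝ) < n := by exact_mod_cast hn
  have ha : (0 : ℝ) < (n : ℝ) ^ (1 / p) := by positivity
  have h := vandMeasure_smul ha (measurableSet_powBall (n := n) p 1)
  rw [smul_powBall ha, ← Real.rpow_mul hn'.le, one_div_mul_cancel (by linarith), Real.rpow_one,
    mul_one] at h
  rw [ballVol, h, ENNReal.toReal_mul, ENNReal.toReal_pow, ENNReal.toReal_ofReal ha.le]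

lemma rpow_neg_one_div_pow {x : ℝ} (hx : 0 < x) {d : ℕ} (hd : 0 < d) :
    (x ^ (-(1 / (d : ℝ)))) ^ d = x⁻¹ := by
  rw [← Real.rpow_natCast, ← Real.rpow_mul hx.le, neg_mul, one_div_mul_cancel, Real.rpow_neg_one]
  exact_mod_cast hd.ne'

lemma symVol_inter_eq {p q t : ℝ} (hp : 1 ≤ p) (hq : 1 ≤ q) (ht : 0 < t) (hn : 0 < n) :
    (symVol n (symNBall n p ∩ t • symNBall n q)).toReal =
      (vandMeasure n (powBall n p n ∩ powBall n q
        ((t * (ballVol n p / ballVol n q) ^ (1 / (symDim n : ℝ))) ^ q * n))).toReal /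
          ballVol n p := by
  obtain ⟨C, hC, hC', h⟩ := exists_symVol_symSet n
  have hn' : (0 : ℝ) < n := by exact_mod_cast hn
  have hd := symDim_pos hn
  set d := symDim n with hd_def
  have hd' : (d : ℝ) ≠ 0 := by exact_mod_cast hd.ne'
  set c := C.toReal with hc_def
  have hc : 0 < c := ENNReal.toReal_pos hC hC'
  set G : ℝ → ℝ := fun r => (vandMeasure n (powBall n r 1)).toReal with hG_def
  have hG : ∀ r, 1 ≤ r → 0 < G r := fun r hr =>
    ENNReal.toReal_pos (vandMeasure_powBall_pos hr one_pos).ne' (vandMeasure_powBall_lt_top hr _).ne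
  set s : ℝ → ℝ := fun r => (c * G r) ^ (-(1 / (d : ℝ))) with hs_def
  have hs : ∀ r, 1 ≤ r → 0 < s r := fun r hr => by
    have := hG r hr
    positivity
  have hN : ∀ r, 1 ≤ r → symNBall n r = symSet (powBall n r (s r ^ r)) := by
    intro r hr
    rw [symNBall, symBall_eq, h _ (measurableSet_powBall r 1) (isSymm_powBall r 1),
      ENNReal.toReal_mul, smul_symSet, smul_powBall (hs r hr), mul_one]
  rw [hN p hp, hN q hq, smul_symSet, smul_powBall ht, ← symSet_inter (isSymm_powBall _ _),
    h _ ((measurableSet_powBall _ _).inter (measurableSet_powBall _ _))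
      ((isSymm_powBall _ _).inter (isSymm_powBall _ _))]
  set l := (n : ℝ) ^ (1 / p) / s p with hl_def
  have hsp := hs p hp
  have hsq := hs q hq
  have hGp := hG p hp
  have hGq := hG q hq
  have hl : 0 < l := by positivity
  have hv := vandMeasure_smul hl ((measurableSet_powBall (n := n) p (s p ^ p)).inter
    (measurableSet_powBall q (t ^ q * s q ^ q)))
  rw [smul_set_inter₀ hl.ne', smul_powBall hl, smul_powBall hl] at hv
  have e1 : l ^ p * s p ^ p = n := by
    rw [← Real.mul_rpow hl.le hsp.le, hl_def, div_mul_cancel₀ _ hsp.ne', ← Real.rpow_mul hn'.le,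
      one_div_mul_cancel (by linarith), Real.rpow_one]
  have hbq : (ballVol n p / ballVol n q) ^ (1 / (d : ℝ)) =
      (n : ℝ) ^ (1 / p) / (n : ℝ) ^ (1 / q) * (s q / s p) := by
    rw [ballVol_eq hp hn, ballVol_eq hq hn]
    have hsr : ∀ r, 1 ≤ r → G r ^ (1 / (d : ℝ)) = (s r)⁻¹ * (c ^ (1 / (d : ℝ)))⁻¹ := by
      intro r hr
      have := hG r hr
      rw [hs_def]
      simp only
      rw [Real.rpow_neg (by positivity), inv_inv, Real.mul_rpow hc.le this.le]
      field_simp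
    have hpow : ∀ x : ℝ, 0 < x → (x ^ d) ^ (1 / (d : ℝ)) = x := fun x hx => by
      rw [← Real.rpow_natCast, ← Real.rpow_mul hx.le, mul_one_div_cancel hd', Real.rpow_one]
    rw [Real.div_rpow (by positivity) (by positivity), Real.mul_rpow (by positivity) hGp.le,
      Real.mul_rpow (by positivity) hGq.le, hpow _ (by positivity), hpow _ (by positivity),
      hsr p hp, hsr q hq]
    have : c ^ (1 / (d : ℝ)) ≠ 0 := by positivity
    field_simp
  have e2 : l ^ q * (t ^ q * s q ^ q) =
      (t * (ballVol n p / ballVol n q) ^ (1 / (d : ℝ))) ^ q * n := by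
    have hnq : (n : ℝ) = ((n : ℝ) ^ (1 / q)) ^ q := by
      rw [← Real.rpow_mul hn'.le, one_div_mul_cancel (by linarith), Real.rpow_one]
    rw [hbq]
    conv_rhs => rw [hnq]
    rw [← Real.mul_rpow ht.le hsq.le, ← Real.mul_rpow hl.le (by positivity),
      ← Real.mul_rpow (by positivity) (by positivity)]
    congr 1
    rw [← hnq, hl_def]
    field_simp
  rw [e1, e2] at hv
  rw [hv, ENNReal.toReal_mul, ENNReal.toReal_mul, ENNReal.toReal_pow, ENNReal.toReal_ofReal hl.le,
    ballVol_eq hp hn, hl_def, div_pow]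
  have e3 : (s p) ^ d = (c * G p)⁻¹ := rpow_neg_one_div_pow (by positivity) hd
  rw [e3]
  have : ((n : ℝ) ^ (1 / p)) ^ d ≠ 0 := by positivity
  change _ = _ / (_ * G p)
  field_simp
  exact mul_comm _ _

end SymBall

namespace SymBall

open scoped ComplexConjugate

/-- The regularized logarithmic kernel `log |u + i ε|`. -/
noncomputable def logKer (ε u : ℝ) : ℝ := Real.log (u ^ 2 + ε ^ 2) / 2

lemma logKer_eq_log_norm (ε u : ℝ) : logKer ε u = Real.log ‖(u : ℂ) + ε * Complex.I‖ := by
  rw [Complex.norm_add_mul_I, Real.log_sqrt (by positivity), logKer]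

lemma continuous_logKer {ε : ℝ} (hε : 0 < ε) : Continuous (logKer ε) := by
  unfold logKer
  refine (Continuous.log (by fun_prop) fun x => ?_).div_const 2
  positivity

lemma logKer_neg (ε u : ℝ) : logKer ε (-u) = logKer ε u := by
  rw [logKer, logKer, neg_sq]

lemma logKer_sub_comm (ε x y : ℝ) : logKer ε (x - y) = logKer ε (y - x) := by
  rw [← logKer_neg, neg_sub]

/-- A Cayley transform mapping the real line into the unit disc. -/
noncomputable def cay (ε : ℝ) (x : ℝ) : ℂ :=
  (x + (ε / 2 - 1 : ℝ) * Complex.I) / (x + (ε / 2 + 1 : ℝ) * Complex.I)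

lemma cay_den_ne_zero {ε : ℝ} (hε : 0 < ε) (x : ℝ) :
    (x + (ε / 2 + 1 : ℝ) * Complex.I : ℂ) ≠ 0 := by
  intro h
  have := congrArg Complex.im h
  simp at this
  linarith

lemma continuous_cay {ε : ℝ} (hε : 0 < ε) : Continuous (cay ε) := by
  unfold cay
  exact Continuous.div (by fun_prop) (by fun_prop) (cay_den_ne_zero hε)

lemma exists_norm_cay_le {ε : ℝ} (hε : 0 < ε) (R : ℝ) :
    ∃ r : ℝ, 0 ≤ r ∧ r < 1 ∧ ∀ x : ℝ, |x| ≤ R → ‖cay ε x‖ ≤ r := by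
  have hlt : ∀ x : ℝ, ‖cay ε x‖ < 1 := by
    intro x
    rw [cay, norm_div, div_lt_one (norm_pos_iff.2 (cay_den_ne_zero hε x)), Complex.norm_add_mul_I,
      Complex.norm_add_mul_I]
    refine Real.sqrt_lt_sqrt (by positivity) ?_
    nlinarith
  rcases lt_or_ge R 0 with hR | hR
  · exact ⟨0, le_rfl, one_pos, fun x hx => absurd (abs_nonneg x) (by linarith)⟩
  obtain ⟨x₀, -, h⟩ := (isCompact_Icc (a := -R) (b := R)).exists_isMaxOn
    ⟨0, by constructor <;> linarith⟩ (continuous_cay hε).norm.continuousOn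
  exact ⟨‖cay ε x₀‖, norm_nonneg _, hlt x₀, fun x hx => h (abs_le.1 hx)⟩

lemma logKer_sub_eq {ε : ℝ} (hε : 0 < ε) (x y : ℝ) :
    logKer ε (x - y) = Real.log ‖1 - cay ε x * conj (cay ε y)‖ +
      Real.log ‖(x + (ε / 2 + 1 : ℝ) * Complex.I : ℂ)‖ +
      Real.log ‖(y + (ε / 2 + 1 : ℝ) * Complex.I : ℂ)‖ - Real.log 2 := by
  have hx := cay_den_ne_zero hε x
  have hy := cay_den_ne_zero hε y
  have hy' : conj (y + (ε / 2 + 1 : ℝ) * Complex.I : ℂ) ≠ 0 := (map_ne_zero _).2 hy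
  have hε' : ((x - y : ℝ) + ε * Complex.I : ℂ) ≠ 0 := by
    intro h
    have := congrArg Complex.im h
    simp at this
    linarith
  have key : (1 - cay ε x * conj (cay ε y)) * (x + (ε / 2 + 1 : ℝ) * Complex.I) *
      conj (y + (ε / 2 + 1 : ℝ) * Complex.I : ℂ) =
      2 * (((x - y : ℝ) + ε * Complex.I) * (- Complex.I)) := by
    rw [cay, cay, map_div₀, mul_assoc, sub_mul, one_mul, div_mul_div_comm,
      div_mul_cancel₀ _ (mul_ne_zero hx hy')]
    simp only [map_add, map_mul, Complex.conj_ofReal, Complex.conj_I]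
    push_cast
    ring
  have h1 : (1 - cay ε x * conj (cay ε y)) ≠ 0 := by
    intro h
    rw [h, zero_mul, zero_mul] at key
    exact mul_ne_zero two_ne_zero (mul_ne_zero hε' (neg_ne_zero.2 Complex.I_ne_zero)) key.symm
  have := congrArg (fun z : ℂ => Real.log ‖z‖) key
  simp only [norm_mul, Complex.norm_conj, norm_neg, Complex.norm_I, mul_one, Complex.norm_ofNat]
    at this
  rw [Real.log_mul (mul_ne_zero (norm_ne_zero_iff.2 h1) (norm_ne_zero_iff.2 hx))
    (norm_ne_zero_iff.2 hy), Real.log_mul (norm_ne_zero_iff.2 h1) (norm_ne_zero_iff.2 hx),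
    Real.log_mul two_ne_zero (norm_ne_zero_iff.2 hε')] at this
  rw [logKer_eq_log_norm]
  linarith

/-- The regularized mutual energy. -/
noncomputable def energy (ε : ℝ) (μ ν : Measure ℝ) : ℝ := ∫ z, logKer ε (z.1 - z.2) ∂(μ.prod ν)

section

lemma ae_prod_abs_le {μ ν : Measure ℝ} [SFinite ν] {R : ℝ} (hμ : ∀ᵐ x ∂μ, |x| ≤ R)
    (hν : ∀ᵐ x ∂ν, |x| ≤ R) :
    ∀ᵐ z ∂(μ.prod ν), |z.1| ≤ R ∧ |z.2| ≤ R := by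
  have h1 : ∀ᵐ z ∂(μ.prod ν), |z.1| ≤ R := Measure.quasiMeasurePreserving_fst.ae hμ
  have h2 : ∀ᵐ z ∂(μ.prod ν), |z.2| ≤ R := Measure.quasiMeasurePreserving_snd.ae hν
  exact h1.and h2

variable {μ ν : Measure ℝ} [IsProbabilityMeasure μ] [IsProbabilityMeasure ν] {R ε : ℝ}

lemma integrable_of_continuous_of_ae_abs_le {E : Type*} [NormedAddCommGroup E] {f : ℝ → E}
    (hf : Continuous f) (hμ : ∀ᵐ x ∂μ, |x| ≤ R) : Integrable f μ := by
  obtain ⟨C, hC⟩ := (isCompact_Icc (a := -R) (b := R)).exists_bound_of_continuousOn hf.continuousOn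
  exact Integrable.of_bound hf.aestronglyMeasurable C
    (hμ.mono fun x hx => hC x (abs_le.1 hx))

lemma integrable_prod_of_continuous {E : Type*} [NormedAddCommGroup E] {f : ℝ × ℝ → E}
    (hf : Continuous f) (hμ : ∀ᵐ x ∂μ, |x| ≤ R) (hν : ∀ᵐ x ∂ν, |x| ≤ R) :
    Integrable f (μ.prod ν) := by
  obtain ⟨C, hC⟩ := (isCompact_Icc (a := ((-R, -R) : ℝ × ℝ)) (b := (R, R))).exists_bound_of_continuousOn
    hf.continuousOn
  exact Integrable.of_bound hf.aestronglyMeasurable C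
    ((ae_prod_abs_le hμ hν).mono fun x hx => hC x ⟨⟨(abs_le.1 hx.1).1, (abs_le.1 hx.2).1⟩,
      ⟨(abs_le.1 hx.1).2, (abs_le.1 hx.2).2⟩⟩)

lemma energy_eq (hε : 0 < ε) (hμ : ∀ᵐ x ∂μ, |x| ≤ R) (hν : ∀ᵐ x ∂ν, |x| ≤ R) :
    energy ε μ ν = ∫ x, ∫ y, logKer ε (x - y) ∂ν ∂μ :=
  integral_prod _ (integrable_prod_of_continuous ((continuous_logKer hε).comp (by fun_prop)) hμ hν)

lemma energy_comm (ε : ℝ) (μ ν : Measure ℝ) [IsProbabilityMeasure μ] [IsProbabilityMeasure ν] :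
    energy ε μ ν = energy ε ν μ := by
  rw [energy, energy, ← integral_prod_swap]
  refine integral_congr_ae (ae_of_all _ fun z => ?_)
  exact logKer_sub_comm _ _ _

lemma hasSum_energy (hε : 0 < ε) (hμ : ∀ᵐ x ∂μ, |x| ≤ R) (hν : ∀ᵐ x ∂ν, |x| ≤ R) :
    HasSum (fun k : ℕ => (((∫ x, cay ε x ^ k ∂μ) * conj (∫ x, cay ε x ^ k ∂ν)) / k).re)
      (-∫ z, Real.log ‖1 - cay ε z.1 * conj (cay ε z.2)‖ ∂(μ.prod ν)) := by
  obtain ⟨r, hr0, hr1, hr⟩ := exists_norm_cay_le hε R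
  have hc := continuous_cay hε
  have hrr : r * r < 1 := by nlinarith
  have hz : ∀ᵐ z ∂(μ.prod ν), ‖cay ε z.1 * conj (cay ε z.2)‖ ≤ r * r :=
    (ae_prod_abs_le hμ hν).mono fun z hz => by
      rw [norm_mul, Complex.norm_conj]
      exact mul_le_mul (hr _ hz.1) (hr _ hz.2) (norm_nonneg _) hr0
  have hI : ∀ k : ℕ, Integrable (fun z : ℝ × ℝ => (cay ε z.1 * conj (cay ε z.2)) ^ k / (k : ℂ))
      (μ.prod ν) := fun k => integrable_prod_of_continuous
        (((Continuous.mul (hc.comp continuous_fst)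
          (Complex.continuous_conj.comp (hc.comp continuous_snd))).pow k).div_const _) hμ hν
  have h := hasSum_integral_of_dominated_convergence (μ := μ.prod ν)
    (F := fun (k : ℕ) (z : ℝ × ℝ) => ((cay ε z.1 * conj (cay ε z.2)) ^ k / (k : ℂ)).re)
    (f := fun z => - Real.log ‖1 - cay ε z.1 * conj (cay ε z.2)‖)
    (fun k _ => (r * r) ^ k) (fun k => (hI k).re.1)
    (fun k => hz.mono fun z hz => by
      rw [Real.norm_eq_abs]
      refine (Complex.abs_re_le_norm _).trans ?_
      rw [norm_div, norm_pow]
      rcases Nat.eq_zero_or_pos k with rfl | hk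
      · simp
      · have h1 : (1 : ℝ) ≤ ‖(k : ℂ)‖ := by
          rw [Complex.norm_natCast]; exact_mod_cast hk
        exact (div_le_self (by positivity) h1).trans (pow_le_pow_left₀ (norm_nonneg _) hz k))
    (ae_of_all _ fun z => summable_geometric_of_lt_one (by positivity) hrr)
    (integrable_const _)
    (hz.mono fun z hz => by
      have := Complex.hasSum_re (Complex.hasSum_taylorSeries_neg_log (hz.trans_lt hrr))
      rwa [Complex.neg_re, Complex.log_re] at this)
  rw [integral_neg] at h
  refine h.congr_fun fun k => ?_
  have h1 : ∫ z, (cay ε z.1 * conj (cay ε z.2)) ^ k / (k : ℂ) ∂(μ.prod ν) =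
      ((∫ x, cay ε x ^ k ∂μ) * conj (∫ x, cay ε x ^ k ∂ν)) / k := by
    rw [integral_div, ← integral_conj, ← integral_prod_mul]
    simp only [mul_pow, map_pow]
  rw [← h1]
  exact (integral_re (hI k)).symm

end

lemma energy_combo_nonpos {ι : Type*} [Fintype ι] {μ : ι → Measure ℝ}
    [∀ a, IsProbabilityMeasure (μ a)] {R ε : ℝ} (hε : 0 < ε) (hμ : ∀ a, ∀ᵐ x ∂(μ a), |x| ≤ R)
    {c : ι → ℝ} (hc : ∑ a, c a = 0) :
    ∑ a, ∑ b, c a * c b * energy ε (μ a) (μ b) ≤ 0 := by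
  set h : ℝ → ℝ := fun x => Real.log ‖(x + (ε / 2 + 1 : ℝ) * Complex.I : ℂ)‖ with h_def
  have hh : Continuous h := by
    refine Continuous.log (by fun_prop) fun x => ?_
    exact norm_ne_zero_iff.2 (cay_den_ne_zero hε x)
  have hcay := continuous_cay hε
  set L : ι → ι → ℝ := fun a b =>
    ∫ z, Real.log ‖1 - cay ε z.1 * conj (cay ε z.2)‖ ∂((μ a).prod (μ b)) with hL
  have hE : ∀ a b, energy ε (μ a) (μ b) =
      L a b + ∫ x, h x ∂(μ a) + ∫ x, h x ∂(μ b) - Real.log 2 := by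
    intro a b
    have hi0 : Integrable (fun z : ℝ × ℝ => logKer ε (z.1 - z.2)) ((μ a).prod (μ b)) :=
      integrable_prod_of_continuous ((continuous_logKer hε).comp (by fun_prop)) (hμ a) (hμ b)
    have hi1 : Integrable (fun z : ℝ × ℝ => h z.1) ((μ a).prod (μ b)) :=
      integrable_prod_of_continuous (by fun_prop) (hμ a) (hμ b)
    have hi2 : Integrable (fun z : ℝ × ℝ => h z.2) ((μ a).prod (μ b)) :=
      integrable_prod_of_continuous (by fun_prop) (hμ a) (hμ b)
    have e1 : L a b = ∫ z, (logKer ε (z.1 - z.2) - h z.1 - h z.2 + Real.log 2)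
        ∂((μ a).prod (μ b)) := by
      refine integral_congr_ae (ae_of_all _ fun z => ?_)
      simp only [logKer_sub_eq hε z.1 z.2, h_def]
      ring
    have e2 : ∫ z, h z.1 ∂((μ a).prod (μ b)) = ∫ x, h x ∂(μ a) := by
      rw [integral_fun_fst]; simp
    have e3 : ∫ z, h z.2 ∂((μ a).prod (μ b)) = ∫ x, h x ∂(μ b) := by
      rw [integral_fun_snd]; simp
    have e4 : ∫ z, (logKer ε (z.1 - z.2) - h z.1 - h z.2 + Real.log 2) ∂((μ a).prod (μ b)) =
        ∫ z, (logKer ε (z.1 - z.2) - h z.1 - h z.2) ∂((μ a).prod (μ b)) +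
          ∫ _, Real.log 2 ∂((μ a).prod (μ b)) :=
      integral_add ((hi0.sub hi1).sub hi2) (integrable_const _)
    have e5 : ∫ z, (logKer ε (z.1 - z.2) - h z.1 - h z.2) ∂((μ a).prod (μ b)) =
        ∫ z, (logKer ε (z.1 - z.2) - h z.1) ∂((μ a).prod (μ b)) -
          ∫ z, h z.2 ∂((μ a).prod (μ b)) := integral_sub (hi0.sub hi1) hi2
    rw [e1, e4, e5, integral_sub hi0 hi1, e2, e3, energy, integral_const]
    rw [probReal_univ, one_smul]
    ring
  have hsum : ∑ a, ∑ b, c a * c b * energy ε (μ a) (μ b) = ∑ a, ∑ b, c a * c b * L a b := by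
    have : ∀ a, ∑ b, c a * c b * energy ε (μ a) (μ b) = ∑ b, c a * c b * L a b +
        c a * ∑ b, c b * ∫ x, h x ∂(μ b) := by
      intro a
      have e : ∀ b, c a * c b * energy ε (μ a) (μ b) = c a * c b * L a b +
        c a * (c b * ∫ x, h x ∂(μ b)) + (c a * (∫ x, h x ∂(μ a) - Real.log 2)) * c b := by
        intro b; rw [hE]; ring
      rw [Finset.sum_congr rfl fun b _ => e b, Finset.sum_add_distrib, Finset.sum_add_distrib,
        ← Finset.mul_sum, ← Finset.mul_sum, hc, mul_zero, add_zero]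
    rw [Finset.sum_congr rfl fun a _ => this a, Finset.sum_add_distrib, ← Finset.sum_mul, hc,
      zero_mul, add_zero]
  rw [hsum]
  have hS : HasSum (fun k : ℕ => ∑ a, ∑ b, c a * c b *
      (((∫ x, cay ε x ^ k ∂(μ a)) * conj (∫ x, cay ε x ^ k ∂(μ b))) / k).re)
      (∑ a, ∑ b, c a * c b * (-L a b)) :=
    hasSum_sum fun a _ => hasSum_sum fun b _ => (hasSum_energy hε (hμ a) (hμ b)).mul_left _
  have hneg : ∑ a, ∑ b, c a * c b * (-L a b) = -∑ a, ∑ b, c a * c b * L a b := by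
    simp only [mul_neg, Finset.sum_neg_distrib]
  rw [hneg] at hS
  refine neg_nonneg.1 (hS.nonneg fun k => ?_)
  have hk : ∑ a, ∑ b, c a * c b *
      (((∫ x, cay ε x ^ k ∂(μ a)) * conj (∫ x, cay ε x ^ k ∂(μ b))) / k).re =
      Complex.normSq (∑ a, c a * ∫ x, cay ε x ^ k ∂(μ a)) / k := by
    have e : ((Complex.normSq (∑ a, c a * ∫ x, cay ε x ^ k ∂(μ a)) / k : ℝ) : ℂ) =
        ∑ a, ∑ b, ((c a * c b : ℝ) : ℂ) *
          (((∫ x, cay ε x ^ k ∂(μ a)) * conj (∫ x, cay ε x ^ k ∂(μ b))) / k) := by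
      rw [Complex.ofReal_div, ← Complex.mul_conj, map_sum, Finset.sum_mul_sum, Finset.sum_div]
      refine Finset.sum_congr rfl fun a _ => ?_
      rw [Finset.sum_div]
      refine Finset.sum_congr rfl fun b _ => ?_
      rw [map_mul, Complex.conj_ofReal]
      push_cast
      ring
    have e' := congrArg Complex.re e
    rw [Complex.ofReal_re] at e'
    rw [e', Complex.re_sum]
    refine Finset.sum_congr rfl fun a _ => ?_
    rw [Complex.re_sum]
    exact Finset.sum_congr rfl fun b _ => (Complex.re_ofReal_mul _ _).symm
  rw [hk]
  exact div_nonneg (Complex.normSq_nonneg _) (Nat.cast_nonneg _)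

end SymBall

namespace SymBall

/-- The uniform probability measure on angles. -/
noncomputable def angle : Measure ℝ :=
  ENNReal.ofReal (2 * Real.pi)⁻¹ • volume.restrict (Ioc 0 (2 * Real.pi))

lemma integral_angle (f : ℝ → ℝ) :
    ∫ θ, f θ ∂angle = (2 * Real.pi)⁻¹ * ∫ θ in 0..(2 * Real.pi), f θ := by
  rw [angle, integral_smul_measure, ENNReal.toReal_ofReal (by positivity), smul_eq_mul,
    intervalIntegral.integral_of_le (by positivity)]

lemma integrable_angle {f : ℝ → ℝ} (hf : IntervalIntegrable f volume 0 (2 * Real.pi)) :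
    Integrable f angle :=
  ((intervalIntegrable_iff_integrableOn_Ioc_of_le (by positivity)).1 hf).smul_measure
    ENNReal.ofReal_ne_top

instance : IsProbabilityMeasure angle := ⟨by
  rw [angle, Measure.smul_apply, Measure.restrict_apply MeasurableSet.univ, univ_inter,
    Real.volume_Ioc, sub_zero, smul_eq_mul, ← ENNReal.ofReal_mul (by positivity),
    inv_mul_cancel₀ (by positivity), ENNReal.ofReal_one]⟩

lemma angle_absolutelyContinuous : angle ≪ volume :=
  (Measure.smul_absolutelyContinuous).trans Measure.absolutelyContinuous_restrict

lemma integrable_log_norm_circleMap_sub (w : ℂ) :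
    Integrable (fun θ => Real.log ‖circleMap 0 1 θ - w‖) angle :=
  integrable_angle (circleIntegrable_log_norm_sub_const (a := w) (c := 0) 1)

lemma integral_log_norm_circleMap_sub (w : ℂ) :
    ∫ θ, Real.log ‖circleMap 0 1 θ - w‖ ∂angle = Real.posLog ‖w‖ := by
  rw [integral_angle, ← circleAverage_log_norm_sub_const_eq_posLog, Real.circleAverage, smul_eq_mul]

/-- A Joukowski parametrization of the complex plane. -/
lemma exists_joukowski (z : ℂ) {s : ℝ} (hs : 0 < s) : ∃ w : ℂ, w ≠ 0 ∧ z = s / 2 * (w + w⁻¹) := by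
  obtain ⟨w, hw⟩ := exists_quadratic_eq_zero (a := (1 : ℂ)) (b := -(2 * z / s)) (c := 1) one_ne_zero
    (by
      obtain ⟨y, hy⟩ := IsAlgClosed.exists_pow_nat_eq (discrim (1 : ℂ) (-(2 * z / s)) 1) two_pos
      exact ⟨y, by rw [← hy, sq]⟩)
  have hs' : (s : ℂ) ≠ 0 := by exact_mod_cast hs.ne'
  have hw0 : w ≠ 0 := by
    rintro rfl
    simp at hw
  refine ⟨w, hw0, ?_⟩
  field_simp at hw ⊢
  linear_combination -hw

lemma posLog_add_posLog_inv (a : ℝ) : Real.posLog a + Real.posLog a⁻¹ = |Real.log a| := by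
  rw [← Real.half_mul_log_add_log_abs, ← Real.half_mul_log_add_log_abs, Real.log_inv, abs_neg]
  ring

lemma log_norm_sub_cos_ae (z : ℂ) {s : ℝ} (hs : 0 < s) {w : ℂ} (hw : w ≠ 0)
    (hz : z = s / 2 * (w + w⁻¹)) : ∀ᵐ θ ∂angle, Real.log ‖z - s * Real.cos θ‖ =
      Real.log (s / 2) + Real.log ‖circleMap 0 1 θ - w‖ + Real.log ‖circleMap 0 1 θ - w⁻¹‖ := by
  have hc : (circleMap 0 1 ⁻¹' ({w, w⁻¹} : Set ℂ)).Countable :=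
    (((countable_singleton _).insert _)).preimage_circleMap 0 one_ne_zero
  have h0 : ∀ᵐ θ ∂angle, θ ∉ circleMap 0 1 ⁻¹' ({w, w⁻¹} : Set ℂ) :=
    angle_absolutelyContinuous.ae_le (hc.ae_notMem volume)
  filter_upwards [h0] with θ hθ
  simp only [mem_preimage, mem_insert_iff, mem_singleton_iff, not_or] at hθ
  set ζ := circleMap 0 1 θ with hζ
  have hn : ‖ζ‖ = 1 := by rw [hζ, norm_circleMap_zero, abs_one]
  have hζ0 : ζ ≠ 0 := fun h => by simp [h] at hn
  have hcos : (Real.cos θ : ℂ) = (ζ + ζ⁻¹) / 2 := by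
    rw [hζ, circleMap, Complex.ofReal_cos, Complex.cos]
    simp [← Complex.exp_neg]
  have key : z - s * Real.cos θ = -(s / 2 : ℝ) * ζ⁻¹ * (ζ - w) * (ζ - w⁻¹) := by
    rw [hz, hcos]
    push_cast
    field_simp
    ring
  have h1 : ‖ζ - w‖ ≠ 0 := norm_ne_zero_iff.2 (sub_ne_zero.2 hθ.1)
  have h2 : ‖ζ - w⁻¹‖ ≠ 0 := norm_ne_zero_iff.2 (sub_ne_zero.2 hθ.2)
  rw [key, norm_mul, norm_mul, norm_mul, norm_neg, norm_inv, hn, Complex.norm_real,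
    Real.norm_eq_abs, abs_of_pos (by positivity), inv_one, mul_one, Real.log_mul (by positivity) h2,
    Real.log_mul (by positivity) h1]

lemma integrable_log_norm_sub_cos (z : ℂ) {s : ℝ} (hs : 0 < s) :
    Integrable (fun θ => Real.log ‖z - s * Real.cos θ‖) angle := by
  obtain ⟨w, hw, hz⟩ := exists_joukowski z hs
  refine Integrable.congr ?_ ((log_norm_sub_cos_ae z hs hw hz).mono fun _ h => h.symm)
  exact ((integrable_const _).add (integrable_log_norm_circleMap_sub w)).add
    (integrable_log_norm_circleMap_sub w⁻¹)

/-- The logarithmic potential of the arcsine law. -/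
lemma integral_log_norm_sub_cos (z : ℂ) {s : ℝ} (hs : 0 < s) :
    ∫ θ, Real.log ‖z - s * Real.cos θ‖ ∂angle =
      Real.log (s / 2) + Real.arcosh ((‖z - s‖ + ‖z + s‖) / (2 * s)) := by
  obtain ⟨w, hw, hz⟩ := exists_joukowski z hs
  have e1 : ∫ θ, (Real.log (s / 2) + Real.log ‖circleMap 0 1 θ - w‖ +
      Real.log ‖circleMap 0 1 θ - w⁻¹‖) ∂angle =
      ∫ θ, (Real.log (s / 2) + Real.log ‖circleMap 0 1 θ - w‖) ∂angle +
        ∫ θ, Real.log ‖circleMap 0 1 θ - w⁻¹‖ ∂angle :=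
    integral_add ((integrable_const _).add (integrable_log_norm_circleMap_sub w))
      (integrable_log_norm_circleMap_sub w⁻¹)
  have e2 : ∫ θ, (Real.log (s / 2) + Real.log ‖circleMap 0 1 θ - w‖) ∂angle =
      ∫ _, Real.log (s / 2) ∂angle + ∫ θ, Real.log ‖circleMap 0 1 θ - w‖ ∂angle :=
    integral_add (integrable_const _) (integrable_log_norm_circleMap_sub w)
  rw [integral_congr_ae (log_norm_sub_cos_ae z hs hw hz), e1, e2,
      integral_log_norm_circleMap_sub, integral_log_norm_circleMap_sub, integral_const, probReal_univ,
    one_smul, add_assoc, norm_inv, posLog_add_posLog_inv]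
  congr 1
  rw [← Real.arcosh_cosh (abs_nonneg _), Real.cosh_abs, Real.cosh_log (norm_pos_iff.2 hw)]
  congr 1
  have hw' : ‖w‖ ≠ 0 := norm_ne_zero_iff.2 hw
  have e1 : z - s = (s / 2 : ℝ) * (w⁻¹ * ((w - 1) * (w - 1))) := by
    rw [hz]; push_cast; field_simp; ring
  have e2 : z + s = (s / 2 : ℝ) * (w⁻¹ * ((w + 1) * (w + 1))) := by
    rw [hz]; push_cast; field_simp; ring
  have hpar := parallelogram_law_with_norm ℝ w 1
  rw [norm_one] at hpar
  rw [e1, e2]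
  simp only [norm_mul, norm_inv, Complex.norm_real, Real.norm_eq_abs, abs_of_pos (half_pos hs)]
  field_simp
  linarith

/-- The potential of the arcsine law on `[-1, 1]` relative to its equilibrium value. -/
noncomputable def green (y : ℝ) : ℝ := Real.arcosh (max 1 y)

lemma green_nonneg (y : ℝ) : 0 ≤ green y := Real.arcosh_nonneg (le_max_left _ _)

lemma green_eq_zero {y : ℝ} (hy : y ≤ 1) : green y = 0 := by
  rw [green, max_eq_left hy, Real.arcosh_zero]

lemma continuous_green : Continuous green :=
  continuousOn_univ.1 (Real.continuousOn_arcosh.comp (by fun_prop) fun _ _ => mem_Ici.2 (le_max_left _ _))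

lemma green_abs_div (x : ℝ) {s : ℝ} (hs : 0 < s) :
    (|x - s| + |x + s|) / (2 * s) = max 1 (|x| / s) := by
  have h : |x - s| + |x + s| = 2 * max s |x| := by
    rcases abs_cases x with h | h <;> rcases abs_cases (x - s) with h1 | h1 <;>
      rcases abs_cases (x + s) with h2 | h2 <;> rcases max_cases s |x| with h3 | h3 <;> linarith
  rw [h, mul_div_mul_left _ _ two_ne_zero, ← max_div_div_right hs.le, div_self hs.ne']

lemma integral_log_abs_sub_cos (x : ℝ) {s : ℝ} (hs : 0 < s) :
    ∫ θ, Real.log |x - s * Real.cos θ| ∂angle = Real.log (s / 2) + green (|x| / s) := by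
  have h := integral_log_norm_sub_cos (x : ℂ) hs
  have e : ∀ r : ℝ, ‖(x : ℂ) - r‖ = |x - r| := fun r => by
    rw [← Complex.ofReal_sub, Complex.norm_real, Real.norm_eq_abs]
  have e' : ‖(x : ℂ) + s‖ = |x + s| := by
    rw [← Complex.ofReal_add, Complex.norm_real, Real.norm_eq_abs]
  rw [e, e', green_abs_div x hs] at h
  rw [green, ← h]
  refine integral_congr_ae (ae_of_all _ fun θ => ?_)
  simp only
  rw [← e]
  push_cast
  rfl

lemma integrable_log_abs_sub_cos (x : ℝ) {s : ℝ} (hs : 0 < s) :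
    Integrable (fun θ => Real.log |x - s * Real.cos θ|) angle := by
  refine (integrable_log_norm_sub_cos (x : ℂ) hs).congr (ae_of_all _ fun θ => ?_)
  simp only
  rw [← Real.norm_eq_abs, ← Complex.norm_real]
  push_cast
  rfl

lemma arcosh_add_le {A δ : ℝ} (hA : 1 ≤ A) (hδ : 0 ≤ δ) :
    Real.arcosh (A + δ) ≤ Real.arcosh A + √(2 * δ) := by
  set a := Real.arcosh A with ha
  set b := √(2 * δ) with hb
  have ha0 : 0 ≤ a := Real.arcosh_nonneg hA
  have hb0 : 0 ≤ b := Real.sqrt_nonneg _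
  have hb2 : b ^ 2 = 2 * δ := Real.sq_sqrt (by linarith)
  rw [← Real.arcosh_cosh (add_nonneg ha0 hb0),
    Real.arcosh_le_arcosh (by linarith) (Real.cosh_pos _), Real.cosh_add]
  have hca : Real.cosh a = A := Real.cosh_arcosh hA
  have hcb : 1 + b ^ 2 / 2 ≤ Real.cosh b := by
    have h1 : Real.cosh b = 1 + 2 * Real.sinh (b / 2) ^ 2 := by
      have := Real.cosh_two_mul (b / 2)
      rw [mul_div_cancel₀ _ two_ne_zero, Real.cosh_sq] at this
      linarith
    have h2 : b / 2 ≤ Real.sinh (b / 2) := Real.self_le_sinh_iff.2 (by linarith)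
    nlinarith
  have hs : 0 ≤ Real.sinh a * Real.sinh b :=
    mul_nonneg (Real.sinh_nonneg_iff.2 ha0) (Real.sinh_nonneg_iff.2 hb0)
  rw [hca]
  nlinarith

lemma logKer_integral_cos_le {ε : ℝ} (hε : 0 < ε) (x : ℝ) {s : ℝ} (hs : 0 < s) :
    ∫ θ, logKer ε (x - s * Real.cos θ) ∂angle ≤
      Real.log (s / 2) + green (|x| / s) + √(2 * (ε / s)) := by
  have h := integral_log_norm_sub_cos (x + ε * Complex.I : ℂ) hs
  have e0 : ∫ θ, logKer ε (x - s * Real.cos θ) ∂angle =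
      ∫ θ, Real.log ‖(x + ε * Complex.I : ℂ) - s * Real.cos θ‖ ∂angle := by
    refine integral_congr_ae (ae_of_all _ fun θ => ?_)
    simp only
    rw [logKer_eq_log_norm]
    congr 2
    push_cast
    ring
  have e : ∀ r : ℝ, ‖(x + ε * Complex.I : ℂ) + r‖ ≤ |x + r| + ε := fun r => by
    rw [add_right_comm, ← Complex.ofReal_add]
    refine (norm_add_le _ _).trans (le_of_eq ?_)
    rw [Complex.norm_real, norm_mul, Complex.norm_real, Complex.norm_I, mul_one, Real.norm_eq_abs,
      Real.norm_eq_abs, abs_of_pos hε]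
  have e1 : ‖(x + ε * Complex.I : ℂ) - s‖ ≤ |x - s| + ε := by
    have := e (-s)
    rwa [Complex.ofReal_neg, ← sub_eq_add_neg, ← sub_eq_add_neg] at this
  have hpos : 0 < ‖(x + ε * Complex.I : ℂ) - s‖ := by
    refine norm_pos_iff.2 fun h0 => ?_
    have := congrArg Complex.im h0
    simp at this
    linarith
  rw [e0, h, add_assoc (Real.log _)]
  gcongr
  refine le_trans ?_ (arcosh_add_le (le_max_left 1 (|x| / s)) (by positivity))
  rw [Real.arcosh_le_arcosh (by positivity) (by positivity), ← green_abs_div x hs]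
  calc _ ≤ ((|x - s| + ε) + (|x + s| + ε)) / (2 * s) := by
        gcongr
        exact e s
    _ = _ := by field_simp; ring

lemma log_abs_le_logKer (ε : ℝ) {u : ℝ} (hu : u ≠ 0) : Real.log |u| ≤ logKer ε u := by
  have h : Real.log |u| = Real.log (u ^ 2) / 2 := by
    rw [← sq_abs, Real.log_pow]; push_cast; ring
  rw [h, logKer]
  have : Real.log (u ^ 2) ≤ Real.log (u ^ 2 + ε ^ 2) :=
    Real.log_le_log (by positivity) (by nlinarith)
  linarith

lemma le_logKer_integral_cos (ε x : ℝ) {s : ℝ} (hs : 0 < s) :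
    Real.log (s / 2) + green (|x| / s) ≤ ∫ θ, logKer ε (x - s * Real.cos θ) ∂angle := by
  have h := integral_log_norm_sub_cos (x + ε * Complex.I : ℂ) hs
  have e0 : ∫ θ, logKer ε (x - s * Real.cos θ) ∂angle =
      ∫ θ, Real.log ‖(x + ε * Complex.I : ℂ) - s * Real.cos θ‖ ∂angle := by
    refine integral_congr_ae (ae_of_all _ fun θ => ?_)
    simp only
    rw [logKer_eq_log_norm]
    congr 2
    push_cast
    ring
  have e : ∀ r : ℝ, |x + r| ≤ ‖(x + ε * Complex.I : ℂ) + r‖ := fun r => by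
    refine le_trans (le_of_eq ?_) (Complex.abs_re_le_norm _)
    simp
  have e1 : |x - s| ≤ ‖(x + ε * Complex.I : ℂ) - s‖ := by
    have := e (-s)
    rwa [Complex.ofReal_neg, ← sub_eq_add_neg, ← sub_eq_add_neg] at this
  have h1 : 1 ≤ (‖(x + ε * Complex.I : ℂ) - s‖ + ‖(x + ε * Complex.I : ℂ) + s‖) / (2 * s) := by
    refine (le_max_left 1 (|x| / s)).trans ?_
    rw [← green_abs_div x hs]
    gcongr
    exact e s
  rw [e0, h]
  gcongr
  rw [green, Real.arcosh_le_arcosh (by positivity) (by positivity), ← green_abs_div x hs]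
  gcongr
  exact e s

end SymBall

namespace SymBall

/-- The uniform probability measure on the unit interval. -/
noncomputable def unitMeas : Measure ℝ := volume.restrict (Ioc 0 1)

instance : IsProbabilityMeasure unitMeas := ⟨by
  rw [unitMeas, Measure.restrict_apply MeasurableSet.univ, univ_inter, Real.volume_Ioc, sub_zero,
    ENNReal.ofReal_one]⟩

lemma integral_unitMeas (f : ℝ → ℝ) : ∫ τ, f τ ∂unitMeas = ∫ τ in 0..1, f τ := by
  rw [unitMeas, intervalIntegral.integral_of_le zero_le_one]

lemma integrable_unitMeas {f : ℝ → ℝ} : Integrable f unitMeas ↔ IntervalIntegrable f volume 0 1 := by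
  rw [unitMeas, intervalIntegrable_iff_integrableOn_Ioc_of_le zero_le_one, IntegrableOn]

lemma unitMeas_ae : ∀ᵐ τ ∂unitMeas, τ ∈ Ioc (0 : ℝ) 1 := ae_restrict_mem measurableSet_Ioc

lemma integral_unitMeas_rpow {s : ℝ} (hs : -1 < s) : ∫ τ, τ ^ s ∂unitMeas = 1 / (s + 1) := by
  rw [integral_unitMeas, integral_rpow (Or.inl hs), Real.one_rpow, Real.zero_rpow (by linarith),
    sub_zero]

lemma integrable_unitMeas_rpow {s : ℝ} (hs : -1 < s) : Integrable (fun τ => τ ^ s) unitMeas :=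
  integrable_unitMeas.2 (intervalIntegral.intervalIntegrable_rpow' hs)

lemma integrable_unitMeas_log : Integrable Real.log unitMeas :=
  integrable_unitMeas.2 intervalIntegral.intervalIntegrable_log'

lemma integral_unitMeas_log : ∫ τ, Real.log τ ∂unitMeas = -1 := by
  rw [integral_unitMeas, integral_log]
  simp

lemma measurable_green : Measurable green := continuous_green.measurable

lemma green_mono : Monotone green := fun a b h => by
  rw [green, green, Real.arcosh_le_arcosh (by positivity) (by positivity)]
  exact max_le_max le_rfl h

lemma green_le_sqrt {y : ℝ} (hy : 0 ≤ y) : green y ≤ √(2 * y) := by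
  have h := arcosh_add_le (le_refl (1 : ℝ)) (δ := max 1 y - 1)
    (sub_nonneg.2 (le_max_left _ _))
  rw [add_sub_cancel, Real.arcosh_zero, zero_add] at h
  refine h.trans (Real.sqrt_le_sqrt ?_)
  have : max 1 y ≤ 1 + y := max_le (by linarith) (by linarith)
  linarith

/-- The absolute moments of the arcsine law. -/
noncomputable def cosMoment (r : ℝ) : ℝ := ∫ θ, |Real.cos θ| ^ r ∂angle

/-- The average of the potentials in Ullman's mixture of arcsine laws. -/
noncomputable def greenInt (r : ℝ) : ℝ := ∫ v in 0..1, green (v ^ (-r⁻¹))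

variable {r R : ℝ}

lemma exponent_bound (hr : 1 ≤ r) : -1 < -(r⁻¹ / 2) := by
  have : r⁻¹ ≤ 1 := inv_le_one_of_one_le₀ hr
  linarith

lemma integrable_green_rpow (hr : 1 ≤ r) {a : ℝ} (ha : 0 ≤ a) :
    Integrable (fun τ => green (a * τ ^ (-r⁻¹))) unitMeas := by
  refine Integrable.mono' ((integrable_unitMeas_rpow (exponent_bound hr)).const_mul √(2 * a))
    (measurable_green.comp (by fun_prop)).aestronglyMeasurable ?_
  filter_upwards [unitMeas_ae] with τ hτ
  rw [Real.norm_eq_abs, abs_of_nonneg (green_nonneg _)]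
  refine (green_le_sqrt (mul_nonneg ha (Real.rpow_nonneg hτ.1.le _))).trans (le_of_eq ?_)
  rw [← mul_assoc, Real.sqrt_mul (by positivity), Real.sqrt_eq_rpow (τ ^ _),
    ← Real.rpow_mul hτ.1.le]
  congr 2
  ring

lemma greenInt_nonneg (r : ℝ) : 0 ≤ greenInt r :=
  intervalIntegral.integral_nonneg zero_le_one fun _ _ => green_nonneg _

lemma intervalIntegrable_green (hr : 1 ≤ r) {c : ℝ} (hc : 0 ≤ c) :
    IntervalIntegrable (fun v => green (v ^ (-r⁻¹))) volume 0 c := by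
  have hr0 : 0 < r := by linarith
  have h1 : IntervalIntegrable (fun v => green (v ^ (-r⁻¹))) volume 0 1 := by
    simpa using integrable_unitMeas.1 (integrable_green_rpow hr zero_le_one)
  have h2 : IntervalIntegrable (fun v => green (v ^ (-r⁻¹))) volume 1 (max 1 c) := by
    refine (intervalIntegrable_iff_integrableOn_Ioc_of_le (le_max_left _ _)).2 ?_
    refine (integrableOn_zero (ε' := ℝ)).congr_fun (fun v hv => ?_) measurableSet_Ioc
    rw [green_eq_zero (Real.rpow_le_one_of_one_le_of_nonpos hv.1.le (by simpa using hr0.le))]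
  refine (h1.trans h2).mono_set ?_
  rw [uIcc_of_le hc, uIcc_of_le (by positivity)]
  exact Icc_subset_Icc le_rfl (le_max_right _ _)

lemma integral_green_one_le (hr : 1 ≤ r) {c : ℝ} (hc : 1 ≤ c) :
    ∫ v in 0..c, green (v ^ (-r⁻¹)) = greenInt r := by
  have hr0 : 0 < r := by linarith
  have h0 := intervalIntegrable_green hr zero_le_one
  have hI : IntervalIntegrable (fun v => green (v ^ (-r⁻¹))) volume 1 c :=
    h0.symm.trans (intervalIntegrable_green hr (by linarith))
  rw [← intervalIntegral.integral_add_adjacent_intervals h0 hI, greenInt, add_eq_left]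
  rw [intervalIntegral.integral_of_le hc]
  refine setIntegral_eq_zero_of_forall_eq_zero fun v hv => ?_
  rw [green_eq_zero (Real.rpow_le_one_of_one_le_of_nonpos hv.1.le (by simpa using hr0.le))]

lemma integral_green_scale (hr : 1 ≤ r) {a : ℝ} (ha : 0 < a) :
    ∫ τ, green (a * τ ^ (-r⁻¹)) ∂unitMeas = a ^ r * ∫ v in 0..a ^ (-r), green (v ^ (-r⁻¹)) := by
  have hr0 : r ≠ 0 := by linarith
  have h := intervalIntegral.mul_integral_comp_mul_left (a := 0) (b := 1)
    (f := fun v => green (v ^ (-r⁻¹))) (a ^ (-r))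
  rw [mul_zero, mul_one] at h
  rw [← h, ← mul_assoc, ← Real.rpow_add ha, add_neg_cancel, Real.rpow_zero, one_mul,
    ← integral_unitMeas]
  refine integral_congr_ae ?_
  filter_upwards [unitMeas_ae] with τ hτ
  rw [Real.mul_rpow (Real.rpow_nonneg ha.le _) hτ.1.le, ← Real.rpow_mul ha.le]
  congr 2
  rw [neg_mul_neg, mul_inv_cancel₀ hr0, Real.rpow_one]

lemma integral_green_eq (hr : 1 ≤ r) {a : ℝ} (ha : 0 ≤ a) (ha1 : a ≤ 1) :
    ∫ τ, green (a * τ ^ (-r⁻¹)) ∂unitMeas = a ^ r * greenInt r := by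
  have hr0 : 0 < r := by linarith
  rcases ha.eq_or_lt with rfl | ha
  · rw [Real.zero_rpow hr0.ne']
    simp [green_eq_zero zero_le_one]
  · rw [integral_green_scale hr ha, integral_green_one_le hr]
    exact Real.one_le_rpow_of_pos_of_le_one_of_nonpos ha ha1 (by linarith)

lemma integral_green_le (hr : 1 ≤ r) {a : ℝ} (ha : 0 ≤ a) :
    ∫ τ, green (a * τ ^ (-r⁻¹)) ∂unitMeas ≤ a ^ r * greenInt r := by
  have hr0 : 0 < r := by linarith
  rcases le_total a 1 with h | h
  · exact (integral_green_eq hr ha h).le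
  have ha' : 0 < a := by linarith
  rw [integral_green_scale hr ha']
  gcongr
  refine intervalIntegral.integral_mono_interval le_rfl (Real.rpow_nonneg ha _)
    (Real.rpow_le_one_of_one_le_of_nonpos h (by linarith)) (ae_of_all _ fun _ => green_nonneg _)
    (intervalIntegrable_green hr zero_le_one)

lemma cos_angle_abs (s : ℝ) (hs : 0 ≤ s) : ∀ᵐ x ∂(angle.map fun θ => s * Real.cos θ), |x| ≤ s := by
  rw [ae_map_iff (by fun_prop) (measurableSet_le (by fun_prop) (by fun_prop))]
  refine ae_of_all _ fun θ => ?_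
  rw [abs_mul, abs_of_nonneg hs]
  exact mul_le_of_le_one_right hs (Real.abs_cos_le_one θ)

/-- The arcsine law on `[-s, s]`. -/
noncomputable def arc (s : ℝ) : Measure ℝ := angle.map fun θ => s * Real.cos θ

instance (s : ℝ) : IsProbabilityMeasure (arc s) :=
  Measure.isProbabilityMeasure_map (by fun_prop)

lemma arc_ae {s : ℝ} (hs : 0 ≤ s) : ∀ᵐ x ∂(arc s), |x| ≤ s := cos_angle_abs s hs

lemma integral_arc (s : ℝ) {f : ℝ → ℝ} (hf : Continuous f) :
    ∫ x, f x ∂(arc s) = ∫ θ, f (s * Real.cos θ) ∂angle :=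
  integral_map (by fun_prop) hf.aestronglyMeasurable

lemma integrable_logKer_cos_prod {ε : ℝ} (hε : 0 < ε) (a b : ℝ) :
    Integrable (fun z : ℝ × ℝ => logKer ε (a * Real.cos z.1 - b * Real.cos z.2))
      (angle.prod angle) := by
  have hc := continuous_logKer hε
  obtain ⟨C, hC⟩ := (isCompact_Icc (a := -(|a| + |b|)) (b := |a| + |b|)).exists_bound_of_continuousOn
    hc.continuousOn
  refine Integrable.of_bound (Continuous.aestronglyMeasurable (by fun_prop)) C
    (ae_of_all _ fun z => hC _ (abs_le.1 ?_))
  refine (abs_sub _ _).trans ?_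
  rw [abs_mul, abs_mul]
  exact add_le_add (mul_le_of_le_one_right (abs_nonneg _) (Real.abs_cos_le_one _))
    (mul_le_of_le_one_right (abs_nonneg _) (Real.abs_cos_le_one _))

lemma integral_green_cos {s : ℝ} (hs : 0 < s) (hs1 : s ≤ 1) :
    ∫ θ, green (|Real.cos θ| / s) ∂angle = -Real.log s := by
  have hg : Integrable (fun θ => green (|Real.cos θ| / s)) angle :=
    integrable_angle (Continuous.intervalIntegrable
      (continuous_green.comp (Real.continuous_cos.abs.div_const s)) _ _)
  have hi : Integrable (fun θ => Real.log (s / 2) + green (|Real.cos θ| / s)) angle :=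
    (integrable_const _).add hg
  have e : ∫ θ, (Real.log (s / 2) + green (|Real.cos θ| / s)) ∂angle =
      Real.log (s / 2) + ∫ θ, green (|Real.cos θ| / s) ∂angle := by
    rw [integral_add (integrable_const _) hg, integral_const, probReal_univ,
      one_smul]
  have h_integrable : ∀ {ε : ℝ}, 0 < ε → ∀ a b : ℝ, Integrable
      (fun θ => ∫ φ, logKer ε (a * Real.cos θ - b * Real.cos φ) ∂angle) angle :=
    fun hε a b => (integrable_logKer_cos_prod hε a b).integral_prod_left
  have key : ∀ ε : ℝ, 0 < ε → |∫ θ, green (|Real.cos θ| / s) ∂angle + Real.log s| ≤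
      √(2 * ε) + √(2 * (ε / s)) := by
    intro ε hε
    have h1 : ∫ θ, ∫ φ, logKer ε (1 * Real.cos θ - s * Real.cos φ) ∂angle ∂angle =
        ∫ φ, ∫ θ, logKer ε (s * Real.cos φ - 1 * Real.cos θ) ∂angle ∂angle := by
      rw [integral_integral_swap (integrable_logKer_cos_prod hε 1 s)]
      simp_rw [logKer_sub_comm ε (s * _)]
    have u1 : ∫ θ, ∫ φ, logKer ε (1 * Real.cos θ - s * Real.cos φ) ∂angle ∂angle ≤
        ∫ θ, (Real.log (s / 2) + green (|Real.cos θ| / s) + √(2 * (ε / s))) ∂angle :=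
      integral_mono (h_integrable hε 1 s) (hi.add (integrable_const _)) fun θ => by
        simpa using logKer_integral_cos_le hε (Real.cos θ) hs
    have l1 : ∫ θ, (Real.log (s / 2) + green (|Real.cos θ| / s)) ∂angle ≤
        ∫ θ, ∫ φ, logKer ε (1 * Real.cos θ - s * Real.cos φ) ∂angle ∂angle :=
      integral_mono hi (h_integrable hε 1 s) fun θ => by
        simpa using le_logKer_integral_cos ε (Real.cos θ) hs
    have hz : ∀ φ, green (|s * Real.cos φ| / 1) = 0 := fun φ => green_eq_zero (by
      rw [div_one, abs_mul, abs_of_pos hs]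
      exact mul_le_one₀ hs1 (abs_nonneg _) (Real.abs_cos_le_one φ))
    have u2 : ∫ φ, ∫ θ, logKer ε (s * Real.cos φ - 1 * Real.cos θ) ∂angle ∂angle ≤
        ∫ _, (Real.log (1 / 2) + √(2 * ε)) ∂angle :=
      integral_mono (h_integrable hε s 1) (integrable_const _) fun φ => by
        have := logKer_integral_cos_le hε (s * Real.cos φ) one_pos
        rwa [hz, add_zero, div_one] at this
    have l2 : ∫ _, Real.log (1 / 2) ∂angle ≤
        ∫ φ, ∫ θ, logKer ε (s * Real.cos φ - 1 * Real.cos θ) ∂angle ∂angle :=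
      integral_mono (integrable_const _) (h_integrable hε s 1) fun φ => by
        have := le_logKer_integral_cos ε (s * Real.cos φ) one_pos
        rwa [hz, add_zero] at this
    have e2 : ∫ θ, (Real.log (s / 2) + green (|Real.cos θ| / s) + √(2 * (ε / s))) ∂angle =
        ∫ θ, (Real.log (s / 2) + green (|Real.cos θ| / s)) ∂angle + ∫ _, √(2 * (ε / s)) ∂angle :=
      integral_add hi (integrable_const _)
    rw [e2] at u1
    rw [e] at u1 l1
    rw [integral_const, probReal_univ, one_smul] at u1 u2 l2
    rw [Real.log_div hs.ne' two_ne_zero] at u1 l1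
    rw [Real.log_div one_ne_zero two_ne_zero, Real.log_one] at u2 l2
    rw [abs_le]
    have := Real.sqrt_nonneg (2 * ε)
    have := Real.sqrt_nonneg (2 * (ε / s))
    constructor <;> linarith
  have hlim : Tendsto (fun ε : ℝ => √(2 * ε) + √(2 * (ε / s))) (𝓝[>] 0) (𝓝 0) := by
    have : Continuous (fun ε : ℝ => √(2 * ε) + √(2 * (ε / s))) := by fun_prop
    have h := this.tendsto 0
    simp only [mul_zero, zero_div, Real.sqrt_zero, add_zero] at h
    exact h.mono_left nhdsWithin_le_nhds
  have h0 : |∫ θ, green (|Real.cos θ| / s) ∂angle + Real.log s| ≤ 0 :=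
    ge_of_tendsto hlim (eventually_mem_nhdsWithin.mono fun ε hε => key ε hε)
  have := abs_nonpos_iff.1 h0
  linarith

end SymBall

namespace SymBall

variable {r R : ℝ}

lemma continuous_logKer_sub {ε : ℝ} (hε : 0 < ε) (x : ℝ) : Continuous fun y => logKer ε (x - y) :=
  (continuous_logKer hε).comp (by fun_prop)

lemma cosMoment_mul_greenInt (hr : 1 ≤ r) : cosMoment r * greenInt r = 1 / r := by
  have hr0 : 0 < r := by linarith
  have h_integrable : Integrable (fun z : ℝ × ℝ => green (|Real.cos z.2| * z.1 ^ (-r⁻¹)))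
      (unitMeas.prod angle) := by
    refine Integrable.mono'
      (((integrable_unitMeas_rpow (exponent_bound hr)).const_mul √(2 * 1)).comp_fst angle)
      (measurable_green.comp (by fun_prop)).aestronglyMeasurable ?_
    filter_upwards [Measure.quasiMeasurePreserving_fst.ae unitMeas_ae] with z hz
    rw [Real.norm_eq_abs, abs_of_nonneg (green_nonneg _)]
    have h1 : |Real.cos z.2| * z.1 ^ (-r⁻¹) ≤ 1 * z.1 ^ (-r⁻¹) :=
      mul_le_mul_of_nonneg_right (Real.abs_cos_le_one _) (Real.rpow_nonneg hz.1.le _)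
    refine (green_mono h1).trans
      ((green_le_sqrt (mul_nonneg zero_le_one (Real.rpow_nonneg hz.1.le _))).trans (le_of_eq ?_))
    rw [← mul_assoc, Real.sqrt_mul (by positivity), Real.sqrt_eq_rpow (z.1 ^ _),
      ← Real.rpow_mul hz.1.le]
    congr 2
    ring
  have e1 : ∫ τ, ∫ θ, green (|Real.cos θ| * τ ^ (-r⁻¹)) ∂angle ∂unitMeas = 1 / r := by
    have : ∫ τ, ∫ θ, green (|Real.cos θ| * τ ^ (-r⁻¹)) ∂angle ∂unitMeas =
        ∫ τ, -r⁻¹ * Real.log τ ∂unitMeas := by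
      refine integral_congr_ae ?_
      filter_upwards [unitMeas_ae] with τ hτ
      have h := integral_green_cos (Real.rpow_pos_of_pos hτ.1 r⁻¹)
        (Real.rpow_le_one hτ.1.le hτ.2 (by positivity))
      rw [Real.log_rpow hτ.1, ← neg_mul] at h
      rw [← h]
      refine integral_congr_ae (ae_of_all _ fun θ => ?_)
      simp only
      rw [Real.rpow_neg hτ.1.le, div_eq_mul_inv]
    rw [this, integral_const_mul, integral_unitMeas_log]
    simp
  rw [← e1, integral_integral_swap h_integrable, cosMoment, ← integral_mul_const]
  refine integral_congr_ae (ae_of_all _ fun θ => ?_)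
  exact (integral_green_eq hr (abs_nonneg _) (Real.abs_cos_le_one θ)).symm

/-- Ullman's law on `[-R, R]`: a mixture of arcsine laws. -/
noncomputable def ullman (r R : ℝ) : Measure ℝ :=
  (unitMeas.prod angle).map fun z => R * z.1 ^ r⁻¹ * Real.cos z.2

instance (r R : ℝ) : IsProbabilityMeasure (ullman r R) :=
  Measure.isProbabilityMeasure_map (by fun_prop)

lemma ullman_ae (hr : 0 < r) (hR : 0 ≤ R) : ∀ᵐ x ∂(ullman r R), |x| ≤ R := by
  rw [ullman, ae_map_iff (by fun_prop) (measurableSet_le (by fun_prop) (by fun_prop))]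
  filter_upwards [Measure.quasiMeasurePreserving_fst.ae unitMeas_ae] with z hz
  have h1 : z.1 ^ r⁻¹ ≤ 1 := Real.rpow_le_one hz.1.le hz.2 (by positivity)
  rw [abs_mul, abs_mul, abs_of_nonneg hR, abs_of_nonneg (Real.rpow_nonneg hz.1.le _), mul_assoc]
  exact mul_le_of_le_one_right hR (mul_le_one₀ h1 (abs_nonneg _) (Real.abs_cos_le_one _))

lemma integrable_ullman_comp (hr : 0 < r) (hR : 0 ≤ R) {f : ℝ → ℝ} (hf : Continuous f) :
    Integrable (fun z : ℝ × ℝ => f (R * z.1 ^ r⁻¹ * Real.cos z.2)) (unitMeas.prod angle) :=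
  by
  have h : Integrable f (ullman r R) :=
    integrable_of_continuous_of_ae_abs_le hf (ullman_ae hr hR)
  exact (integrable_map_measure hf.aestronglyMeasurable (by fun_prop)).1 h

lemma integral_ullman (hr : 0 < r) (hR : 0 ≤ R) {f : ℝ → ℝ} (hf : Continuous f) :
    ∫ x, f x ∂(ullman r R) = ∫ τ, ∫ θ, f (R * τ ^ r⁻¹ * Real.cos θ) ∂angle ∂unitMeas := by
  rw [ullman, integral_map (by fun_prop) hf.aestronglyMeasurable,
    integral_prod _ (integrable_ullman_comp hr hR hf)]

lemma continuous_abs_rpow {s : ℝ} (hs : 0 ≤ s) : Continuous fun x : ℝ => |x| ^ s :=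
  continuous_abs.rpow_const fun _ => Or.inr hs

lemma integral_ullman_abs_rpow {s : ℝ} (hr : 0 < r) (hR : 0 ≤ R) (hs : 0 < s) :
    ∫ x, |x| ^ s ∂(ullman r R) = R ^ s * (r / (r + s)) * cosMoment s := by
  rw [integral_ullman hr hR (continuous_abs_rpow hs.le)]
  have : ∀ᵐ τ ∂unitMeas, ∫ θ, |R * τ ^ r⁻¹ * Real.cos θ| ^ s ∂angle =
      τ ^ (s / r) * (R ^ s * cosMoment s) := by
    filter_upwards [unitMeas_ae] with τ hτ
    have hτ' := Real.rpow_nonneg hτ.1.le r⁻¹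
    have : ∀ θ, |R * τ ^ r⁻¹ * Real.cos θ| ^ s = τ ^ (s / r) * R ^ s * |Real.cos θ| ^ s := by
      intro θ
      rw [abs_mul, abs_mul, abs_of_nonneg hR, abs_of_nonneg hτ', Real.mul_rpow (by positivity)
        (abs_nonneg _), Real.mul_rpow hR hτ', ← Real.rpow_mul hτ.1.le, mul_comm (R ^ s)]
      congr 3
      field_simp
    simp_rw [this]
    rw [integral_const_mul, cosMoment, mul_assoc]
  rw [integral_congr_ae this, integral_mul_const, integral_unitMeas_rpow
    (by have : 0 < s / r := by positivity
        linarith)]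
  field_simp
  ring

/-- The logarithmic potential of Ullman's law. -/
noncomputable def ullmanPot (r R x : ℝ) : ℝ :=
  Real.log (R / 2) - 1 / r + ∫ τ, green (|x| / R * τ ^ (-r⁻¹)) ∂unitMeas

lemma ullmanPot_le (hr : 1 ≤ r) (hR : 0 < R) (x : ℝ) :
    ullmanPot r R x ≤ Real.log (R / 2) - 1 / r + (|x| / R) ^ r * greenInt r := by
  unfold ullmanPot
  gcongr
  exact integral_green_le hr (by positivity)

lemma ullmanPot_eq (hr : 1 ≤ r) (hR : 0 < R) {x : ℝ} (hx : |x| ≤ R) :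
    ullmanPot r R x = Real.log (R / 2) - 1 / r + (|x| / R) ^ r * greenInt r := by
  rw [ullmanPot, integral_green_eq hr (by positivity) ((div_le_one hR).2 hx)]

lemma ullmanPot_inner (hr : 1 ≤ r) (hR : 0 < R) (x : ℝ) :
    Integrable (fun τ => Real.log (R * τ ^ r⁻¹ / 2) + green (|x| / (R * τ ^ r⁻¹))) unitMeas ∧
    ∫ τ, (Real.log (R * τ ^ r⁻¹ / 2) + green (|x| / (R * τ ^ r⁻¹))) ∂unitMeas =
      ullmanPot r R x := by
  have hr0 : 0 < r := by linarith
  have hi1 : Integrable (fun τ => Real.log (R / 2) + r⁻¹ * Real.log τ) unitMeas :=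
    (integrable_const _).add (integrable_unitMeas_log.const_mul _)
  have hi2 := integrable_green_rpow hr (a := |x| / R) (by positivity)
  have hcongr : ∀ᵐ τ ∂unitMeas, (Real.log (R / 2) + r⁻¹ * Real.log τ) +
      green (|x| / R * τ ^ (-r⁻¹)) =
      Real.log (R * τ ^ r⁻¹ / 2) + green (|x| / (R * τ ^ r⁻¹)) := by
    filter_upwards [unitMeas_ae] with τ hτ
    have hτ' := Real.rpow_pos_of_pos hτ.1 r⁻¹
    rw [mul_div_right_comm, Real.log_mul (by positivity) hτ'.ne', Real.log_rpow hτ.1,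
      Real.rpow_neg hτ.1.le]
    congr 2
    field_simp
  refine ⟨(hi1.add hi2).congr hcongr, ?_⟩
  rw [← integral_congr_ae hcongr]
  have e1 : ∫ τ, ((Real.log (R / 2) + r⁻¹ * Real.log τ) + green (|x| / R * τ ^ (-r⁻¹))) ∂unitMeas =
      ∫ τ, (Real.log (R / 2) + r⁻¹ * Real.log τ) ∂unitMeas +
      ∫ τ, green (|x| / R * τ ^ (-r⁻¹)) ∂unitMeas := integral_add hi1 hi2
  have e2 : ∫ τ, (Real.log (R / 2) + r⁻¹ * Real.log τ) ∂unitMeas =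
      ∫ _, Real.log (R / 2) ∂unitMeas + ∫ τ, r⁻¹ * Real.log τ ∂unitMeas :=
    integral_add (integrable_const _) (integrable_unitMeas_log.const_mul _)
  rw [e1, e2, integral_const, probReal_univ, one_smul, integral_const_mul, integral_unitMeas_log,
    ullmanPot]
  ring

variable {ε : ℝ}

lemma integrable_logKer_ullman (hε : 0 < ε) (hr : 1 ≤ r) (hR : 0 < R) (x : ℝ) :
    Integrable (fun τ => ∫ θ, logKer ε (x - R * τ ^ r⁻¹ * Real.cos θ) ∂angle) unitMeas :=
  (integrable_ullman_comp (r := r) (by linarith) hR.le (f := fun y => logKer ε (x - y))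
    (continuous_logKer_sub hε x)).integral_prod_left

lemma ullmanPot_le_logKer (hε : 0 < ε) (hr : 1 ≤ r) (hR : 0 < R) (x : ℝ) :
    ullmanPot r R x ≤ ∫ y, logKer ε (x - y) ∂(ullman r R) := by
  have hr0 : 0 < r := by linarith
  rw [integral_ullman hr0 hR.le (continuous_logKer_sub hε x),
    ← (ullmanPot_inner hr hR x).2]
  refine integral_mono_ae (ullmanPot_inner hr hR x).1 (integrable_logKer_ullman hε hr hR x) ?_
  filter_upwards [unitMeas_ae] with τ hτ
  exact le_logKer_integral_cos ε x (mul_pos hR (Real.rpow_pos_of_pos hτ.1 _))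

lemma logKer_le_ullmanPot (hε : 0 < ε) (hr : 1 ≤ r) (hR : 0 < R) (x : ℝ) :
    ∫ y, logKer ε (x - y) ∂(ullman r R) ≤ ullmanPot r R x + 2 * √(2 * (ε / R)) := by
  have hr0 : 0 < r := by linarith
  have hb := exponent_bound hr
  rw [integral_ullman hr0 hR.le (continuous_logKer_sub hε x)]
  have hi := (integrable_unitMeas_rpow hb).const_mul √(2 * (ε / R))
  have e : ∫ τ, ((Real.log (R * τ ^ r⁻¹ / 2) + green (|x| / (R * τ ^ r⁻¹))) +
      √(2 * (ε / R)) * τ ^ (-(r⁻¹ / 2))) ∂unitMeas =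
      ∫ τ, (Real.log (R * τ ^ r⁻¹ / 2) + green (|x| / (R * τ ^ r⁻¹))) ∂unitMeas +
      ∫ τ, √(2 * (ε / R)) * τ ^ (-(r⁻¹ / 2)) ∂unitMeas :=
    integral_add (ullmanPot_inner hr hR x).1 hi
  calc _ ≤ ∫ τ, ((Real.log (R * τ ^ r⁻¹ / 2) + green (|x| / (R * τ ^ r⁻¹))) +
        √(2 * (ε / R)) * τ ^ (-(r⁻¹ / 2))) ∂unitMeas := by
        refine integral_mono_ae (integrable_logKer_ullman hε hr hR x)
          ((ullmanPot_inner hr hR x).1.add hi) ?_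
        filter_upwards [unitMeas_ae] with τ hτ
        refine (logKer_integral_cos_le hε x (mul_pos hR (Real.rpow_pos_of_pos hτ.1 _))).trans
          (le_of_eq ?_)
        congr 1
        rw [← div_div, ← mul_div_assoc, div_eq_mul_inv, Real.sqrt_mul (by positivity),
          ← Real.rpow_neg hτ.1.le, Real.sqrt_eq_rpow (τ ^ _), ← Real.rpow_mul hτ.1.le]
        congr 2
        ring
    _ ≤ _ := by
        rw [e, (ullmanPot_inner hr hR x).2, integral_const_mul, integral_unitMeas_rpow hb,
          mul_comm (2 : ℝ) √(2 * (ε / R))]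
        gcongr
        have : r⁻¹ ≤ 1 := inv_le_one_of_one_le₀ hr
        rw [div_le_iff₀ (by linarith)]
        linarith

lemma log_half_le_arc {a : ℝ} (hε : 0 < ε) (ha : 0 < a) {x : ℝ} (hx : |x| ≤ a) :
    Real.log (a / 2) ≤ ∫ y, logKer ε (x - y) ∂(arc a) := by
  rw [integral_arc a (continuous_logKer_sub hε x)]
  have := le_logKer_integral_cos ε x ha
  rwa [green_eq_zero ((div_le_one ha).2 hx), add_zero] at this

lemma arc_le_log_half {a : ℝ} (hε : 0 < ε) (ha : 0 < a) {x : ℝ} (hx : |x| ≤ a) :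
    ∫ y, logKer ε (x - y) ∂(arc a) ≤ Real.log (a / 2) + √(2 * (ε / a)) := by
  rw [integral_arc a (continuous_logKer_sub hε x)]
  have := logKer_integral_cos_le hε x ha
  rwa [green_eq_zero ((div_le_one ha).2 hx), add_zero] at this

end SymBall

namespace SymBall

lemma cosMoment_pos {r : ℝ} (hr : 1 ≤ r) : 0 < cosMoment r := by
  have h := cosMoment_mul_greenInt hr
  have h0 : 0 ≤ cosMoment r := integral_nonneg fun θ => Real.rpow_nonneg (abs_nonneg _) _
  refine h0.lt_of_ne fun h1 => ?_
  rw [← h1, zero_mul] at h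
  have : 0 < 1 / r := by positivity
  linarith

lemma greenInt_pos {r : ℝ} (hr : 1 ≤ r) : 0 < greenInt r := by
  have h := cosMoment_mul_greenInt hr
  refine (greenInt_nonneg r).lt_of_ne fun h1 => ?_
  rw [← h1, mul_zero] at h
  have : 0 < 1 / r := by positivity
  linarith

/-- The radius of the limiting spectral distribution. -/
noncomputable def limRadius (p : ℝ) : ℝ := (2 / cosMoment p) ^ (1 / p)

/-- The logarithmic energy of the limiting spectral distribution. -/
noncomputable def limEnergy (p : ℝ) : ℝ := Real.log (limRadius p / 2) - 1 / (2 * p)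

/-- The moments of the limiting spectral distribution. -/
noncomputable def limMoment (p q : ℝ) : ℝ := limRadius p ^ q * (p / (p + q)) * cosMoment q

lemma limRadius_pos {p : ℝ} (hp : 1 ≤ p) : 0 < limRadius p :=
  Real.rpow_pos_of_pos (div_pos two_pos (cosMoment_pos hp)) _

lemma limRadius_rpow {p : ℝ} (hp : 1 ≤ p) : limRadius p ^ p = 2 / cosMoment p := by
  rw [limRadius, ← Real.rpow_mul (div_pos two_pos (cosMoment_pos hp)).le,
    one_div_mul_cancel (by linarith), Real.rpow_one]

section Bounds

variable {ρ : Measure ℝ} [IsProbabilityMeasure ρ] {r R K ε : ℝ}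

lemma integrable_abs_rpow {s : ℝ} (hs : 0 ≤ s) (hρ : ∀ᵐ x ∂ρ, |x| ≤ K) :
    Integrable (fun x => |x| ^ s) ρ :=
  integrable_of_continuous_of_ae_abs_le (continuous_abs_rpow hs) hρ

lemma integral_pot_eq (hr : 1 ≤ r) (hR : 0 < R) (hρ : ∀ᵐ x ∂ρ, |x| ≤ K) (c : ℝ) :
    Integrable (fun x => Real.log (R / 2) - 1 / r + (|x| / R) ^ r * greenInt r + c) ρ ∧
    ∫ x, (Real.log (R / 2) - 1 / r + (|x| / R) ^ r * greenInt r + c) ∂ρ =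
      Real.log (R / 2) - 1 / r + greenInt r / R ^ r * ∫ x, |x| ^ r ∂ρ + c := by
  have hi := (integrable_abs_rpow (by linarith : 0 ≤ r) hρ).const_mul (greenInt r / R ^ r)
  have e : (fun x : ℝ => Real.log (R / 2) - 1 / r + (|x| / R) ^ r * greenInt r + c) =
      fun x => greenInt r / R ^ r * |x| ^ r + (Real.log (R / 2) - 1 / r + c) := by
    ext x
    rw [Real.div_rpow (abs_nonneg _) hR.le]
    ring
  have e2 : ∫ x, (greenInt r / R ^ r * |x| ^ r + (Real.log (R / 2) - 1 / r + c)) ∂ρ =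
      ∫ x, greenInt r / R ^ r * |x| ^ r ∂ρ + ∫ _, (Real.log (R / 2) - 1 / r + c) ∂ρ :=
    integral_add hi (integrable_const _)
  rw [e]
  refine ⟨hi.add (integrable_const _), ?_⟩
  rw [e2, integral_const, probReal_univ, one_smul, integral_const_mul]
  ring

lemma integrable_potential (hε : 0 < ε) {μ : Measure ℝ} [IsProbabilityMeasure μ]
    (hρ : ∀ᵐ x ∂ρ, |x| ≤ K) (hμ : ∀ᵐ x ∂μ, |x| ≤ K) :
    Integrable (fun x => ∫ y, logKer ε (x - y) ∂μ) ρ :=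
  (integrable_prod_of_continuous ((continuous_logKer hε).comp (by fun_prop : Continuous
    fun z : ℝ × ℝ => z.1 - z.2)) hρ hμ).integral_prod_left

lemma energy_ullman_le (hε : 0 < ε) (hr : 1 ≤ r) (hR : 0 < R) (hRK : R ≤ K)
    (hρ : ∀ᵐ x ∂ρ, |x| ≤ K) :
    energy ε ρ (ullman r R) ≤ Real.log (R / 2) - 1 / r + greenInt r / R ^ r * ∫ x, |x| ^ r ∂ρ +
      2 * √(2 * (ε / R)) := by
  have hμ : ∀ᵐ x ∂(ullman r R), |x| ≤ K :=
    (ullman_ae (by linarith) hR.le).mono fun x hx => hx.trans hRK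
  rw [energy_eq hε hρ hμ, ← (integral_pot_eq hr hR hρ _).2]
  refine integral_mono (integrable_potential hε hρ hμ) (integral_pot_eq hr hR hρ _).1 fun x => ?_
  have h1 := logKer_le_ullmanPot hε hr hR x
  have h2 := ullmanPot_le hr hR x
  simp only
  linarith

lemma le_energy_ullman (hε : 0 < ε) (hr : 1 ≤ r) (hR : 0 < R) (hρ : ∀ᵐ x ∂ρ, |x| ≤ R) :
    Real.log (R / 2) - 1 / r + greenInt r / R ^ r * ∫ x, |x| ^ r ∂ρ ≤
      energy ε ρ (ullman r R) := by
  have hμ : ∀ᵐ x ∂(ullman r R), |x| ≤ R := ullman_ae (by linarith) hR.le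
  have h0 := integral_pot_eq hr hR hρ 0
  simp only [add_zero] at h0
  rw [energy_eq hε hρ hμ, ← h0.2]
  refine integral_mono_ae h0.1 (integrable_potential hε hρ hμ) ?_
  filter_upwards [hρ] with x hx
  have h1 := ullmanPot_le_logKer hε hr hR x
  rwa [ullmanPot_eq hr hR hx] at h1

lemma energy_arc_le (hε : 0 < ε) (hK : 0 < K) (hρ : ∀ᵐ x ∂ρ, |x| ≤ K) :
    energy ε ρ (arc K) ≤ Real.log (K / 2) + √(2 * (ε / K)) := by
  rw [energy_eq hε hρ (arc_ae hK.le)]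
  refine (integral_mono_ae (integrable_potential hε hρ (arc_ae hK.le)) (integrable_const _)
    (hρ.mono fun x hx => arc_le_log_half hε hK hx)).trans (le_of_eq ?_)
  rw [integral_const, probReal_univ, one_smul]

lemma le_energy_arc (hε : 0 < ε) (hK : 0 < K) (hρ : ∀ᵐ x ∂ρ, |x| ≤ K) :
    Real.log (K / 2) ≤ energy ε ρ (arc K) := by
  rw [energy_eq hε hρ (arc_ae hK.le)]
  refine (le_of_eq ?_).trans (integral_mono_ae (integrable_const (Real.log (K / 2)))
    (integrable_potential hε hρ (arc_ae hK.le)) (hρ.mono fun x hx => log_half_le_arc hε hK hx))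
  rw [integral_const, probReal_univ, one_smul]

/-- An upper bound for the regularized logarithmic energy of a measure with bounded `p`-th moment,
quantifying the deviation of its `q`-th moment from the one of the minimizer. -/
lemma energy_le {p q : ℝ} (hε : 0 < ε) (hp : 1 ≤ p) (hq : 1 ≤ q) (hK : limRadius p ≤ K)
    (hρ : ∀ᵐ x ∂ρ, |x| ≤ K) (hM : ∫ x, |x| ^ p ∂ρ ≤ 1) (η : ℝ) :
    energy ε ρ ρ ≤ limEnergy p +
      2 * η * (greenInt q / K ^ q * (∫ x, |x| ^ q ∂ρ - limMoment p q)) + η ^ 2 / (2 * q) +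
      (4 + 6 * |η| + 2 * η ^ 2) * √(2 * (ε / limRadius p)) := by
  have hp0 : 0 < p := by linarith
  have hq0 : 0 < q := by linarith
  set b := limRadius p with hb_def
  have hb : 0 < b := limRadius_pos hp
  have hK0 : 0 < K := hb.trans_le hK
  set δ := √(2 * (ε / b)) with hδ
  have hδ0 : 0 ≤ δ := Real.sqrt_nonneg _
  have hδK : √(2 * (ε / K)) ≤ δ := by
    rw [hδ]
    gcongr
  have hmp := cosMoment_pos hp
  have hmq := cosMoment_pos hq
  have hup : ∀ᵐ x ∂(ullman p b), |x| ≤ b := ullman_ae hp0 hb.le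
  have hupK : ∀ᵐ x ∂(ullman p b), |x| ≤ K := hup.mono fun x hx => hx.trans hK
  have huq : ∀ᵐ x ∂(ullman q K), |x| ≤ K := ullman_ae hq0 hK0.le
  have hgp : greenInt p / b ^ p = 1 / (2 * p) := by
    have h := cosMoment_mul_greenInt hp
    rw [hb_def, limRadius_rpow hp]
    field_simp at h ⊢
    linarith
  have hMp : ∫ x, |x| ^ p ∂(ullman p b) = 1 := by
    rw [integral_ullman_abs_rpow hp0 hb.le hp0, hb_def, limRadius_rpow hp]
    field_simp
    ring
  have hMpq : ∫ x, |x| ^ q ∂(ullman p b) = limMoment p q :=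
    integral_ullman_abs_rpow hp0 hb.le hq0
  have hMq : greenInt q / K ^ q * ∫ x, |x| ^ q ∂(ullman q K) = 1 / (2 * q) := by
    have h := cosMoment_mul_greenInt hq
    have hKq := Real.rpow_pos_of_pos hK0 q
    rw [integral_ullman_abs_rpow hq0 hK0.le hq0]
    field_simp at h ⊢
    linarith
  have hle : limEnergy p = Real.log (b / 2) - 1 / (2 * p) := rfl
  have hpp : 1 / p = 2 * (1 / (2 * p)) := by field_simp
  have hqq : 1 / q = 2 * (1 / (2 * q)) := by field_simp
  have a1 : energy ε ρ (ullman p b) ≤ limEnergy p + 2 * δ := by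
    have h := energy_ullman_le hε hp hb hK hρ
    rw [hgp] at h
    have : 1 / (2 * p) * ∫ x, |x| ^ p ∂ρ ≤ 1 / (2 * p) * 1 := by gcongr
    rw [hle]
    linarith
  have a2 : limEnergy p ≤ energy ε (ullman p b) (ullman p b) := by
    have h := le_energy_ullman hε hp hb hup
    rw [hgp, hMp] at h
    rw [hle]
    linarith
  have b1 := energy_ullman_le hε hq hK0 le_rfl hρ
  have b2 := le_energy_ullman hε hq hK0 hρ
  have b3 := energy_arc_le hε hK0 hρ
  have b4 := le_energy_arc hε hK0 hρ
  have c1 := energy_ullman_le hε hq hK0 le_rfl hupK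
  have c2 := le_energy_ullman hε hq hK0 hupK
  have c3 := energy_arc_le hε hK0 hupK
  have c4 := le_energy_arc hε hK0 hupK
  have d1 := le_energy_ullman hε hq hK0 huq
  have d2 := energy_arc_le hε hK0 huq
  have d3 := le_energy_arc hε hK0 (arc_ae hK0.le)
  rw [hMpq] at c1 c2
  rw [hMq] at d1
  set μ : Fin 4 → Measure ℝ := ![ρ, ullman p b, ullman q K, arc K] with hμ_def
  have : ∀ a, IsProbabilityMeasure (μ a) := by
    intro a
    fin_cases a
    exacts [inferInstanceAs (IsProbabilityMeasure ρ),
      inferInstanceAs (IsProbabilityMeasure (ullman p b)),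
      inferInstanceAs (IsProbabilityMeasure (ullman q K)),
      inferInstanceAs (IsProbabilityMeasure (arc K))]
  have hμK : ∀ a, ∀ᵐ x ∂(μ a), |x| ≤ K := by
    intro a
    fin_cases a
    exacts [hρ, hupK, huq, arc_ae hK0.le]
  have main := energy_combo_nonpos hε hμK (c := ![1, -1, -η, η]) (by
    simp [Fin.sum_univ_four])
  simp only [Fin.sum_univ_four, hμ_def, Matrix.cons_val] at main
  rw [energy_comm ε (ullman p b) ρ, energy_comm ε (ullman q K) ρ, energy_comm ε (arc K) ρ,
    energy_comm ε (ullman q K) (ullman p b), energy_comm ε (arc K) (ullman p b),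
    energy_comm ε (arc K) (ullman q K)] at main
  set X := (energy ε ρ (ullman q K) - energy ε ρ (arc K)) -
    (energy ε (ullman p b) (ullman q K) - energy ε (ullman p b) (arc K)) -
    greenInt q / K ^ q * (∫ x, |x| ^ q ∂ρ - limMoment p q) with hX
  have hXa : |X| ≤ 3 * δ := by
    rw [hX, mul_sub, abs_le]
    constructor <;> linarith
  have hηX : η * X ≤ |η| * (3 * δ) := by
    refine (le_abs_self _).trans ?_
    rw [abs_mul]
    gcongr
  have hY : -(1 / (2 * q)) - 2 * δ ≤ energy ε (ullman q K) (ullman q K) -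
      2 * energy ε (ullman q K) (arc K) + energy ε (arc K) (arc K) := by
    linarith
  have hηY := mul_le_mul_of_nonneg_left hY (sq_nonneg η)
  have e3 : η ^ 2 / (2 * q) = η ^ 2 * (1 / (2 * q)) := by ring
  rw [e3]
  have e4 : η * X = η * (energy ε ρ (ullman q K) - energy ε ρ (arc K)) -
    η * (energy ε (ullman p b) (ullman q K) - energy ε (ullman p b) (arc K)) -
    η * (greenInt q / K ^ q * (∫ x, |x| ^ q ∂ρ - limMoment p q)) := by rw [hX]; ring
  linarith

end Bounds

end SymBall

namespace SymBall

variable {n : ℕ}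

/-- The empirical measure of a configuration of points. -/
noncomputable def empirical (x : Fin n → ℝ) : Measure ℝ :=
  ENNReal.ofReal (n : ℝ)⁻¹ • Measure.sum fun i => Measure.dirac (x i)

lemma isProbabilityMeasure_empirical (hn : 0 < n) (x : Fin n → ℝ) :
    IsProbabilityMeasure (empirical x) := ⟨by
  have hn' : (0 : ℝ) < n := by exact_mod_cast hn
  rw [empirical, Measure.smul_apply, Measure.sum_apply _ MeasurableSet.univ]
  simp only [measure_univ, tsum_fintype, Finset.sum_const, Finset.card_univ, Fintype.card_fin,
    nsmul_eq_mul, mul_one, smul_eq_mul]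
  rw [← ENNReal.ofReal_natCast, ← ENNReal.ofReal_mul (by positivity), inv_mul_cancel₀ hn'.ne',
    ENNReal.ofReal_one]⟩

lemma empirical_ae {x : Fin n → ℝ} {K : ℝ} (hx : ∀ i, |x i| ≤ K) :
    ∀ᵐ y ∂(empirical x), |y| ≤ K := by
  refine Measure.ae_smul_measure ?_ _
  rw [Measure.ae_sum_iff]
  intro i
  rw [ae_dirac_eq]
  exact hx i

lemma integral_empirical (x : Fin n → ℝ) (f : ℝ → ℝ) :
    ∫ y, f y ∂(empirical x) = (∑ i, f (x i)) / n := by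
  rw [empirical, integral_smul_measure, Measure.sum_fintype, integral_finsetSum_measure
    (fun i _ => integrable_dirac (by simp)),
    ENNReal.toReal_ofReal (by positivity), smul_eq_mul]
  simp only [integral_dirac]
  rw [div_eq_inv_mul]

lemma energy_empirical {ε K : ℝ} (hε : 0 < ε) (hn : 0 < n) {x : Fin n → ℝ}
    (hx : ∀ i, |x i| ≤ K) :
    energy ε (empirical x) (empirical x) = (∑ i, ∑ j, logKer ε (x i - x j)) / (n : ℝ) ^ 2 := by
  have := isProbabilityMeasure_empirical hn x
  rw [energy_eq hε (empirical_ae hx) (empirical_ae hx), integral_empirical]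
  simp_rw [integral_empirical]
  rw [← Finset.sum_div, div_div, sq]

lemma abs_le_exp_logKer (ε u : ℝ) : |u| ≤ Real.exp (logKer ε u) := by
  rcases eq_or_ne u 0 with rfl | hu
  · rw [abs_zero]
    positivity
  · rw [← Real.log_le_iff_le_exp (abs_pos.2 hu)]
    exact log_abs_le_logKer ε hu

lemma vand_le_exp (ε : ℝ) (x : Fin n → ℝ) :
    vand x ≤ Real.exp ((∑ i, ∑ j, logKer ε (x i - x j) - n * Real.log ε) / 2) := by
  have h1 : vand x ≤ Real.exp (∑ i, ∑ j ∈ Finset.Ioi i, logKer ε (x j - x i)) := by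
    rw [Real.exp_sum, vand]
    refine Finset.prod_le_prod (fun i _ => Finset.prod_nonneg fun _ _ => abs_nonneg _) fun i _ => ?_
    rw [Real.exp_sum]
    exact Finset.prod_le_prod (fun _ _ => abs_nonneg _) fun j _ => abs_le_exp_logKer ε _
  refine h1.trans (le_of_eq ?_)
  have h2 := Finset.sum_sum_Ioi_add_eq_sum_sum_off_diag fun i j : Fin n => logKer ε (x i - x j)
  have h3 : ∀ i : Fin n, ∑ j, logKer ε (x j - x i) =
      Real.log ε + ∑ j ∈ ({i}ᶜ : Finset (Fin n)), logKer ε (x j - x i) := by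
    intro i
    rw [← Finset.sum_add_sum_compl {i}, Finset.sum_singleton, sub_self]
    congr 1
    rw [logKer, zero_pow two_ne_zero, zero_add, Real.log_pow]
    push_cast
    ring
  have h4 : ∑ i, ∑ j, logKer ε (x i - x j) =
      n * Real.log ε + 2 * ∑ i, ∑ j ∈ Finset.Ioi i, logKer ε (x j - x i) := by
    rw [Finset.sum_comm]
    simp_rw [h3]
    rw [Finset.sum_add_distrib, Finset.sum_const, Finset.card_univ, Fintype.card_fin, nsmul_eq_mul,
      ← h2, Finset.mul_sum]
    congr 1
    refine Finset.sum_congr rfl fun i _ => ?_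
    rw [Finset.mul_sum]
    refine Finset.sum_congr rfl fun j _ => ?_
    rw [logKer_sub_comm ε (x i), two_mul]
  rw [h4]
  congr 1
  ring

/-- The Vandermonde product on the `p`-ball, with the deviation of the `q`-th moment. -/
lemma vand_le_exp_energy {p q ε K : ℝ} (hε : 0 < ε) (hp : 1 ≤ p) (hq : 1 ≤ q)
    (hK : limRadius p ≤ K) (hn : 0 < n) {x : Fin n → ℝ} (hx : ∀ i, |x i| ≤ K)
    (hxp : x ∈ powBall n p n) (η : ℝ) :
    vand x ≤ Real.exp ((n : ℝ) ^ 2 / 2 * (limEnergy p +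
      2 * η * (greenInt q / K ^ q * ((∑ i, |x i| ^ q) / n - limMoment p q)) + η ^ 2 / (2 * q) +
      (4 + 6 * |η| + 2 * η ^ 2) * √(2 * (ε / limRadius p))) - n * Real.log ε / 2) := by
  have hn' : (0 : ℝ) < n := by exact_mod_cast hn
  have := isProbabilityMeasure_empirical hn x
  have hM : ∫ y, |y| ^ p ∂(empirical x) ≤ 1 := by
    rw [integral_empirical, div_le_one hn']
    exact hxp
  have h := energy_le hε hp hq hK (empirical_ae hx) hM η
  rw [energy_empirical hε hn hx, div_le_iff₀ (by positivity),
    integral_empirical x fun y => |y| ^ q] at h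
  refine (vand_le_exp ε x).trans (Real.exp_le_exp.2 ?_)
  linarith

lemma vand_le_of_mem_powBall {p ε : ℝ} (hε : 0 < ε) (hp : 1 ≤ p) (hn : 0 < n) {x : Fin n → ℝ}
    (hxp : x ∈ powBall n p n) :
    vand x ≤ Real.exp ((n : ℝ) ^ 2 / 2 * (limEnergy p + 4 * √(2 * (ε / limRadius p))) -
      n * Real.log ε / 2) := by
  refine (vand_le_exp_energy hε hp hp (le_max_left _ (max 1 (n : ℝ))) hn
    (fun i => (abs_le_of_mem_powBall hp hxp i).trans (le_max_right _ _)) hxp 0).trans (le_of_eq ?_)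
  simp

/-- Configurations with an atypical `q`-th moment have exponentially smaller Vandermonde product. -/
lemma vand_le_of_deviation {p q K δ : ℝ} (hp : 1 ≤ p) (hq : 1 ≤ q) (hK : limRadius p ≤ K)
    (hδ : 0 < δ) : ∃ A > 0, ∀ ε > 0, ∀ n : ℕ, 0 < n → ∀ x : Fin n → ℝ, (∀ i, |x i| ≤ K) →
    x ∈ powBall n p n → δ ≤ |(∑ i, |x i| ^ q) / n - limMoment p q| →
    vand x ≤ Real.exp ((n : ℝ) ^ 2 / 2 * (limEnergy p - 2 * q * A ^ 2 +
      (4 + 6 * (2 * q * A) + 2 * (2 * q * A) ^ 2) * √(2 * (ε / limRadius p))) -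
        n * Real.log ε / 2) := by
  have hK0 : 0 < K := (limRadius_pos hp).trans_le hK
  have hg : 0 < greenInt q / K ^ q := div_pos (greenInt_pos hq) (Real.rpow_pos_of_pos hK0 _)
  have hA : 0 < greenInt q / K ^ q * δ := mul_pos hg hδ
  refine ⟨greenInt q / K ^ q * δ, hA, fun ε hε n hn x hx hxp hdev => ?_⟩
  set A := greenInt q / K ^ q * δ with hA_def
  have hqA : 0 < 2 * q * A := by positivity
  obtain ⟨η, hη, hη2⟩ : ∃ η, |η| = 2 * q * A ∧
      η * (greenInt q / K ^ q * ((∑ i, |x i| ^ q) / n - limMoment p q)) ≤ -(2 * q * A) * A := by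
    rcases le_abs.1 hdev with h | h
    · refine ⟨-(2 * q * A), by rw [abs_neg, abs_of_pos hqA], ?_⟩
      have : A ≤ greenInt q / K ^ q * ((∑ i, |x i| ^ q) / n - limMoment p q) := by
        rw [hA_def]
        gcongr
      nlinarith
    · refine ⟨2 * q * A, abs_of_pos hqA, ?_⟩
      have : A ≤ greenInt q / K ^ q * (-((∑ i, |x i| ^ q) / n - limMoment p q)) := by
        rw [hA_def]
        gcongr
      nlinarith
  have h := vand_le_exp_energy hε hp hq hK hn hx hxp η
  refine h.trans (Real.exp_le_exp.2 ?_)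
  rw [← sq_abs η, hη]
  have e : (2 * q * A) ^ 2 / (2 * q) = 2 * q * A ^ 2 := by field_simp
  rw [e]
  gcongr
  linarith

end SymBall

namespace SymBall

lemma lintegral_image_cos_le {s : ℝ} (g : ℝ → ℝ≥0∞) {S : Set ℝ} (hS : MeasurableSet S)
    (hs : s ≠ 0) (hinj : InjOn Real.cos S) :
    ∫⁻ θ in S, ENNReal.ofReal |s * -Real.sin θ| * g (s * Real.cos θ) ≤ ∫⁻ u, g u := by
  rw [← lintegral_image_eq_lintegral_abs_deriv_mul (f := fun θ => s * Real.cos θ) hS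
    (fun θ _ => ((Real.hasDerivAt_cos θ).const_mul s).hasDerivWithinAt)
    (fun a ha b hb h => hinj ha hb (mul_left_cancel₀ hs h))]
  exact setLIntegral_le_lintegral _ _

lemma injOn_cos_Icc_pi_two_pi : InjOn Real.cos (Ioc Real.pi (2 * Real.pi)) := by
  intro a ha b hb h
  have h' : Real.cos (2 * Real.pi - a) = Real.cos (2 * Real.pi - b) := by
    rwa [Real.cos_two_pi_sub, Real.cos_two_pi_sub]
  have := Real.injOn_cos ⟨by linarith [ha.2], by linarith [ha.1]⟩
    ⟨by linarith [hb.2], by linarith [hb.1]⟩ h'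
  linarith

lemma lintegral_angle_le {s : ℝ} (hs : 0 < s) {g : ℝ → ℝ≥0∞} :
    ENNReal.ofReal s * ∫⁻ θ, ENNReal.ofReal |Real.sin θ| * g (s * Real.cos θ) ∂angle ≤
      ∫⁻ u, g u := by
  have hpi := Real.pi_pos
  have e : ∀ θ, ENNReal.ofReal |s * -Real.sin θ| * g (s * Real.cos θ) =
      ENNReal.ofReal s * (ENNReal.ofReal |Real.sin θ| * g (s * Real.cos θ)) := fun θ => by
    rw [abs_mul, abs_neg, abs_of_pos hs, ENNReal.ofReal_mul hs.le, mul_assoc]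
  have h1 := lintegral_image_cos_le g (measurableSet_Ioc (a := 0) (b := Real.pi)) hs.ne'
    (Real.injOn_cos.mono Ioc_subset_Icc_self)
  have h2 := lintegral_image_cos_le g measurableSet_Ioc hs.ne' injOn_cos_Icc_pi_two_pi
  simp_rw [e] at h1 h2
  rw [lintegral_const_mul' _ _ ENNReal.ofReal_ne_top] at h1 h2
  have h3 := add_le_add h1 h2
  rw [← mul_add, ← lintegral_union measurableSet_Ioc (Ioc_disjoint_Ioc_of_le le_rfl),
    Ioc_union_Ioc_eq_Ioc hpi.le (by linarith), ← two_mul] at h3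
  have h4 : ENNReal.ofReal (2 * Real.pi)⁻¹ * 2 ≤ 1 := by
    rw [show (2 : ℝ≥0∞) = ENNReal.ofReal 2 by simp, ← ENNReal.ofReal_mul (by positivity),
      ENNReal.ofReal_le_one, inv_mul_le_iff₀ (by positivity)]
    linarith [Real.pi_gt_three]
  rw [angle, lintegral_smul_measure, smul_eq_mul, mul_left_comm]
  calc _ ≤ ENNReal.ofReal (2 * Real.pi)⁻¹ * (2 * ∫⁻ u, g u) := by gcongr
    _ = ENNReal.ofReal (2 * Real.pi)⁻¹ * 2 * ∫⁻ u, g u := by rw [mul_assoc]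
    _ ≤ 1 * ∫⁻ u, g u := by gcongr
    _ = _ := one_mul _

lemma integrable_log_sin : Integrable (fun θ => Real.log (Real.sin θ)) angle :=
  integrable_angle intervalIntegrable_log_sin

lemma sin_ne_zero_ae : ∀ᵐ θ ∂angle, Real.sin θ ≠ 0 := by
  have hc : {θ | Real.sin θ = 0}.Countable := by
    have : {θ | Real.sin θ = 0} = range fun k : ℤ => (k : ℝ) * Real.pi := by
      ext θ
      simp [Real.sin_eq_zero_iff]
    rw [this]
    exact countable_range _
  exact angle_absolutelyContinuous.ae_le (hc.ae_notMem volume)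

lemma ne_cos_ae {s : ℝ} (hs : 0 < s) (x : ℝ) : ∀ᵐ θ ∂angle, x - s * Real.cos θ ≠ 0 := by
  have hc : {θ | x - s * Real.cos θ = 0}.Countable := by
    have hsub : {θ | x - s * Real.cos θ = 0} ⊆ range (fun k : ℤ =>
        2 * (k : ℝ) * Real.pi + Real.arccos (x / s)) ∪
        range (fun k : ℤ => 2 * (k : ℝ) * Real.pi - Real.arccos (x / s)) := by
      intro θ hθ
      have h1 : Real.cos θ = x / s := by
        rw [eq_div_iff hs.ne']
        linarith [mem_ofPred.1 hθ]
      have h2 : Real.cos (Real.arccos (x / s)) = Real.cos θ := by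
        rw [← h1]
        exact Real.cos_arccos (Real.neg_one_le_cos θ) (Real.cos_le_one θ)
      obtain ⟨k, hk | hk⟩ := Real.cos_eq_cos_iff.1 h2
      · exact Or.inl ⟨k, hk.symm⟩
      · exact Or.inr ⟨k, hk.symm⟩
    exact ((countable_range _).union (countable_range _)).mono hsub
  exact angle_absolutelyContinuous.ae_le (hc.ae_notMem volume)

variable {n : ℕ}

/-- The integral of the density of one point, given the others, is bounded below by Jensen's
inequality. -/
lemma le_lintegral_point {p c s : ℝ} (hp : 1 ≤ p) (hs : 0 < s) (x : Fin n → ℝ) :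
    ENNReal.ofReal (Real.exp (n * Real.log (s / 2) - c * (s ^ p * cosMoment p) + Real.log s +
      ∫ θ, Real.log (Real.sin θ) ∂angle)) ≤
      ∫⁻ u, ENNReal.ofReal ((∏ j, |x j - u|) * Real.exp (-c * |u| ^ p)) := by
  have hp0 : 0 ≤ p := by linarith
  set F : ℝ → ℝ := fun θ => Real.log (Real.sin θ) + ∑ j, Real.log |x j - s * Real.cos θ| +
    -c * (s ^ p * |Real.cos θ| ^ p) with hF
  have i1 : Integrable (fun θ => ∑ j, Real.log |x j - s * Real.cos θ|) angle :=
    integrable_finsetSum _ fun j _ => integrable_log_abs_sub_cos (x j) hs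
  have i2 : Integrable (fun θ => -c * (s ^ p * |Real.cos θ| ^ p)) angle :=
    integrable_angle (Continuous.intervalIntegrable
      (((continuous_abs_rpow hp0).comp Real.continuous_cos).const_mul _ |>.const_mul _) _ _)
  have i12 : Integrable (fun θ => Real.log (Real.sin θ) +
    ∑ j, Real.log |x j - s * Real.cos θ|) angle := integrable_log_sin.add i1
  have iF : Integrable F angle := i12.add i2
  set H : ℝ → ℝ := fun θ => |Real.sin θ| * ((∏ j, |x j - s * Real.cos θ|) *
    Real.exp (-c * |s * Real.cos θ| ^ p)) with hH
  have hHc : Continuous H := by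
    have := (continuous_abs_rpow hp0).comp (Real.continuous_cos.const_mul s)
    simp only [hH]
    exact Real.continuous_sin.abs.mul ((continuous_finsetProd _ fun j _ => by fun_prop).mul
      (Real.continuous_exp.comp (this.const_mul _)))
  have iH : Integrable H angle := integrable_angle (hHc.intervalIntegrable _ _)
  have hFH : ∀ᵐ θ ∂angle, Real.exp (F θ) = H θ := by
    have h : ∀ᵐ θ ∂angle, ∀ j, x j - s * Real.cos θ ≠ 0 := ae_all_iff.2 fun j => ne_cos_ae hs (x j)
    filter_upwards [sin_ne_zero_ae, h] with θ h1 h2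
    have h3 : ∏ j, Real.exp (Real.log |x j - s * Real.cos θ|) = ∏ j, |x j - s * Real.cos θ| :=
      Finset.prod_congr rfl fun j _ => Real.exp_log (abs_pos.2 (h2 j))
    rw [hF, hH]
    simp only
    rw [Real.exp_add, Real.exp_add, Real.exp_sum, h3, ← Real.log_abs, Real.exp_log (abs_pos.2 h1),
      abs_mul, abs_of_pos hs, Real.mul_rpow hs.le (abs_nonneg _), mul_assoc]
  have hJ : Real.exp (∫ θ, F θ ∂angle) ≤ ∫ θ, H θ ∂angle := by
    rw [← integral_congr_ae hFH]
    exact convexOn_exp.map_integral_le Real.continuous_exp.continuousOn isClosed_univ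
      (ae_of_all _ fun _ => mem_univ _) iF (iH.congr (hFH.mono fun _ h => h.symm))
  have eF : n * Real.log (s / 2) - c * (s ^ p * cosMoment p) + ∫ θ, Real.log (Real.sin θ) ∂angle ≤
      ∫ θ, F θ ∂angle := by
    have e1 : ∫ θ, F θ ∂angle = ∫ θ, (Real.log (Real.sin θ) +
        ∑ j, Real.log |x j - s * Real.cos θ|) ∂angle +
        ∫ θ, -c * (s ^ p * |Real.cos θ| ^ p) ∂angle := integral_add i12 i2
    have e2 : ∫ θ, (Real.log (Real.sin θ) + ∑ j, Real.log |x j - s * Real.cos θ|) ∂angle =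
        ∫ θ, Real.log (Real.sin θ) ∂angle + ∫ θ, ∑ j, Real.log |x j - s * Real.cos θ| ∂angle :=
      integral_add integrable_log_sin i1
    have e3 : n * Real.log (s / 2) ≤ ∫ θ, ∑ j, Real.log |x j - s * Real.cos θ| ∂angle := by
      rw [integral_finsetSum _ fun j _ => integrable_log_abs_sub_cos (x j) hs]
      simp_rw [integral_log_abs_sub_cos _ hs]
      have : ∑ _j : Fin n, Real.log (s / 2) = n * Real.log (s / 2) := by simp
      rw [← this]
      exact Finset.sum_le_sum fun j _ => le_add_of_nonneg_right (green_nonneg _)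
    rw [e1, e2, integral_const_mul, integral_const_mul, ← cosMoment]
    linarith
  have hlow := (lintegral_angle_le hs
    (g := fun u => ENNReal.ofReal ((∏ j, |x j - u|) * Real.exp (-c * |u| ^ p))))
  refine le_trans ?_ hlow
  simp_rw [← ENNReal.ofReal_mul (abs_nonneg _)]
  rw [← ofReal_integral_eq_lintegral_ofReal iH (ae_of_all _ fun θ => by positivity),
    ← ENNReal.ofReal_mul hs.le]
  refine ENNReal.ofReal_le_ofReal ?_
  rw [add_right_comm, Real.exp_add, Real.exp_log hs, mul_comm]
  gcongr
  exact (Real.exp_le_exp.2 eF).trans hJ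

/-- The partition function of the Gibbs measure with potential `c |x| ^ p`. -/
noncomputable def gibbs (n : ℕ) (p c : ℝ) : ℝ≥0∞ :=
  ∫⁻ x : Fin n → ℝ, ENNReal.ofReal (vand x * Real.exp (-c * ∑ i, |x i| ^ p))

lemma gibbs_zero (p c : ℝ) : gibbs 0 p c = 1 := by
  simp [gibbs, vand, volume_pi]

lemma vand_cons (u : ℝ) (x : Fin n → ℝ) :
    vand (Fin.cons u x : Fin (n + 1) → ℝ) = (∏ j, |x j - u|) * vand x := by
  rw [vand, Fin.prod_univ_succ, Fin.prod_Ioi_zero, vand]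
  congr 1
  refine Finset.prod_congr rfl fun i _ => ?_
  rw [Fin.prod_Ioi_succ]
  rfl

lemma lintegral_cons {F : (Fin (n + 1) → ℝ) → ℝ≥0∞} (hF : Measurable F) :
    ∫⁻ x, F x = ∫⁻ x : Fin n → ℝ, ∫⁻ u : ℝ, F (Fin.cons u x) := by
  have e := (volume_preserving_piFinSuccAbove (fun _ : Fin (n + 1) => ℝ) 0).symm
  have h : ∀ (u : ℝ) (x : Fin n → ℝ),
      (MeasurableEquiv.piFinSuccAbove (fun _ => ℝ) 0).symm (u, x) = Fin.cons u x := fun u x => by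
    simp
    rfl
  rw [← e.lintegral_comp hF, Measure.volume_eq_prod, lintegral_prod_symm]
  · simp_rw [h]
  · exact (hF.comp (MeasurableEquiv.measurable _)).aemeasurable

lemma measurable_gibbs_density {p : ℝ} (c : ℝ) :
    Measurable fun x : Fin n → ℝ => ENNReal.ofReal (vand x * Real.exp (-c * ∑ i, |x i| ^ p)) := by
  have := (continuous_vand (n := n)).measurable
  fun_prop

lemma gibbs_density_cons (p c u : ℝ) (x : Fin n → ℝ) :
    ENNReal.ofReal (vand (Fin.cons u x : Fin (n + 1) → ℝ) *
      Real.exp (-c * ∑ i, |(Fin.cons u x : Fin (n + 1) → ℝ) i| ^ p)) =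
      ENNReal.ofReal (vand x * Real.exp (-c * ∑ i, |x i| ^ p)) *
        ENNReal.ofReal ((∏ j, |x j - u|) * Real.exp (-c * |u| ^ p)) := by
  rw [← ENNReal.ofReal_mul (mul_nonneg (vand_nonneg x) (Real.exp_pos _).le), vand_cons,
    Fin.sum_univ_succ]
  simp only [Fin.cons_zero, Fin.cons_succ]
  rw [mul_add, Real.exp_add]
  congr 1
  ring

lemma gibbs_succ_ge {p s : ℝ} (c : ℝ) (hp : 1 ≤ p) (hs : 0 < s) (n : ℕ) :
    gibbs n p c * ENNReal.ofReal (Real.exp (n * Real.log (s / 2) - c * (s ^ p * cosMoment p) +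
      Real.log s + ∫ θ, Real.log (Real.sin θ) ∂angle)) ≤ gibbs (n + 1) p c := by
  rw [gibbs, gibbs, lintegral_cons (measurable_gibbs_density c)]
  simp_rw [gibbs_density_cons]
  rw [← lintegral_mul_const' _ _ ENNReal.ofReal_ne_top]
  refine lintegral_mono fun x => ?_
  rw [lintegral_const_mul' _ _ ENNReal.ofReal_ne_top]
  gcongr
  exact le_lintegral_point hp hs x

end SymBall

namespace SymBall

variable {n : ℕ}

lemma vandMeasure_powBall {p a : ℝ} (hp : 1 ≤ p) (ha : 0 < a) (hn : 0 < n) :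
    vandMeasure n (powBall n p a) =
      ENNReal.ofReal ((a / n) ^ (symDim n / p)) * vandMeasure n (powBall n p n) := by
  have hp0 : p ≠ 0 := by linarith
  have hn' : (0 : ℝ) < n := by exact_mod_cast hn
  have hl : (0 : ℝ) < (a / n) ^ (1 / p) := by positivity
  have h := vandMeasure_smul hl (measurableSet_powBall (n := n) p n)
  rw [smul_powBall hl, ← Real.rpow_mul (by positivity), one_div_mul_cancel hp0, Real.rpow_one,
    div_mul_cancel₀ _ hn'.ne', ← ENNReal.ofReal_pow hl.le, ← Real.rpow_natCast,
    ← Real.rpow_mul (by positivity)] at h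
  rw [h, one_div_mul_eq_div]

lemma rpow_div_le {D L : ℝ} (hD : 2 ≤ D) (hL : 0 ≤ L) :
    (L / D) ^ D ≤ Real.exp (2 - D) * Real.exp (L * (1 - 1 / D)) := by
  have hD0 : 0 < D := by linarith
  have hu : 0 < D - 1 := by linarith
  have h1 : L / D ≤ Real.exp (L * (1 - 1 / D) / D - 1) * Real.exp (1 / (D - 1)) := by
    have a1 := Real.add_one_le_exp (L * (1 - 1 / D) / D - 1)
    have a2 := Real.add_one_le_exp (1 / (D - 1))
    have a3 : L / D = (L * (1 - 1 / D) / D - 1 + 1) * (1 / (D - 1) + 1) := by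
      field_simp
      ring
    rw [a3]
    have : 0 < 1 / (D - 1) := by positivity
    exact mul_le_mul a1 a2 (by positivity) (Real.exp_pos _).le
  calc (L / D) ^ D ≤ (Real.exp (L * (1 - 1 / D) / D - 1) * Real.exp (1 / (D - 1))) ^ D :=
        Real.rpow_le_rpow (by positivity) h1 hD0.le
    _ = Real.exp (D / (D - 1) - D) * Real.exp (L * (1 - 1 / D)) := by
        rw [← Real.exp_add, ← Real.exp_mul, ← Real.exp_add]
        congr 1
        field_simp
        ring
    _ ≤ _ := by
        gcongr
        rw [div_le_iff₀ hu]
        linarith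

lemma lintegral_rpow_Ioo {r : ℝ} (hr : -1 < r) :
    ∫⁻ t in Ioo (0 : ℝ) 1, ENNReal.ofReal (t ^ r) = ENNReal.ofReal (1 / (r + 1)) := by
  have hi : IntegrableOn (fun t : ℝ => t ^ r) (Ioc 0 1) :=
    (intervalIntegrable_iff_integrableOn_Ioc_of_le zero_le_one).1
      (intervalIntegral.intervalIntegrable_rpow' hr)
  rw [setLIntegral_congr Ioo_ae_eq_Ioc, ← ofReal_integral_eq_lintegral_ofReal hi]
  · rw [← intervalIntegral.integral_of_le zero_le_one, integral_rpow (Or.inl hr), Real.one_rpow,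
      Real.zero_rpow (by linarith), sub_zero]
  · filter_upwards [ae_restrict_mem measurableSet_Ioc] with t ht
    exact Real.rpow_nonneg ht.1.le _

lemma gibbs_eq_lintegral_vandMeasure {p : ℝ} (c : ℝ) :
    gibbs n p c =
      ∫⁻ x, ENNReal.ofReal (Real.exp (-c * ∑ i, |x i| ^ p)) ∂vandMeasure n := by
  rw [gibbs, vandMeasure, lintegral_withDensity_eq_lintegral_mul _
    continuous_vand.measurable.ennreal_ofReal (by fun_prop)]
  refine lintegral_congr fun x => ?_
  rw [ENNReal.ofReal_mul (vand_nonneg x)]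
  rfl

lemma gibbs_le_powBall {p D : ℝ} (hp : 1 ≤ p) (hn : 0 < n) (hD : 2 ≤ D)
    (hDn : D = symDim n / p) :
    gibbs n p (D / n) ≤
      ENNReal.ofReal (D * Real.exp (2 - D)) * vandMeasure n (powBall n p n) := by
  have hn' : (0 : ℝ) < n := by exact_mod_cast hn
  have hD0 : 0 < D := by linarith
  have hc : 0 < D / n := by positivity
  rw [gibbs_eq_lintegral_vandMeasure, lintegral_eq_lintegral_meas_le _
    (ae_of_all _ fun x => (Real.exp_pos _).le)
    (by fun_prop : Measurable fun x : Fin n → ℝ =>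
      Real.exp (-(D / n) * ∑ i, |x i| ^ p)).aemeasurable]
  set M := vandMeasure n (powBall n p n) with hM
  have key : ∀ t ∈ Ioi (0 : ℝ), t ≠ 1 →
      vandMeasure n {x | t ≤ Real.exp (-(D / n) * ∑ i, |x i| ^ p)} ≤
      (Ioo (0 : ℝ) 1).indicator (fun t => ENNReal.ofReal (Real.exp (2 - D)) * M *
        ENNReal.ofReal (t ^ (-(1 - 1 / D)))) t := by
    intro t ht h1
    have ht : 0 < t := ht
    rcases lt_or_gt_of_ne h1 with h1 | h1
    · rw [indicator_of_mem (show t ∈ Ioo (0 : ℝ) 1 from ⟨ht, h1⟩)]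
      have hlog := Real.log_neg ht h1
      have e : {x | t ≤ Real.exp (-(D / n) * ∑ i, |x i| ^ p)} =
          powBall n p (-Real.log t / (D / n)) := by
        ext x
        rw [powBall, Set.mem_ofPred_eq, Set.mem_ofPred_eq, ← Real.log_le_iff_le_exp ht,
          le_div_iff₀ hc]
        constructor <;> intro h <;> linarith
      rw [e, vandMeasure_powBall hp (by apply div_pos <;> linarith) hn, ← hDn, ← hM,
        mul_right_comm, ← ENNReal.ofReal_mul (Real.exp_pos _).le]
      gcongr
      have e2 : -Real.log t / (D / n) / n = -Real.log t / D := by field_simp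
      rw [e2, Real.rpow_def_of_pos ht]
      refine (rpow_div_le hD (by linarith)).trans (le_of_eq ?_)
      congr 2
      ring
    · have e : {x : Fin n → ℝ | t ≤ Real.exp (-(D / n) * ∑ i, |x i| ^ p)} = ∅ := by
        refine eq_empty_of_forall_notMem fun x hx => ?_
        have h2 : t ≤ Real.exp (-(D / n) * ∑ i, |x i| ^ p) := hx
        have h3 : Real.exp (-(D / n) * ∑ i, |x i| ^ p) ≤ 1 := by
          rw [Real.exp_le_one_iff, neg_mul, neg_nonpos]
          positivity
        linarith
      rw [e, measure_empty]
      exact zero_le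
  calc _ ≤ ∫⁻ t in Ioi (0 : ℝ), (Ioo (0 : ℝ) 1).indicator (fun t =>
        ENNReal.ofReal (Real.exp (2 - D)) * M * ENNReal.ofReal (t ^ (-(1 - 1 / D)))) t := by
        refine lintegral_mono_ae ?_
        have h1 : ∀ᵐ t ∂(volume.restrict (Ioi (0 : ℝ))), t ≠ 1 :=
          ae_restrict_of_ae (Measure.ae_ne volume 1)
        filter_upwards [ae_restrict_mem measurableSet_Ioi, h1] with t ht h1
        exact key t ht h1
    _ ≤ ∫⁻ t, (Ioo (0 : ℝ) 1).indicator (fun t =>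
        ENNReal.ofReal (Real.exp (2 - D)) * M * ENNReal.ofReal (t ^ (-(1 - 1 / D)))) t :=
        setLIntegral_le_lintegral _ _
    _ = _ := by
        have hMt : M ≠ ∞ := (vandMeasure_powBall_lt_top hp _).ne
        have hr : -1 < -(1 - 1 / D) := by
          have : 0 < 1 / D := by positivity
          linarith
        rw [lintegral_indicator measurableSet_Ioo, lintegral_const_mul' _ _
          (ENNReal.mul_ne_top ENNReal.ofReal_ne_top hMt), lintegral_rpow_Ioo hr,
          mul_right_comm, ← ENNReal.ofReal_mul (Real.exp_pos _).le, mul_comm (Real.exp (2 - D))]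
        congr 3
        field_simp
        ring

lemma vandMeasure_le_exp_mul {p c : ℝ} (hc : 0 ≤ c) {S : Set (Fin n → ℝ)}
    (hS : S ⊆ powBall n p n) (hSm : MeasurableSet S) :
    vandMeasure n S ≤ ENNReal.ofReal (Real.exp (c * n)) *
      ∫⁻ x in S, ENNReal.ofReal (vand x * Real.exp (-c * ∑ i, |x i| ^ p)) := by
  rw [vandMeasure_apply, ← lintegral_const_mul' _ _ ENNReal.ofReal_ne_top]
  refine setLIntegral_mono' hSm fun x hx => ?_
  rw [← ENNReal.ofReal_mul (Real.exp_pos _).le]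
  refine ENNReal.ofReal_le_ofReal ?_
  have h1 : ∑ i, |x i| ^ p ≤ n := hS hx
  rw [mul_left_comm, ← Real.exp_add]
  refine le_mul_of_one_le_right (vand_nonneg x) (Real.one_le_exp ?_)
  nlinarith

end SymBall

namespace SymBall

variable {n : ℕ}

lemma eventually_mul_one_add_log_le (C : ℝ) {ρ : ℝ} (hρ : 0 < ρ) :
    ∀ᶠ n : ℕ in atTop, C * (1 + Real.log (n + 1)) ≤ ρ * n := by
  have h1 : Tendsto (fun n : ℕ => (n : ℝ) + 1) atTop atTop :=
    tendsto_atTop_add_const_right _ _ tendsto_natCast_atTop_atTop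
  have hη : 0 < ρ / (4 * (|C| + 1)) := by positivity
  have h2 := h1.eventually (Real.isLittleO_log_id_atTop.bound hη)
  have h3 := tendsto_natCast_atTop_atTop.eventually_ge_atTop (2 * (|C| + 1) / ρ)
  filter_upwards [h2, h3, eventually_ge_atTop 1] with n h2 h3 h4
  have h4' : (1 : ℝ) ≤ n := by exact_mod_cast h4
  have hl : 0 ≤ Real.log (n + 1) := Real.log_nonneg (by linarith)
  rw [id, Real.norm_of_nonneg hl, Real.norm_of_nonneg (by positivity), div_mul_eq_mul_div,
    le_div_iff₀ (by positivity)] at h2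
  rw [div_le_iff₀ hρ] at h3
  have h5 : C * (1 + Real.log (n + 1)) ≤ (|C| + 1) * (1 + Real.log (n + 1)) := by
    gcongr
    linarith [le_abs_self C]
  nlinarith [abs_nonneg C]

lemma eventually_mul_mul_one_add_log_le (C : ℝ) {ρ : ℝ} (hρ : 0 < ρ) :
    ∀ᶠ n : ℕ in atTop, C * n * (1 + Real.log (n + 1)) ≤ ρ * (n : ℝ) ^ 2 := by
  filter_upwards [eventually_mul_one_add_log_le C hρ] with n h
  nlinarith [mul_le_mul_of_nonneg_left h n.cast_nonneg (α := ℝ)]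

lemma gibbs_ge_prod {p : ℝ} (c : ℝ) (hp : 1 ≤ p) {s : ℕ → ℝ} (hs : ∀ k, 0 < s k) (n : ℕ) :
    ENNReal.ofReal (Real.exp (∑ k ∈ Finset.range n, (k * Real.log (s k / 2) -
      c * (s k ^ p * cosMoment p) + Real.log (s k) + ∫ θ, Real.log (Real.sin θ) ∂angle))) ≤
      gibbs n p c := by
  induction n with
  | zero => simp [gibbs_zero]
  | succ n ih =>
    rw [Finset.sum_range_succ, Real.exp_add, ENNReal.ofReal_mul (Real.exp_pos _).le]
    exact le_trans (by gcongr) (gibbs_succ_ge c hp (hs n) n)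

lemma sum_mul_log_ge (n : ℕ) :
    (n : ℝ) ^ 2 / 2 * Real.log n - (n : ℝ) ^ 2 / 4 ≤
      ∑ k ∈ Finset.range n, ((k : ℝ) + 1) * Real.log (k + 1) := by
  induction n with
  | zero => simp
  | succ n ih =>
    rw [Finset.sum_range_succ]
    push_cast
    rcases Nat.eq_zero_or_pos n with rfl | hn
    · simp
    have hn' : (0 : ℝ) < n := by exact_mod_cast hn
    have h0 : 0 ≤ Real.log (n + 1) := Real.log_nonneg (by linarith)
    have h1 : n * (Real.log (n + 1) - Real.log n) ≤ 1 := by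
      rw [← Real.log_div (by positivity) hn'.ne']
      have := Real.log_le_sub_one_of_pos (show 0 < ((n : ℝ) + 1) / n by positivity)
      have h2 : ((n : ℝ) + 1) / n - 1 = 1 / n := by field_simp; ring
      rw [h2] at this
      calc _ ≤ (n : ℝ) * (1 / n) := by gcongr
        _ = 1 := by field_simp
    nlinarith

lemma gibbs_ge {p : ℝ} (hp : 1 ≤ p) : ∃ C : ℝ, 0 ≤ C ∧ ∀ n : ℕ, 0 < n →
    ENNReal.ofReal (Real.exp ((n : ℝ) ^ 2 / 2 * limEnergy p - n * (n + 1) / (2 * p) -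
      C * n * (1 + Real.log (n + 1)))) ≤ gibbs n p ((n + 1) / (2 * p)) := by
  have hp0 : 0 < p := by linarith
  set b := limRadius p with hb_def
  have hb : 0 < b := limRadius_pos hp
  set κ := ∫ θ, Real.log (Real.sin θ) ∂angle with hκ
  refine ⟨|Real.log (b / 2)| + |Real.log b| + |κ| + 1, by positivity, fun n hn => ?_⟩
  have hn' : (1 : ℝ) ≤ n := by exact_mod_cast hn
  have hl : 0 ≤ Real.log (n + 1) := Real.log_nonneg (by linarith)
  set s : ℕ → ℝ := fun k => b * (((k : ℝ) + 1) / (n + 1)) ^ (1 / p) with hs_def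
  have hs : ∀ k, 0 < s k := fun k => by positivity
  refine le_trans (ENNReal.ofReal_le_ofReal (Real.exp_le_exp.2 ?_)) (gibbs_ge_prod _ hp hs n)
  have hterm : ∀ k : ℕ, (k : ℝ) * Real.log (s k / 2) -
      (n + 1) / (2 * p) * (s k ^ p * cosMoment p) + Real.log (s k) + κ =
      k * Real.log (b / 2) + 1 / p * (((k : ℝ) + 1) * Real.log (k + 1)) -
        (1 / p * Real.log (n + 1) + 1 / p) * ((k : ℝ) + 1) + (Real.log b + κ) := by
    intro k
    have e1 : s k ^ p * cosMoment p = 2 * (((k : ℝ) + 1) / (n + 1)) := by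
      have hm := cosMoment_pos hp
      rw [hs_def, Real.mul_rpow hb.le (by positivity), ← Real.rpow_mul (by positivity),
        one_div_mul_cancel hp0.ne', Real.rpow_one, hb_def, limRadius_rpow hp]
      field_simp
    have e2 : Real.log (s k) = Real.log b + 1 / p * (Real.log (k + 1) - Real.log (n + 1)) := by
      rw [hs_def, Real.log_mul hb.ne' (by positivity), Real.log_rpow (by positivity),
        Real.log_div (by positivity) (by positivity)]
    rw [e1, Real.log_div (hs k).ne' two_ne_zero, e2, Real.log_div hb.ne' two_ne_zero]
    field_simp
    ring
  have hk : ∑ k ∈ Finset.range n, (k : ℝ) = n * (n - 1) / 2 := by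
    clear_value s
    induction n with
    | zero => simp
    | succ m ih =>
      clear ih
      have := Finset.sum_range_id_mul_two (m + 1)
      have h2 : (∑ k ∈ Finset.range (m + 1), (k : ℝ)) * 2 = ((m + 1 : ℕ) : ℝ) * m := by
        rw [Nat.add_sub_cancel] at this
        rw [← Nat.cast_sum]
        exact_mod_cast this
      push_cast at h2 ⊢
      linarith
  have hk1 : ∑ k ∈ Finset.range n, ((k : ℝ) + 1) = n * (n + 1) / 2 := by
    rw [Finset.sum_add_distrib, hk, Finset.sum_const, Finset.card_range, nsmul_eq_mul]
    ring
  rw [Finset.sum_congr rfl fun k _ => hterm k]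
  rw [Finset.sum_add_distrib, Finset.sum_sub_distrib, Finset.sum_add_distrib, ← Finset.sum_mul,
    ← Finset.mul_sum, ← Finset.mul_sum, hk, hk1, Finset.sum_const, Finset.card_range, nsmul_eq_mul]
  have hsum : -((n : ℝ) ^ 2 / 4) - n / 2 * (1 + Real.log (n + 1)) ≤
      ∑ k ∈ Finset.range n, ((k : ℝ) + 1) * Real.log (k + 1) -
        Real.log (n + 1) * (n * (n + 1) / 2) := by
    have h1 : n * (Real.log (n + 1) - Real.log n) ≤ 1 := by
      rw [← Real.log_div (by positivity) (by positivity)]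
      have := Real.log_le_sub_one_of_pos (show 0 < ((n : ℝ) + 1) / n by positivity)
      have h2 : ((n : ℝ) + 1) / n - 1 = 1 / n := by field_simp; ring
      rw [h2] at this
      calc _ ≤ (n : ℝ) * (1 / n) := by gcongr
        _ = 1 := by field_simp
    have := sum_mul_log_ge n
    nlinarith
  have hsum' := mul_le_mul_of_nonneg_left hsum (show 0 ≤ 1 / p by positivity)
  have hp1 : 1 / p ≤ 1 := by rw [div_le_one hp0]; exact hp
  have hx : 0 ≤ (n : ℝ) / 2 * (1 + Real.log (n + 1)) := by positivity
  have h3 : 1 / p * (n / 2 * (1 + Real.log (n + 1))) ≤ n * (1 + Real.log (n + 1)) := by nlinarith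
  have h4 : (|Real.log (b / 2)| + |Real.log b| + |κ|) * n ≤
      (|Real.log (b / 2)| + |Real.log b| + |κ|) * n * (1 + Real.log (n + 1)) :=
    le_mul_of_one_le_right (by positivity) (by linarith)
  have h5 := mul_le_mul_of_nonneg_right (neg_abs_le (Real.log b)) n.cast_nonneg (α := ℝ)
  have h6 := mul_le_mul_of_nonneg_right (neg_abs_le κ) n.cast_nonneg (α := ℝ)
  have h7 := mul_le_mul_of_nonneg_right (le_abs_self (Real.log (b / 2))) n.cast_nonneg (α := ℝ)
  have h8 : 0 ≤ |Real.log (b / 2)| * n := by positivity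
  have e9 : limEnergy p = Real.log (b / 2) - 1 / p / 2 := by
    rw [limEnergy]; ring
  have e10 : (n : ℝ) * (n + 1) / (2 * p) = 1 / p * (n * (n + 1) / 2) := by field_simp
  rw [e9, e10]
  linarith

lemma symDim_cast (n : ℕ) : (symDim n : ℝ) = n * (n + 1) / 2 := by
  rw [symDim, Nat.cast_div (Nat.even_mul_succ_self n).two_dvd two_ne_zero]
  push_cast
  ring

lemma symDim_div_le_exp {p : ℝ} (hp : 1 ≤ p) (n : ℕ) :
    (symDim n : ℝ) / p ≤ Real.exp (2 * Real.log (n + 1)) := by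
  have h1 : Real.exp (2 * Real.log (n + 1)) = ((n : ℝ) + 1) ^ 2 := by
    rw [mul_comm, Real.exp_mul, Real.exp_log (by positivity), Real.rpow_two]
  rw [h1, symDim_cast]
  refine (div_le_self (by positivity) hp).trans ?_
  nlinarith [n.cast_nonneg (α := ℝ)]

lemma gibbs_le_ballVol {p : ℝ} (hp : 1 ≤ p) (hn : 0 < n) (hD : 2 ≤ (symDim n : ℝ) / p) :
    gibbs n p ((n + 1) / (2 * p)) ≤ ENNReal.ofReal (Real.exp (2 + 2 * Real.log (n + 1) -
      n * (n + 1) / (2 * p)) * ballVol n p) := by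
  have hn' : (0 : ℝ) < n := by exact_mod_cast hn
  have hp0 : 0 < p := by linarith
  have h := gibbs_le_powBall hp hn hD rfl
  have e1 : (symDim n : ℝ) / p / n = (n + 1) / (2 * p) := by
    rw [symDim_cast]
    field_simp
  have e2 : (n : ℝ) * (n + 1) / (2 * p) = symDim n / p := by
    rw [symDim_cast]
    field_simp
  rw [e1] at h
  refine h.trans ?_
  rw [ENNReal.ofReal_mul (Real.exp_pos _).le, ballVol, ENNReal.ofReal_toReal
    (vandMeasure_powBall_lt_top hp _).ne, e2,
    show 2 + 2 * Real.log (n + 1) - symDim n / p = 2 * Real.log (n + 1) + (2 - symDim n / p) by ring,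
    Real.exp_add]
  gcongr
  exact symDim_div_le_exp hp n

lemma exp_le_ballVol {p : ℝ} (hp : 1 ≤ p) : ∃ C : ℝ, ∀ n : ℕ, 0 < n → 2 ≤ (symDim n : ℝ) / p →
    Real.exp ((n : ℝ) ^ 2 / 2 * limEnergy p - C * n * (1 + Real.log (n + 1))) ≤ ballVol n p := by
  obtain ⟨C, -, hC⟩ := gibbs_ge hp
  refine ⟨C + 2, fun n hn hD => ?_⟩
  have hn' : (1 : ℝ) ≤ n := by exact_mod_cast hn
  have hl : 0 ≤ Real.log (n + 1) := Real.log_nonneg (by linarith)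
  have h := (hC n hn).trans (gibbs_le_ballVol hp hn hD)
  have hb := ballVol_pos hp hn
  rw [ENNReal.ofReal_le_ofReal_iff (by positivity)] at h
  rw [← mul_le_mul_iff_of_pos_left (Real.exp_pos (2 + 2 * Real.log (n + 1) -
      n * (n + 1) / (2 * p))), ← Real.exp_add]
  refine le_trans (Real.exp_le_exp.2 ?_) h
  nlinarith

lemma eventually_two_le_symDim_div {p : ℝ} (hp : 1 ≤ p) :
    ∀ᶠ n : ℕ in atTop, 2 ≤ (symDim n : ℝ) / p := by
  have hp0 : 0 < p := by linarith
  filter_upwards [tendsto_natCast_atTop_atTop.eventually_ge_atTop (4 * p),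
    eventually_ge_atTop 1] with n h h1
  have h1' : (1 : ℝ) ≤ n := by exact_mod_cast h1
  rw [le_div_iff₀ hp0, symDim_cast]
  nlinarith

lemma eventually_exp_le_ballVol {p ρ : ℝ} (hp : 1 ≤ p) (hρ : 0 < ρ) :
    ∀ᶠ n : ℕ in atTop, Real.exp ((n : ℝ) ^ 2 / 2 * (limEnergy p - ρ)) ≤ ballVol n p := by
  obtain ⟨C, hC⟩ := exp_le_ballVol hp
  filter_upwards [eventually_two_le_symDim_div hp, eventually_gt_atTop 0,
    eventually_mul_mul_one_add_log_le C (half_pos hρ)] with n h1 h2 h3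
  refine le_trans (Real.exp_le_exp.2 ?_) (hC n h2 h1)
  linarith

lemma vandMeasure_le_of_box {K E : ℝ} (hK : 0 ≤ K) {S : Set (Fin n → ℝ)} (hSm : MeasurableSet S)
    (hS : ∀ x ∈ S, ∀ i, |x i| ≤ K) (hE : ∀ x ∈ S, vand x ≤ Real.exp E) :
    vandMeasure n S ≤ ENNReal.ofReal ((2 * K) ^ n * Real.exp E) := by
  have hsub : S ⊆ Icc (fun _ => -K) fun _ => K := fun x hx =>
    ⟨fun i => (abs_le.1 (hS x hx i)).1, fun i => (abs_le.1 (hS x hx i)).2⟩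
  calc vandMeasure n S = ∫⁻ x in S, ENNReal.ofReal (vand x) := vandMeasure_apply S
    _ ≤ ∫⁻ _ in S, ENNReal.ofReal (Real.exp E) :=
        setLIntegral_mono' hSm fun x hx => ENNReal.ofReal_le_ofReal (hE x hx)
    _ = ENNReal.ofReal (Real.exp E) * volume S := setLIntegral_const _ _
    _ ≤ ENNReal.ofReal (Real.exp E) * volume (Icc (fun _ : Fin n => -K) fun _ => K) := by gcongr
    _ = _ := by
        rw [Real.volume_Icc_pi, Finset.prod_const, Finset.card_univ, Fintype.card_fin,
          ← ENNReal.ofReal_pow (by linarith), ← ENNReal.ofReal_mul (Real.exp_pos _).le, mul_comm,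
          sub_neg_eq_add, two_mul]

lemma eventually_ballVol_le_exp {p ρ : ℝ} (hp : 1 ≤ p) (hρ : 0 < ρ) :
    ∀ᶠ n : ℕ in atTop, ballVol n p ≤ Real.exp ((n : ℝ) ^ 2 / 2 * (limEnergy p + ρ)) := by
  have hb := limRadius_pos hp
  set b := limRadius p with hb_def
  set ε := b / 2 * (ρ / 8) ^ 2 with hε_def
  have hε : 0 < ε := by positivity
  have hs : 4 * √(2 * (ε / b)) = ρ / 2 := by
    have : 2 * (ε / b) = (ρ / 8) ^ 2 := by
      rw [hε_def]
      field_simp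
    rw [this, Real.sqrt_sq (by positivity)]
    ring
  filter_upwards [eventually_gt_atTop 0, eventually_mul_mul_one_add_log_le
    (Real.log 2 + 1 + |Real.log ε| / 2) (show 0 < ρ / 4 by positivity)] with n hn h
  have hn' : (1 : ℝ) ≤ n := by exact_mod_cast hn
  have hl : 0 ≤ Real.log (n + 1) := Real.log_nonneg (by linarith)
  have h1 := vandMeasure_le_of_box (K := n) (by positivity)
    (measurableSet_powBall p (n : ℝ))
    (fun x hx i => (abs_le_of_mem_powBall hp hx i).trans_eq (max_eq_right hn'))
    (fun x hx => vand_le_of_mem_powBall hε hp hn hx)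
  have h2 := ENNReal.toReal_le_of_le_ofReal (by positivity) h1
  refine h2.trans ?_
  rw [← Real.exp_log (show (0 : ℝ) < 2 * n by positivity), ← Real.exp_nat_mul, ← Real.exp_add,
    Real.exp_le_exp, hs, Real.log_mul two_ne_zero (by positivity)]
  have h3 : Real.log n ≤ Real.log (n + 1) := Real.log_le_log (by positivity) (by linarith)
  have h4 := mul_le_mul_of_nonneg_left h3 n.cast_nonneg (α := ℝ)
  have h5 : -(n * Real.log ε / 2) ≤ n * (|Real.log ε| / 2) := by
    have := mul_le_mul_of_nonneg_left (neg_le_abs (Real.log ε)) n.cast_nonneg (α := ℝ)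
    linarith
  have h6 : 0 ≤ (Real.log 2 + |Real.log ε| / 2) * (n * Real.log (n + 1)) := by
    have := Real.log_nonneg (one_le_two (α := ℝ))
    positivity
  nlinarith

lemma tendsto_ballVol_rpow {p : ℝ} (hp : 1 ≤ p) :
    Tendsto (fun n : ℕ => ballVol n p ^ (1 / (symDim n : ℝ))) atTop
      (𝓝 (Real.exp (limEnergy p))) := by
  have key : Tendsto (fun n : ℕ => 1 / (symDim n : ℝ) * Real.log (ballVol n p)) atTop
      (𝓝 (limEnergy p)) := by
    have hfac : Tendsto (fun n : ℕ => (n : ℝ) / (n + 1)) atTop (𝓝 1) :=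
      tendsto_natCast_div_add_atTop 1
    have h2 : Tendsto (fun n : ℕ => Real.log (ballVol n p) / ((n : ℝ) ^ 2 / 2)) atTop
        (𝓝 (limEnergy p)) := by
      refine tendsto_order.2 ⟨fun a ha => ?_, fun a ha => ?_⟩
      · filter_upwards [eventually_exp_le_ballVol hp (half_pos (sub_pos.2 ha)),
          eventually_gt_atTop 0] with n h hn
        have hn' : (0 : ℝ) < n := by exact_mod_cast hn
        have h' := (Real.le_log_iff_exp_le (ballVol_pos hp hn)).2 h
        rw [lt_div_iff₀ (by positivity)]
        refine lt_of_lt_of_le ?_ h'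
        rw [mul_comm]
        gcongr
        linarith
      · filter_upwards [eventually_ballVol_le_exp hp (half_pos (sub_pos.2 ha)),
          eventually_gt_atTop 0] with n h hn
        have hn' : (0 : ℝ) < n := by exact_mod_cast hn
        have h' := (Real.log_le_iff_le_exp (ballVol_pos hp hn)).2 h
        rw [div_lt_iff₀ (by positivity)]
        refine lt_of_le_of_lt h' ?_
        rw [mul_comm a]
        gcongr
        linarith
    have h3 := hfac.mul h2
    rw [one_mul] at h3
    refine h3.congr' ?_
    filter_upwards [eventually_gt_atTop 0] with n hn
    have hn' : (0 : ℝ) < n := by exact_mod_cast hn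
    rw [symDim_cast]
    field_simp
  refine (Real.continuous_exp.continuousAt.tendsto.comp key).congr' ?_
  filter_upwards [eventually_gt_atTop 0] with n hn
  rw [Function.comp, mul_comm, Real.exp_mul, Real.exp_log (ballVol_pos hp hn)]

end SymBall

namespace SymBall

variable {n : ℕ}

lemma integrable_exp_neg_mul_abs {a : ℝ} (ha : 0 < a) :
    Integrable fun u : ℝ => Real.exp (-a * |u|) := by
  refine Integrable.of_integral_ne_zero ?_
  rw [integral_comp_abs (f := fun u => Real.exp (-a * u)), integral_exp_mul_Ioi (by linarith)]
  simp [ha.ne']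

lemma exists_forall_mul_exp_neg_le {a ε K₀ : ℝ} (ha : 0 < a) (hε : 0 < ε) :
    ∃ K : ℝ, K₀ ≤ K ∧ ∀ r, K ≤ r → r * Real.exp (-a * r) ≤ ε := by
  have h := tendsto_rpow_mul_exp_neg_mul_atTop_nhds_zero 1 a ha
  simp_rw [Real.rpow_one] at h
  obtain ⟨K, hK⟩ := eventually_atTop.1 (h.eventually_le_const hε)
  exact ⟨max K₀ K, le_max_left _ _, fun r hr => hK r ((le_max_right _ _).trans hr)⟩

lemma prod_abs_sub_le {u : ℝ} (hu : 1 ≤ |u|) (x : Fin n → ℝ) :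
    ∏ j, |x j - u| ≤ |u| ^ n * Real.exp (∑ j, |x j|) := by
  rw [Real.exp_sum]
  have h : |u| ^ n = ∏ _j : Fin n, |u| := by simp
  rw [h, ← Finset.prod_mul_distrib]
  refine Finset.prod_le_prod (fun j _ => abs_nonneg _) fun j _ => ?_
  have h1 := abs_sub (x j) u
  have h2 := Real.add_one_le_exp |x j|
  nlinarith [abs_nonneg (x j)]

lemma abs_le_one_add_rpow {p : ℝ} (hp : 1 ≤ p) (x : ℝ) : |x| ≤ 1 + |x| ^ p := by
  rcases le_total |x| 1 with h | h
  · have : 0 ≤ |x| ^ p := by positivity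
    linarith
  · linarith [Real.self_le_rpow_of_one_le h hp]

lemma sum_abs_le_of_mem_powBall {p a : ℝ} (hp : 1 ≤ p) {x : Fin n → ℝ}
    (hx : x ∈ powBall n p a) : ∑ i, |x i| ≤ n + a := by
  calc ∑ i, |x i| ≤ ∑ i, (1 + |x i| ^ p) := Finset.sum_le_sum fun i _ => abs_le_one_add_rpow hp _
    _ = n + ∑ i, |x i| ^ p := by simp [Finset.sum_add_distrib]
    _ ≤ n + a := add_le_add_right hx _

/-- A far away point contributes little to the Gibbs weight. -/
lemma outlier_weight_le {p a B K u : ℝ} {x : Fin n → ℝ} (hp : 1 ≤ p) (hK : 1 ≤ K)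
    (hKB : ∀ r, K ≤ r → r * Real.exp (-a * r) ≤ Real.exp (-B - 2)) (ha : 0 < a)
    (hx : (Fin.cons u x : Fin (n + 1) → ℝ) ∈ powBall (n + 1) p (n + 1 : ℕ)) (hu : K ≤ |u|) :
    (∏ j, |x j - u|) * Real.exp (-(((n : ℝ) + 2) * a) * |u| ^ p) ≤
      Real.exp (-B * (n + 1)) * Real.exp (-a * |u|) := by
  have hu1 : 1 ≤ |u| := hK.trans hu
  have h1 : ∑ j, |x j| ≤ 2 * (n + 1) := by
    have := sum_abs_le_of_mem_powBall hp hx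
    rw [Fin.sum_univ_succ] at this
    simp only [Fin.cons_zero, Fin.cons_succ] at this
    push_cast at this
    linarith [abs_nonneg u]
  have h2 : |u| ≤ |u| ^ p := Real.self_le_rpow_of_one_le hu1 hp
  calc _ ≤ (|u| ^ n * Real.exp (∑ j, |x j|)) * Real.exp (-(((n : ℝ) + 2) * a) * |u|) := by
        refine mul_le_mul (prod_abs_sub_le hu1 x) ?_ (Real.exp_pos _).le (by positivity)
        refine Real.exp_le_exp.2 ?_
        rw [neg_mul, neg_mul, neg_le_neg_iff]
        gcongr
    _ ≤ (|u| ^ (n + 1) * Real.exp (2 * (n + 1))) * Real.exp (-(((n : ℝ) + 2) * a) * |u|) := by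
        gcongr
        omega
    _ = (|u| * Real.exp (-a * |u|)) ^ (n + 1) * Real.exp (2 * (n + 1)) * Real.exp (-a * |u|) := by
        rw [mul_pow, ← Real.exp_nat_mul, mul_assoc, mul_assoc, mul_assoc, ← Real.exp_add,
          ← Real.exp_add, ← Real.exp_add]
        congr 2
        push_cast
        ring
    _ ≤ Real.exp (-B - 2) ^ (n + 1) * Real.exp (2 * (n + 1)) * Real.exp (-a * |u|) := by
        gcongr
        exact hKB _ hu
    _ = _ := by
        rw [← Real.exp_nat_mul, ← Real.exp_add]
        congr 2
        push_cast
        ring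

lemma measurableSet_powBall_inter_lt (p a K : ℝ) (i : Fin n) :
    MeasurableSet (powBall n p a ∩ {x | K < |x i|}) :=
  (measurableSet_powBall p a).inter (measurableSet_lt measurable_const (by fun_prop))

lemma vandMeasure_outlier_zero_le {p B K : ℝ} (hp : 1 ≤ p) (hK : 1 ≤ K)
    (hKB : ∀ r, K ≤ r → r * Real.exp (-(1 / (2 * p)) * r) ≤ Real.exp (-B - 2)) :
    vandMeasure (n + 1) (powBall (n + 1) p (n + 1 : ℕ) ∩ {x | K < |x 0|}) ≤
      ENNReal.ofReal (Real.exp (((n : ℝ) + 2) / (2 * p) * (n + 1) - B * (n + 1)) *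
        ∫ u, Real.exp (-(1 / (2 * p)) * |u|)) * gibbs n p (((n : ℝ) + 2) / (2 * p)) := by
  have hp0 : 0 < p := by linarith
  set S := powBall (n + 1) p (n + 1 : ℕ) ∩ {x : Fin (n + 1) → ℝ | K < |x 0|} with hS
  set c := ((n : ℝ) + 2) / (2 * p) with hc_def
  have hc : 0 ≤ c := by positivity
  have hSm : MeasurableSet S := measurableSet_powBall_inter_lt _ _ _ _
  have hJ : ∫⁻ u : ℝ, ENNReal.ofReal (Real.exp (-(1 / (2 * p)) * |u|)) =
      ENNReal.ofReal (∫ u, Real.exp (-(1 / (2 * p)) * |u|)) :=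
    (ofReal_integral_eq_lintegral_ofReal (integrable_exp_neg_mul_abs (by positivity))
      (ae_of_all _ fun _ => (Real.exp_pos _).le)).symm
  have h1 := vandMeasure_le_exp_mul hc (S := S) inter_subset_left hSm
  have h2 : ∫⁻ y in S, ENNReal.ofReal (vand y * Real.exp (-c * ∑ i, |y i| ^ p)) ≤
      ENNReal.ofReal (Real.exp (-B * (n + 1)) * ∫ u, Real.exp (-(1 / (2 * p)) * |u|)) *
        gibbs n p c := by
    rw [← lintegral_indicator hSm, lintegral_cons ((measurable_gibbs_density c).indicator hSm),
      gibbs, ← lintegral_const_mul' _ _ ENNReal.ofReal_ne_top]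
    refine lintegral_mono fun x => ?_
    calc _ ≤ ∫⁻ u, ENNReal.ofReal (vand x * Real.exp (-c * ∑ i, |x i| ^ p)) *
          ENNReal.ofReal (Real.exp (-B * (n + 1))) *
            ENNReal.ofReal (Real.exp (-(1 / (2 * p)) * |u|)) := by
          refine lintegral_mono fun u => ?_
          by_cases hu : (Fin.cons u x : Fin (n + 1) → ℝ) ∈ S
          · rw [indicator_of_mem hu, gibbs_density_cons, mul_assoc,
              ← ENNReal.ofReal_mul (Real.exp_pos _).le]
            have h3 := outlier_weight_le hp hK hKB (by positivity) hu.1 (le_of_lt hu.2)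
            rw [mul_one_div] at h3
            exact mul_le_mul_right (ENNReal.ofReal_le_ofReal h3) _
          · rw [indicator_of_notMem hu]
            exact zero_le
      _ = _ := by
          rw [lintegral_const_mul' _ _ (ENNReal.mul_ne_top ENNReal.ofReal_ne_top
            ENNReal.ofReal_ne_top), hJ, mul_assoc, ← ENNReal.ofReal_mul (Real.exp_pos _).le, mul_comm]
  refine h1.trans ((mul_le_mul_right h2 _).trans_eq ?_)
  rw [← mul_assoc, ← ENNReal.ofReal_mul (Real.exp_pos _).le, ← mul_assoc, ← Real.exp_add]
  push_cast
  congr 4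
  ring

lemma vandMeasure_outlier_eq (p a K : ℝ) (i j : Fin n) :
    vandMeasure n (powBall n p a ∩ {x | K < |x i|}) =
      vandMeasure n (powBall n p a ∩ {x | K < |x j|}) := by
  set σ := Equiv.swap i j
  rw [vandMeasure_apply, vandMeasure_apply,
    ← (measurePreserving_comp_perm σ).setLIntegral_comp_preimage
      (measurableSet_powBall_inter_lt p a K j) continuous_vand.measurable.ennreal_ofReal]
  simp_rw [vand_comp_perm]
  congr 2
  ext x
  have h : ∑ k, |x (σ k)| ^ p = ∑ k, |x k| ^ p := Equiv.sum_comp σ fun k => |x k| ^ p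
  have hj : σ j = i := Equiv.swap_apply_right i j
  simp [powBall, h, hj]

/-- Uniformly in the dimension, only an exponentially small part of the ball has a coordinate of
modulus larger than a suitable constant. -/
lemma exists_outlier_bound {p : ℝ} (hp : 1 ≤ p) (K₀ : ℝ) : ∃ K : ℝ, K₀ ≤ K ∧ 1 ≤ K ∧
    ∃ J : ℝ, 0 ≤ J ∧ ∀ n : ℕ, 0 < n → 2 ≤ (symDim n : ℝ) / p →
    (vandMeasure n (powBall n p n ∩ {x | ∃ i, K < |x i|})).toReal ≤
      J * Real.exp (3 * (1 + Real.log (n + 1)) - n) * ballVol n p := by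
  have hp0 : 0 < p := by linarith
  set κ := ∫ θ, Real.log (Real.sin θ) ∂angle with hκ
  have hm := cosMoment_pos hp
  set A := Real.log 2 + cosMoment p + |κ| with hA
  obtain ⟨K, hK0, hK⟩ := exists_forall_mul_exp_neg_le (a := 1 / (2 * p)) (ε := Real.exp (-(A + 1) - 2))
    (K₀ := max K₀ 1) (by positivity) (Real.exp_pos _)
  have hK1 : 1 ≤ K := (le_max_right _ _).trans hK0
  refine ⟨K, (le_max_left _ _).trans hK0, hK1, ∫ u, Real.exp (-(1 / (2 * p)) * |u|),
    integral_nonneg fun _ => (Real.exp_pos _).le, fun N hN hD => ?_⟩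
  set J := ∫ u, Real.exp (-(1 / (2 * p)) * |u|) with hJ
  have hJ0 : 0 ≤ J := integral_nonneg fun _ => (Real.exp_pos _).le
  obtain ⟨n, rfl⟩ : ∃ n, N = n + 1 := ⟨N - 1, by omega⟩
  have hV := ballVol_pos hp hN
  have h1 := vandMeasure_outlier_zero_le (n := n) hp hK1 hK
  have h2 := gibbs_succ_ge (((n : ℝ) + 2) / (2 * p)) hp one_pos n
  have h3 := gibbs_le_ballVol hp hN hD
  have e : ((n + 1 : ℕ) : ℝ) + 1 = n + 2 := by push_cast; ring
  rw [e] at h3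
  have h4 : gibbs n p (((n : ℝ) + 2) / (2 * p)) ≤ ENNReal.ofReal (Real.exp (A * (n + 1))) *
      gibbs (n + 1) p (((n : ℝ) + 2) / (2 * p)) := by
    refine le_trans ?_ (mul_le_mul_right h2 _)
    rw [mul_left_comm, ← ENNReal.ofReal_mul (Real.exp_pos _).le, ← Real.exp_add]
    refine le_mul_of_one_le_right' ?_
    rw [ENNReal.one_le_ofReal]
    refine Real.one_le_exp ?_
    rw [Real.one_rpow, one_mul, Real.log_one, one_div, Real.log_inv, ← hκ]
    have hc : ((n : ℝ) + 2) / (2 * p) ≤ n + 1 := by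
      rw [div_le_iff₀ (by positivity)]
      nlinarith [n.cast_nonneg (α := ℝ)]
    have hc' := mul_le_mul_of_nonneg_right hc hm.le
    have hl := Real.log_nonneg (one_le_two (α := ℝ))
    have hk := neg_abs_le κ
    have hk' : 0 ≤ |κ| * n := by positivity
    rw [hA]
    linarith
  have h5 : vandMeasure (n + 1) (powBall (n + 1) p (n + 1 : ℕ) ∩ {x | ∃ i, K < |x i|}) ≤
      ENNReal.ofReal (J * Real.exp (3 * (1 + Real.log ((n + 1 : ℕ) + 1)) - (n + 1 : ℕ)) *
        ballVol (n + 1) p) := by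
    have hU : powBall (n + 1) p (n + 1 : ℕ) ∩ {x | ∃ i, K < |x i|} =
        ⋃ i, powBall (n + 1) p (n + 1 : ℕ) ∩ {x | K < |x i|} := by
      rw [← inter_iUnion]
      congr 1
      ext x
      simp
    calc _ ≤ ∑ i : Fin (n + 1), vandMeasure (n + 1) (powBall (n + 1) p (n + 1 : ℕ) ∩
          {x | K < |x i|}) := hU ▸ measure_iUnion_fintype_le _ _
      _ = ((n + 1 : ℕ) : ℝ≥0∞) * vandMeasure (n + 1) (powBall (n + 1) p (n + 1 : ℕ) ∩
          {x | K < |x 0|}) := by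
          rw [Finset.sum_congr rfl fun i _ => vandMeasure_outlier_eq p _ K i 0, Finset.sum_const,
            Finset.card_univ, Fintype.card_fin, nsmul_eq_mul]
      _ ≤ ENNReal.ofReal (Real.exp (Real.log (n + 2))) * (ENNReal.ofReal (Real.exp
          (((n : ℝ) + 2) / (2 * p) * (n + 1) - (A + 1) * (n + 1)) * J) *
            (ENNReal.ofReal (Real.exp (A * (n + 1))) * ENNReal.ofReal (Real.exp
              (2 + 2 * Real.log (n + 2) - (n + 1 : ℕ) * (n + 2) / (2 * p)) *
                ballVol (n + 1) p))) := by
          gcongr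
          · rw [Real.exp_log (by positivity), ← ENNReal.ofReal_natCast]
            refine ENNReal.ofReal_le_ofReal ?_
            push_cast
            linarith
          · exact h1.trans (by gcongr; exact h4.trans (by gcongr))
      _ ≤ _ := by
          rw [← ENNReal.ofReal_mul (Real.exp_pos _).le, ← ENNReal.ofReal_mul (by positivity),
            ← ENNReal.ofReal_mul (Real.exp_pos _).le, e]
          refine ENNReal.ofReal_le_ofReal ?_
          have : ∀ a b c d : ℝ, Real.exp a * (Real.exp b * J * (Real.exp c * (Real.exp d *
              ballVol (n + 1) p))) = J * Real.exp (a + b + c + d) * ballVol (n + 1) p := by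
            intro a b c d
            rw [Real.exp_add, Real.exp_add, Real.exp_add]
            ring
          rw [this]
          gcongr
          push_cast
          have e3 : ((n : ℝ) + 2) / (2 * p) * (n + 1) = (n + 1) * (n + 2) / (2 * p) := by ring
          rw [e3]
          linarith
  exact ENNReal.toReal_le_of_le_ofReal (by positivity) h5

end SymBall

namespace SymBall

/-- The part of the `p`-ball where the normalised `q`-th moment is at least `δ` away from its
limiting value. -/
def deviationSet (n : ℕ) (p q δ : ℝ) : Set (Fin n → ℝ) :=
  powBall n p n ∩ {x | δ ≤ |(∑ i, |x i| ^ q) / n - limMoment p q|}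

lemma measurableSet_deviationSet (n : ℕ) (p q δ : ℝ) : MeasurableSet (deviationSet n p q δ) :=
  (measurableSet_powBall p _).inter (measurableSet_le measurable_const (by fun_prop))

lemma tendsto_deviationSet {p q δ : ℝ} (hp : 1 ≤ p) (hq : 1 ≤ q) (hδ : 0 < δ) :
    Tendsto (fun n : ℕ => (vandMeasure n (deviationSet n p q δ)).toReal / ballVol n p) atTop
      (𝓝 0) := by
  have hb := limRadius_pos hp
  obtain ⟨K, hKb, hK1, J, hJ, hout⟩ := exists_outlier_bound hp (limRadius p)
  obtain ⟨A, hA, hdev⟩ := vand_le_of_deviation hp hq hKb hδ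
  set b := limRadius p with hb_def
  set M := 4 + 6 * (2 * q * A) + 2 * (2 * q * A) ^ 2 with hM_def
  have hM : 0 < M := by positivity
  set ρ := q * A ^ 2 with hρ_def
  have hρ : 0 < ρ := by positivity
  set ε := b / 2 * (ρ / M) ^ 2 with hε_def
  have hε : 0 < ε := by positivity
  have hs : M * √(2 * (ε / b)) = ρ := by
    have : 2 * (ε / b) = (ρ / M) ^ 2 := by
      rw [hε_def]
      field_simp
    rw [this, Real.sqrt_sq (by positivity)]
    field_simp
  have hbound : ∀ᶠ n : ℕ in atTop, (vandMeasure n (deviationSet n p q δ)).toReal / ballVol n p ≤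
      (J + 1) * Real.exp (-(1 / 2) * n) := by
    filter_upwards [eventually_gt_atTop 0, eventually_two_le_symDim_div hp,
      eventually_exp_le_ballVol hp (half_pos hρ), eventually_mul_one_add_log_le 3 one_half_pos,
      eventually_mul_mul_one_add_log_le (|Real.log (2 * K)| + |Real.log ε| / 2 + 1)
        (show 0 < ρ / 4 by positivity)] with n hn hD hV hl1 hl2
    have hn' : (1 : ℝ) ≤ n := by exact_mod_cast hn
    have hVp := ballVol_pos hp hn
    have hl : 0 ≤ Real.log (n + 1) := Real.log_nonneg (by linarith)
    set S := deviationSet n p q δ with hS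
    set T := S ∩ {x : Fin n → ℝ | ∀ i, |x i| ≤ K} with hT
    have hTm : MeasurableSet T := by
      refine (measurableSet_deviationSet n p q δ).inter ?_
      rw [Set.ofPred_forall]
      exact MeasurableSet.iInter fun i => measurableSet_le (by fun_prop) measurable_const
    have h1 := ENNReal.toReal_le_of_le_ofReal (by positivity)
      (vandMeasure_le_of_box (by linarith) hTm (fun x hx => hx.2)
        (fun x hx => hdev ε hε n hn x hx.2 hx.1.1 hx.1.2))
    have h2 : (vandMeasure n S).toReal ≤
        (vandMeasure n (powBall n p n ∩ {x | ∃ i, K < |x i|})).toReal +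
          (vandMeasure n T).toReal := by
      have hfin := vandMeasure_powBall_lt_top (n := n) hp n
      have f1 := ((measure_mono (inter_subset_left (t := {x | ∃ i, K < |x i|}))).trans_lt hfin).ne
      have f2 := ((measure_mono (show T ⊆ powBall n p n from fun x hx => hx.1.1)).trans_lt hfin).ne
      rw [← ENNReal.toReal_add f1 f2]
      refine ENNReal.toReal_mono (ENNReal.add_ne_top.2 ⟨f1, f2⟩)
        ((measure_mono fun x hx => ?_).trans (measure_union_le _ _))
      by_cases h : ∃ i, K < |x i|
      · exact Or.inl ⟨hx.1, h⟩
      · push Not at h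
        exact Or.inr ⟨hx, h⟩
    have h3 : (vandMeasure n T).toReal ≤ Real.exp (-(1 / 2) * n) * ballVol n p := by
      refine h1.trans (le_trans ?_ (mul_le_mul_of_nonneg_left hV (Real.exp_pos _).le))
      rw [← Real.exp_log (show 0 < 2 * K by linarith), ← Real.exp_nat_mul, ← Real.exp_add,
        ← Real.exp_add, Real.exp_le_exp, hs]
      have h5 : -(n * Real.log ε / 2) ≤ n * (|Real.log ε| / 2) := by
        have := mul_le_mul_of_nonneg_left (neg_le_abs (Real.log ε)) n.cast_nonneg (α := ℝ)
        linarith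
      have h6 := mul_le_mul_of_nonneg_left (le_abs_self (Real.log (2 * K))) n.cast_nonneg (α := ℝ)
      have h7 : 0 ≤ (|Real.log (2 * K)| + |Real.log ε| / 2 + 1) * n * Real.log (n + 1) := by
        positivity
      have h8 : 2 * q * A ^ 2 = 2 * ρ := by rw [hρ_def]; ring
      rw [h8]
      linarith
    have h4 : (vandMeasure n (powBall n p n ∩ {x | ∃ i, K < |x i|})).toReal ≤
        J * Real.exp (-(1 / 2) * n) * ballVol n p := by
      refine (hout n hn hD).trans ?_
      gcongr
      linarith
    rw [div_le_iff₀ hVp]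
    linarith
  refine squeeze_zero' (Eventually.of_forall fun n => div_nonneg ENNReal.toReal_nonneg
    ENNReal.toReal_nonneg) hbound ?_
  have h : Tendsto (fun n : ℕ => Real.exp (-(1 / 2) * n)) atTop (𝓝 0) :=
    Real.tendsto_exp_atBot.comp (tendsto_natCast_atTop_atTop.const_mul_atTop_of_neg (by norm_num))
  simpa using h.const_mul (J + 1)

lemma tendsto_inter_zero {p q c : ℝ} (hp : 1 ≤ p) (hq : 1 ≤ q) {a : ℕ → ℝ}
    (ha : Tendsto a atTop (𝓝 c)) (hc : c < limMoment p q) :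
    Tendsto (fun n : ℕ => (vandMeasure n (powBall n p n ∩ powBall n q (a n * n))).toReal /
      ballVol n p) atTop (𝓝 0) := by
  set δ := (limMoment p q - c) / 2 with hδ_def
  have hδ : 0 < δ := by rw [hδ_def]; linarith
  refine squeeze_zero' (Eventually.of_forall fun n => div_nonneg ENNReal.toReal_nonneg
    ENNReal.toReal_nonneg) ?_ (tendsto_deviationSet hp hq hδ)
  filter_upwards [ha.eventually_lt_const (show c < c + δ by linarith),
    eventually_gt_atTop 0] with n hn h0
  have hn' : (0 : ℝ) < n := by exact_mod_cast h0
  refine div_le_div_of_nonneg_right (ENNReal.toReal_mono ((measure_mono inter_subset_left).trans_lt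
    (vandMeasure_powBall_lt_top hp n)).ne (measure_mono fun x hx => ⟨hx.1, ?_⟩))
    ENNReal.toReal_nonneg
  have h1 : ∑ i, |x i| ^ q ≤ a n * n := hx.2
  rw [← div_le_iff₀ hn'] at h1
  rw [Set.mem_ofPred_eq, abs_sub_comm]
  refine le_trans ?_ (le_abs_self _)
  rw [hδ_def] at hn ⊢
  linarith

lemma tendsto_inter_one {p q c : ℝ} (hp : 1 ≤ p) (hq : 1 ≤ q) {a : ℕ → ℝ}
    (ha : Tendsto a atTop (𝓝 c)) (hc : limMoment p q < c) :
    Tendsto (fun n : ℕ => (vandMeasure n (powBall n p n ∩ powBall n q (a n * n))).toReal /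
      ballVol n p) atTop (𝓝 1) := by
  set δ := (c - limMoment p q) / 2 with hδ_def
  have hδ : 0 < δ := by rw [hδ_def]; linarith
  have hdev := (tendsto_deviationSet hp hq hδ).const_sub 1
  rw [sub_zero] at hdev
  refine tendsto_of_tendsto_of_tendsto_of_le_of_le' hdev tendsto_const_nhds ?_ ?_
  · filter_upwards [ha.eventually_const_lt (show c - δ < c by linarith),
      eventually_gt_atTop 0] with n hn h0
    have hn' : (0 : ℝ) < n := by exact_mod_cast h0
    have hV := ballVol_pos hp h0
    have hfin := vandMeasure_powBall_lt_top (n := n) hp n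
    have f1 := ((measure_mono (inter_subset_left (t := powBall n q (a n * n)))).trans_lt hfin).ne
    have f2 := ((measure_mono (show deviationSet n p q δ ⊆ powBall n p n from
      inter_subset_left)).trans_lt hfin).ne
    have h1 : ballVol n p ≤ (vandMeasure n (powBall n p n ∩ powBall n q (a n * n))).toReal +
        (vandMeasure n (deviationSet n p q δ)).toReal := by
      rw [← ENNReal.toReal_add f1 f2]
      refine ENNReal.toReal_mono (ENNReal.add_ne_top.2 ⟨f1, f2⟩)
        ((measure_mono fun x hx => ?_).trans (measure_union_le _ _))
      by_cases h : x ∈ powBall n q (a n * n)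
      · exact Or.inl ⟨hx, h⟩
      · refine Or.inr ⟨hx, ?_⟩
        have h2 : a n * n < ∑ i, |x i| ^ q := not_le.1 h
        rw [← lt_div_iff₀ hn'] at h2
        have h3 : δ ≤ (∑ i, |x i| ^ q) / n - limMoment p q := by
          rw [hδ_def] at hn ⊢
          linarith
        exact h3.trans (le_abs_self _)
    rw [sub_le_iff_le_add, ← add_div, one_le_div hV]
    exact h1
  · refine Eventually.of_forall fun n => div_le_one_of_le₀ ?_ ENNReal.toReal_nonneg
    exact ENNReal.toReal_mono (vandMeasure_powBall_lt_top hp n).ne (measure_mono inter_subset_left)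

lemma tendsto_scale {p q t : ℝ} (hp : 1 ≤ p) (hq : 1 ≤ q) :
    Tendsto (fun n : ℕ => (t * (ballVol n p / ballVol n q) ^ (1 / (symDim n : ℝ))) ^ q) atTop
      (𝓝 ((t * (Real.exp (limEnergy p) / Real.exp (limEnergy q))) ^ q)) := by
  have h := (((tendsto_ballVol_rpow hp).div (tendsto_ballVol_rpow hq)
    (Real.exp_pos _).ne').const_mul t).rpow_const (p := q) (Or.inr (by linarith))
  refine h.congr fun n => ?_
  have e : (ballVol n p / ballVol n q) ^ (1 / (symDim n : ℝ)) =
      ballVol n p ^ (1 / (symDim n : ℝ)) / ballVol n q ^ (1 / (symDim n : ℝ)) :=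
    Real.div_rpow ENNReal.toReal_nonneg ENNReal.toReal_nonneg _
  rw [e]
  rfl

lemma limMoment_eq {p q : ℝ} (hp : 1 ≤ p) (hq : 1 ≤ q) :
    limMoment p q = (Real.exp (1 / (2 * p) - 1 / (2 * q)) * (2 * p / (p + q)) ^ (1 / q) *
      (Real.exp (limEnergy p) / Real.exp (limEnergy q))) ^ q := by
  have hp0 : 0 < p := by linarith
  have hq0 : 0 < q := by linarith
  have hbp := limRadius_pos hp
  have hbq := limRadius_pos hq
  have hm := cosMoment_pos hq
  have hE : ∀ r, 1 ≤ r → Real.exp (limEnergy r) =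
      limRadius r / 2 * Real.exp (-(1 / (2 * r))) := fun r hr => by
    have := limRadius_pos hr
    rw [limEnergy, sub_eq_add_neg, Real.exp_add, Real.exp_log (by positivity)]
  have h1 : Real.exp (1 / (2 * p) - 1 / (2 * q)) * (2 * p / (p + q)) ^ (1 / q) *
      (Real.exp (limEnergy p) / Real.exp (limEnergy q)) =
      limRadius p / limRadius q * (2 * p / (p + q)) ^ (1 / q) := by
    rw [hE p hp, hE q hq, Real.exp_neg, Real.exp_neg, Real.exp_sub]
    field_simp
  rw [h1, Real.mul_rpow (by positivity) (by positivity), ← Real.rpow_mul (by positivity),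
    one_div_mul_cancel hq0.ne', Real.rpow_one, Real.div_rpow hbp.le hbq.le, limRadius_rpow hq,
    limMoment]
  field_simp

end SymBall

/-- Schechtman–Schmuckenschläger in the non-commutative (symmetric matrix) setting:
`vol(𝔻_p^{n,sym} ∩ t 𝔻_q^{n,sym})` converges to `0` if
`t < e^{1/(2p) − 1/(2q)} (2p/(p+q))^{1/q}` and to `1` if
`t > e^{1/(2p) − 1/(2q)} (2p/(p+q))^{1/q}`. -/
theorem volume_intersection_symmetric_matrix_balls
    (p q : ℝ) (hp : 1 ≤ p) (hq : 1 ≤ q) (hpq : p ≠ q) (t : ℝ) (ht : 0 < t) :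
    (t < Real.exp (1 / (2 * p) - 1 / (2 * q)) * (2 * p / (p + q)) ^ (1 / q) →
      Tendsto (fun n : ℕ => (symVol n (symNBall n p ∩ t • symNBall n q)).toReal)
        atTop (𝓝 0)) ∧
    (Real.exp (1 / (2 * p) - 1 / (2 * q)) * (2 * p / (p + q)) ^ (1 / q) < t →
      Tendsto (fun n : ℕ => (symVol n (symNBall n p ∩ t • symNBall n q)).toReal)
        atTop (𝓝 1)) := by
  have hE : 0 < Real.exp (SymBall.limEnergy p) / Real.exp (SymBall.limEnergy q) := by positivity
  have hθ : 0 < Real.exp (1 / (2 * p) - 1 / (2 * q)) * (2 * p / (p + q)) ^ (1 / q) := by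
    have : 0 < 2 * p / (p + q) := by apply div_pos <;> linarith
    positivity
  have hq0 : 0 < q := by linarith
  have hscale := SymBall.tendsto_scale (t := t) hp hq
  have hsym : ∀ᶠ n : ℕ in atTop, _ = _ := (eventually_gt_atTop 0).mono fun n hn =>
    (SymBall.symVol_inter_eq (n := n) hp hq ht hn).symm
  refine ⟨fun h => ?_, fun h => ?_⟩
  · refine (SymBall.tendsto_inter_zero hp hq hscale ?_).congr' hsym
    rw [SymBall.limMoment_eq hp hq]
    exact Real.rpow_lt_rpow (by positivity) (mul_lt_mul_of_pos_right h hE) hq0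
  · refine (SymBall.tendsto_inter_one hp hq hscale ?_).congr' hsym
    rw [SymBall.limMoment_eq hp hq]
    exact Real.rpow_lt_rpow (by positivity) (mul_lt_mul_of_pos_right h hE) hq0
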